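/- (Vector-valued Littlewood–Paley for operator densities) Let 1/2 < r, r̃ < ∞, let (λ_k)_{k=1}^m be positive reals and (u_k)_{k=1}^m ⊂ L^{2r}_x L^{2r̃}_y(𝕋^{d−k} × 𝕋^k). Then there is C > 1, independent of m, (λ_k), (u_k), such that C^{−1} ‖ ∑_{k} λ_k |u_k|² ‖_{L^r_x L^{r̃}_y} ≤ ‖ ∑_{N ∈ 2^ℕ} ∑_{k} λ_k |P_N u_k|² ‖_{L^r_x L^{r̃}_y} ≤ C ‖ ∑_{k} λ_k |u_k|² ‖_{L^r_x L^{r̃}_y}. -/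

import Mathlib

open MeasureTheory Complex Finset
open scoped ENNReal Real ComplexConjugate

noncomputable section

/-- Mixed-norm building block: the `L^p` "norm" (`p ∈ [1,∞]`) of an
`ℝ≥0∞`-valued function, with the convention `essSup` for `p = ∞`. -/
def eNorm {α : Type*} [MeasurableSpace α] (p : ℝ≥0∞) (μ : Measure α) (g : α → ℝ≥0∞) : ℝ≥0∞ :=
  if p = ∞ then essSup g μ else (∫⁻ a, g a ^ p.toReal ∂μ) ^ (1 / p.toReal)

/-- The `m`-dimensional torus `𝕋^m = (ℝ/ℤ)^m`. -/
abbrev Torus (m : ℕ) := Fin m → AddCircle (1 : ℝ)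

/-- The character `z ↦ e^{2πi z·ξ}` on `𝕋^m`. -/
def eChar {m : ℕ} (ξ : Fin m → ℤ) (z : Torus m) : ℂ := ∏ i, fourier (ξ i) (z i)

/-- Fourier coefficient of a function on the product torus `𝕋^m × 𝕋^k`. -/
def fcoef {m k : ℕ} (f : Torus m × Torus k → ℂ) (ξ : (Fin m → ℤ) × (Fin k → ℤ)) : ℂ :=
  ∫ z : Torus m × Torus k, f z * conj (eChar ξ.1 z.1 * eChar ξ.2 z.2)

/-- The frequency box `ℤ^m ∩ [-N,N]^m`. -/
def box (m N : ℕ) : Finset (Fin m → ℤ) :=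
  Finset.Icc (fun _ => -(N : ℤ)) (fun _ => (N : ℤ))

/-- The mixed norm `‖f‖_{L^r_x L^s_y}` on `𝕋^m × 𝕋^k`, valued in `ℝ≥0∞`. -/
def mixedNorm {m k : ℕ} (r s : ℝ≥0∞) (f : Torus m × Torus k → ℂ) : ℝ≥0∞ :=
  eNorm r volume (fun x => eNorm s volume (fun y => (‖f (x, y)‖₊ : ℝ≥0∞)))

/-- The frequency-truncated Schrödinger propagator `e^{-itΔ}P_{≤N} f` on `𝕋^m × 𝕋^k`,
given on the Fourier side by multiplication with `e^{2πit|ξ|²} 𝟙_{[-N,N]^d}(ξ)`. -/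
def prp {m k : ℕ} (N : ℕ) (t : ℝ) (f : Torus m × Torus k → ℂ)
    (z : Torus m × Torus k) : ℂ :=
  ∑ ξ₁ ∈ box m N, ∑ ξ₂ ∈ box k N,
    fcoef f (ξ₁, ξ₂) *
      Complex.exp (2 * Real.pi * I * t * ((∑ i, (ξ₁ i : ℝ) ^ 2) + ∑ i, (ξ₂ i : ℝ) ^ 2)) *
      (eChar ξ₁ z.1 * eChar ξ₂ z.2)

/-- Euclidean length of a point of `ℝ^m × ℝ^k`. -/
def eLen {m k : ℕ} (v : (Fin m → ℝ) × (Fin k → ℝ)) : ℝ :=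
  Real.sqrt ((∑ i, v.1 i ^ 2) + ∑ i, v.2 i ^ 2)

/-- Coercion of a lattice point of `ℤ^m × ℤ^k` into `ℝ^m × ℝ^k`. -/
def latCoe {m k : ℕ} (ξ : (Fin m → ℤ) × (Fin k → ℤ)) : (Fin m → ℝ) × (Fin k → ℝ) :=
  (fun i => (ξ.1 i : ℝ), fun i => (ξ.2 i : ℝ))

/-- `φ` is an admissible smooth Littlewood–Paley cutoff: smooth, even, `[0,1]`-valued,
equal to `1` on the (Euclidean) unit ball and vanishing outside the ball of radius 2. -/
structure IsLPCutoff {m k : ℕ} (φ : (Fin m → ℝ) × (Fin k → ℝ) → ℝ) : Prop where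
  smooth : ContDiff ℝ (⊤ : ℕ∞) φ
  even : ∀ v, φ (-v) = φ v
  mem_Icc : ∀ v, φ v ∈ Set.Icc (0 : ℝ) 1
  eq_one : ∀ v, eLen v ≤ 1 → φ v = 1
  eq_zero : ∀ v, 2 ≤ eLen v → φ v = 0

/-- The dyadic symbol `ψ_N` with `N = 2^j`: `ψ_{2^0} = φ` and
`ψ_{2^j}(ξ) = φ(ξ/2^j) - φ(ξ/2^{j-1})` for `j ≥ 1`, evaluated at lattice points. -/
def psiCut {m k : ℕ} (φ : (Fin m → ℝ) × (Fin k → ℝ) → ℝ) (j : ℕ)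
    (ξ : (Fin m → ℤ) × (Fin k → ℤ)) : ℝ :=
  if j = 0 then φ (latCoe ξ)
  else φ (((2 : ℝ) ^ j)⁻¹ • latCoe ξ) - φ (((2 : ℝ) ^ (j - 1))⁻¹ • latCoe ξ)

/-- The Littlewood–Paley projector `P_{2^j}` on `𝕋^m × 𝕋^k` built from `φ`. -/
def lpProj {m k : ℕ} (φ : (Fin m → ℝ) × (Fin k → ℝ) → ℝ) (j : ℕ)
    (f : Torus m × Torus k → ℂ) (z : Torus m × Torus k) : ℂ :=
  ∑' ξ : (Fin m → ℤ) × (Fin k → ℤ),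
    (psiCut φ j ξ : ℂ) * fcoef f ξ * (eChar ξ.1 z.1 * eChar ξ.2 z.2)

set_option linter.unusedSectionVars false
set_option linter.unusedVariables false
set_option linter.unusedSimpArgs false

lemma lint_pow_lt (p : ℝ) (hp : 0 < p) (t : ℝ) (ht : 0 ≤ t) :
    ∫⁻ l in Set.Ioi (0:ℝ), (if l < t then ENNReal.ofReal (l^(p-1)) else 0)
      = ENNReal.ofReal (t^p/p) := by
  have h1 : ∀ l : ℝ, (if l < t then ENNReal.ofReal (l^(p-1)) else 0)
      = (Set.Iio t).indicator (fun l => ENNReal.ofReal (l^(p-1))) l := by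
    intro l; simp [Set.indicator_apply]
  simp_rw [h1]
  rw [lintegral_indicator measurableSet_Iio, Measure.restrict_restrict measurableSet_Iio]
  have h2 : Set.Iio t ∩ Set.Ioi 0 = Set.Ioo 0 t := by ext; simp [and_comm]
  rw [h2]
  have hIntg : IntervalIntegrable (fun l : ℝ => l^(p-1)) volume 0 t :=
    intervalIntegral.intervalIntegrable_rpow' (by linarith)
  rw [intervalIntegrable_iff_integrableOn_Ioo_of_le ht] at hIntg
  rw [← ofReal_integral_eq_lintegral_ofReal hIntg]
  · congr 1
    rw [← integral_Ioc_eq_integral_Ioo, ← intervalIntegral.integral_of_le ht,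
      integral_rpow (Or.inl (by linarith))]
    simp [Real.zero_rpow hp.ne']
  · refine (ae_restrict_iff' measurableSet_Ioo).2 (Filter.Eventually.of_forall ?_)
    intro x hx; exact Real.rpow_nonneg hx.1.le _

lemma lint_pow_ge (s : ℝ) (hs : 0 < s) (t : ℝ) (ht : 0 < t) :
    ∫⁻ l in Set.Ioi (0:ℝ), (if l < t then 0 else ENNReal.ofReal (l^(-s-1)))
      = ENNReal.ofReal (t^(-s)/s) := by
  have h1 : ∀ l : ℝ, (if l < t then 0 else ENNReal.ofReal (l^(-s-1)))
      = (Set.Ici t).indicator (fun l => ENNReal.ofReal (l^(-s-1))) l := by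
    intro l
    by_cases h : l < t
    · simp [h]
    · simp [h, not_lt.1 h]
  simp_rw [h1]
  rw [lintegral_indicator measurableSet_Ici, Measure.restrict_restrict measurableSet_Ici]
  have h2 : Set.Ici t ∩ Set.Ioi 0 = Set.Ici t := by
    ext x; simp only [Set.mem_inter_iff, Set.mem_Ici, Set.mem_Ioi, and_iff_left_iff_imp]
    intro h; linarith
  rw [h2, setLIntegral_congr Ioi_ae_eq_Ici.symm]
  have hIntg : IntegrableOn (fun l : ℝ => l^(-s-1)) (Set.Ioi t) :=
    integrableOn_Ioi_rpow_of_lt (by linarith) ht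
  rw [← ofReal_integral_eq_lintegral_ofReal hIntg]
  · congr 1
    rw [integral_Ioi_rpow_of_lt (by linarith) ht]
    rw [show -s - 1 + 1 = -s by ring, neg_div_neg_eq]
  · refine (ae_restrict_iff' measurableSet_Ioi).2 (Filter.Eventually.of_forall ?_)
    intro x hx; exact Real.rpow_nonneg (ht.le.trans (le_of_lt hx)) _

/-- Integration of distributional inequalities on a finite set. -/
lemma layercake {X : Type*} [Fintype X] (p q c1 c2 c3 : ℝ) (hp : 1 < p) (hpq : p < q)
    (h1 : 0 ≤ c1) (h2 : 0 ≤ c2) (h3 : 0 ≤ c3) (a M : X → ℝ) (ha : ∀ x, 0 ≤ a x)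
    (hM : ∀ x, 0 ≤ M x)
    (h : ∀ l : ℝ, 0 < l → ∑ x, (if 2 * l < a x then (1:ℝ) else 0) ≤
      ∑ x, (if l < M x then c1 + c3 * l⁻¹ * M x else c2 * l^(-q) * (M x)^q)) :
    ∑ x, (a x)^p ≤ 2^p * (c1 + c2 * p / (q-p) + c3 * p / (p-1)) * ∑ x, (M x)^p := by
  have hp0 : 0 < p := by linarith
  have key : ∑ x, ENNReal.ofReal ((a x / 2)^p / p) ≤
      ∑ x, ENNReal.ofReal ((c1/p + c2/(q-p) + c3/(p-1)) * (M x)^p) := by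
    have e1 : ∀ x, ENNReal.ofReal ((a x / 2)^p / p) =
        ∫⁻ l in Set.Ioi (0:ℝ), (if l < a x / 2 then ENNReal.ofReal (l^(p-1)) else 0) := by
      intro x; rw [lint_pow_lt p hp0 _ (by have := ha x; positivity)]
    have mm : ∀ (t : ℝ) (u v : ℝ → ℝ≥0∞), Measurable u → Measurable v →
        Measurable (fun l : ℝ => if l < t then u l else v l) := by
      intro t u v hu hv
      exact Measurable.ite measurableSet_Iio hu hv
    have mp : ∀ e : ℝ, Measurable (fun l : ℝ => ENNReal.ofReal (l^e)) := by
      intro e; fun_prop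
    simp_rw [e1]
    rw [← lintegral_finsetSum _ (fun x _ => mm _ _ _ (mp _) measurable_const)]
    calc _ ≤ ∫⁻ l in Set.Ioi (0:ℝ), ∑ x, (ENNReal.ofReal c1 * (if l < M x then ENNReal.ofReal (l^(p-1)) else 0)
          + ENNReal.ofReal (c3 * M x) * (if l < M x then ENNReal.ofReal (l^(p-1-1)) else 0)
          + ENNReal.ofReal (c2 * (M x)^q) * (if l < M x then 0 else ENNReal.ofReal (l^(-(q-p)-1)))) := by
          apply setLIntegral_mono' measurableSet_Ioi
          intro l hl
          have hl : 0 < l := hl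
          have hh := h l hl
          have hlp : 0 ≤ l^(p-1) := Real.rpow_nonneg hl.le _
          have := mul_le_mul_of_nonneg_left hh hlp
          have e2 : ∑ x, (if l < a x / 2 then ENNReal.ofReal (l^(p-1)) else 0) =
              ENNReal.ofReal (l^(p-1) * ∑ x, (if 2 * l < a x then (1:ℝ) else 0)) := by
            rw [Finset.mul_sum, ENNReal.ofReal_sum_of_nonneg]
            · refine Finset.sum_congr rfl fun x _ => ?_
              have : l < a x / 2 ↔ 2 * l < a x := by constructor <;> intro <;> linarith
              simp only [this]; split_ifs <;> simp
            · intro x _; split_ifs <;> simp [hlp]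
          rw [e2]
          refine (ENNReal.ofReal_le_ofReal this).trans ?_
          rw [Finset.mul_sum, ENNReal.ofReal_sum_of_nonneg]
          · refine Finset.sum_le_sum fun x _ => ?_
            split_ifs with hx
            · simp only [mul_zero, add_zero]
              rw [← ENNReal.ofReal_mul h1, ← ENNReal.ofReal_mul (mul_nonneg h3 (hM x)),
                ← ENNReal.ofReal_add (by positivity) (by have := hM x; positivity)]
              apply ENNReal.ofReal_le_ofReal
              rw [Real.rpow_sub_one hl.ne' (p-1)]
              apply le_of_eq; field_simp
            · simp only [mul_zero, zero_add]
              rw [← ENNReal.ofReal_mul (mul_nonneg h2 (Real.rpow_nonneg (hM x) _))]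
              apply ENNReal.ofReal_le_ofReal
              rw [show -(q-p)-1 = (p-1) + (-q) by ring, Real.rpow_add hl]
              apply le_of_eq; ring
          · intro x _
            have := hM x
            split_ifs <;> positivity
      _ ≤ _ := by
          rw [lintegral_finsetSum]
          swap
          · intro x _
            exact (((mm _ _ _ (mp _) measurable_const).const_mul _).add
              ((mm _ _ _ (mp _) measurable_const).const_mul _)).add
              ((mm _ _ _ measurable_const (mp _)).const_mul _)
          refine Finset.sum_le_sum fun x _ => ?_
          rw [lintegral_add_right _ ((mm _ _ _ measurable_const (mp _)).const_mul _),
            lintegral_add_right _ ((mm _ _ _ (mp _) measurable_const).const_mul _),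
            lintegral_const_mul _ (mm _ _ _ (mp _) measurable_const),
            lintegral_const_mul _ (mm _ _ _ (mp _) measurable_const),
            lintegral_const_mul _ (mm _ _ _ measurable_const (mp _)),
            lint_pow_lt p hp0 _ (hM x), lint_pow_lt (p-1) (by linarith) _ (hM x)]
          have hqp : 0 < q - p := by linarith
          have hp1 : 0 < p - 1 := by linarith
          rcases (hM x).eq_or_lt with h0 | h0
          · rw [← h0]
            simp [Real.zero_rpow hp0.ne', Real.zero_rpow (show q ≠ 0 by linarith)]
          · rw [lint_pow_ge _ hqp _ h0, ← ENNReal.ofReal_mul h1, ← ENNReal.ofReal_mul (by positivity),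
              ← ENNReal.ofReal_mul (by positivity), ← ENNReal.ofReal_add (by positivity) (by positivity),
              ← ENNReal.ofReal_add (by positivity) (by positivity)]
            apply ENNReal.ofReal_le_ofReal
            apply le_of_eq
            have a1 : (M x)^(-(q-p)) = (M x)^p / (M x)^q := by
              rw [← Real.rpow_sub h0]; congr 1; ring
            rw [a1, Real.rpow_sub_one h0.ne']
            have : (M x)^q ≠ 0 := by positivity
            field_simp
            ring
  have hqp : 0 < q - p := by linarith
  have hp1 : 0 < p - 1 := by linarith
  rw [← ENNReal.ofReal_sum_of_nonneg, ← ENNReal.ofReal_sum_of_nonneg,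
    ENNReal.ofReal_le_ofReal_iff, ← Finset.mul_sum] at key
  · have e3 : ∑ x, (a x / 2)^p / p = (∑ x, (a x)^p) / (2^p * p) := by
      rw [Finset.sum_div]
      refine Finset.sum_congr rfl fun x _ => ?_
      rw [Real.div_rpow (ha x) (by norm_num)]; field_simp
    rw [e3, div_le_iff₀ (by positivity)] at key
    refine key.trans (le_of_eq ?_)
    field_simp
  · refine Finset.sum_nonneg fun x _ => ?_
    have := hM x; positivity
  · intro x _; have := hM x; positivity
  · intro x _; have := ha x; positivity

/-- A dyadic tree structure on a finite set, with stars. -/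
structure CZTree (X β : Type*) [Fintype X] [DecidableEq β] (D : ℝ) where
  n : ℕ
  pr : ℕ → X → β
  S : ℕ → β → Finset X
  h0 : ∀ x y, pr 0 x = pr 0 y
  nest : ∀ l x y, pr (l+1) x = pr (l+1) y → pr l x = pr l y
  inj : ∀ x y, pr n x = pr n y → x = y
  doub : ∀ l x, l < n → (#{y | pr l y = pr l x} : ℝ) ≤ D * #{y | pr (l+1) y = pr (l+1) x}
  star : ∀ l x, l ≤ n → (#(S l (pr l x)) : ℝ) ≤ D * #{y | pr l y = pr l x}

namespace CZTree

variable {X β : Type*} [Fintype X] [DecidableEq β] {D : ℝ} (t : CZTree X β D)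

def cell (l : ℕ) (x : X) : Finset X := {y | t.pr l y = t.pr l x}

lemma mem_cell (l : ℕ) (x y : X) : y ∈ t.cell l x ↔ t.pr l y = t.pr l x := by simp [cell]

lemma nest_le {l l' : ℕ} (h : l ≤ l') (x y : X) (hxy : t.pr l' x = t.pr l' y) : t.pr l x = t.pr l y := by
  induction l', h using Nat.le_induction with
  | base => exact hxy
  | succ k hk ih => exact ih (t.nest _ _ _ hxy)

lemma card_pos (l : ℕ) (x : X) : (0:ℝ) < #(t.cell l x) := by
  have : 0 < #(t.cell l x) := Finset.card_pos.2 ⟨x, by simp [mem_cell]⟩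
  exact_mod_cast this

lemma cell_congr {l : ℕ} {x y : X} (h : t.pr l x = t.pr l y) : t.cell l x = t.cell l y := by
  ext z; simp [mem_cell, h]

variable {E : Type*} [NormedAddCommGroup E] [NormedSpace ℝ E]

def avg (l : ℕ) (f : X → E) (x : X) : E := (#(t.cell l x) : ℝ)⁻¹ • ∑ y ∈ t.cell l x, f y

lemma avg_congr {l : ℕ} (f : X → E) {x y : X} (h : t.pr l x = t.pr l y) : t.avg l f x = t.avg l f y := by
  simp [avg, t.cell_congr h]

lemma sum_avg (l : ℕ) (f : X → E) (x : X) : ∑ y ∈ t.cell l x, t.avg l f y = ∑ y ∈ t.cell l x, f y := by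
  have : ∀ y ∈ t.cell l x, t.avg l f y = t.avg l f x := fun y hy => t.avg_congr f ((t.mem_cell _ _ _).1 hy)
  rw [Finset.sum_congr rfl this, Finset.sum_const, avg, ← Nat.cast_smul_eq_nsmul ℝ, smul_smul,
    mul_inv_cancel₀ (t.card_pos l x).ne', one_smul]

lemma norm_avg_le (l : ℕ) (f : X → E) (x : X) : ‖t.avg l f x‖ ≤ t.avg l (fun y => ‖f y‖) x := by
  unfold avg
  rw [norm_smul, smul_eq_mul, Real.norm_of_nonneg (by positivity)]
  gcongr
  exact norm_sum_le _ _

lemma avg_n (f : X → E) (x : X) : t.avg t.n f x = f x := by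
  have : t.cell t.n x = {x} := by
    ext y; simp only [mem_cell, Finset.mem_singleton]
    exact ⟨t.inj _ _, fun h => by rw [h]⟩
  simp [avg, this]

lemma avg_nonneg (l : ℕ) (f : X → ℝ) (hf : ∀ x, 0 ≤ f x) (x : X) : 0 ≤ t.avg l f x := by
  unfold avg
  exact smul_nonneg (by positivity) (Finset.sum_nonneg fun y _ => hf y)

lemma avg_doub (l : ℕ) (hl : l < t.n) (f : X → ℝ) (hf : ∀ x, 0 ≤ f x) (x : X) :
    t.avg (l+1) f x ≤ D * t.avg l f x := by
  unfold avg
  have h1 := t.card_pos l x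
  have h2 := t.card_pos (l+1) x
  have h3 : (#(t.cell l x) : ℝ) ≤ D * #(t.cell (l+1) x) := t.doub l x hl
  have h4 : ∑ y ∈ t.cell (l+1) x, f y ≤ ∑ y ∈ t.cell l x, f y := by
    apply Finset.sum_le_sum_of_subset_of_nonneg
    · intro y; simp only [mem_cell]; exact t.nest _ _ _
    · intro y _ _; exact hf y
  have h5 : 0 ≤ ∑ y ∈ t.cell (l+1) x, f y := Finset.sum_nonneg fun y _ => hf y
  simp only [smul_eq_mul]
  rw [inv_mul_le_iff₀ h2]
  calc _ ≤ ∑ y ∈ t.cell l x, f y := h4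
    _ = (#(t.cell l x) : ℝ) * ((#(t.cell l x) : ℝ)⁻¹ * ∑ y ∈ t.cell l x, f y) := by field_simp
    _ ≤ (D * #(t.cell (l+1) x)) * ((#(t.cell l x) : ℝ)⁻¹ * ∑ y ∈ t.cell l x, f y) := by
        gcongr
        exact mul_nonneg (by positivity) (h5.trans h4)
    _ = _ := by ring

/-- martingale maximal function -/
def mx (f : X → ℝ) (x : X) : ℝ := (Finset.range (t.n+1)).sup' Finset.nonempty_range_add_one (fun l => t.avg l f x)

lemma lt_mx (f : X → ℝ) (x : X) (a : ℝ) : a < t.mx f x ↔ ∃ l, l ≤ t.n ∧ a < t.avg l f x := by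
  unfold mx
  rw [Finset.lt_sup'_iff]
  simp [Nat.lt_succ_iff]

lemma le_mx (f : X → ℝ) (x : X) : f x ≤ t.mx f x := by
  rw [← t.avg_n f x]
  exact Finset.le_sup' (f := fun l => t.avg l f x) (by simp)

lemma avg_zero_le_mx (f : X → ℝ) (x : X) : t.avg 0 f x ≤ t.mx f x :=
  Finset.le_sup' (f := fun l => t.avg l f x) (by simp)

open Classical in
/-- stopping time -/
def stm (f : X → ℝ) (a : ℝ) (x : X) : ℕ :=
  if h : ∃ l, l ≤ t.n ∧ a < t.avg l f x then Nat.find h else 0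

lemma stm_spec (f : X → ℝ) (a : ℝ) (x : X) (h : a < t.mx f x) :
    t.stm f a x ≤ t.n ∧ a < t.avg (t.stm f a x) f x := by
  classical
  rw [lt_mx] at h
  simp only [stm, dif_pos h]
  exact Nat.find_spec h

lemma stm_min (f : X → ℝ) (a : ℝ) (x : X) (h : a < t.mx f x) (l : ℕ) (hl : l < t.stm f a x) :
    t.avg l f x ≤ a := by
  classical
  have h1 := (t.stm_spec f a x h).1
  rw [lt_mx] at h
  simp only [stm, dif_pos h] at hl h1
  have := Nat.find_min h hl
  by_contra h'
  exact this ⟨by omega, by linarith⟩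

lemma stm_congr (f : X → ℝ) (a : ℝ) (x y : X) (h : a < t.mx f x)
    (hxy : t.pr (t.stm f a x) y = t.pr (t.stm f a x) x) :
    a < t.mx f y ∧ t.stm f a y = t.stm f a x := by
  have h1 := t.stm_spec f a x h
  have hy : a < t.mx f y := by
    rw [lt_mx]; exact ⟨_, h1.1, by rw [t.avg_congr f hxy]; exact h1.2⟩
  refine ⟨hy, le_antisymm ?_ ?_⟩
  · by_contra hc
    push Not at hc
    have := t.stm_min f a y hy _ hc
    rw [t.avg_congr f hxy] at this
    linarith [h1.2]
  · by_contra hc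
    push Not at hc
    have := t.stm_min f a x h _ hc
    rw [← t.avg_congr f (t.nest_le hc.le _ _ hxy)] at this
    linarith [(t.stm_spec f a y hy).2]

def lab (f : X → ℝ) (a : ℝ) (x : X) : ℕ × β := (t.stm f a x, t.pr (t.stm f a x) x)

lemma fiber (f : X → ℝ) (a : ℝ) (x : X) (h : a < t.mx f x) :
    ({y | a < t.mx f y} : Finset X).filter (fun y => t.lab f a y = t.lab f a x) = t.cell (t.stm f a x) x := by
  ext y
  simp only [Finset.mem_filter, Finset.mem_univ, true_and, mem_cell, lab, Prod.mk.injEq]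
  constructor
  · rintro ⟨_, h1, h2⟩; rw [h1] at h2; exact h2
  · intro hxy
    obtain ⟨h1, h2⟩ := t.stm_congr f a x y h hxy
    exact ⟨h1, h2, by rw [h2]; exact hxy⟩

/-- sums over stopped averages, on each fiber -/
lemma sum_stm_fiber (f : X → ℝ) (a : ℝ) (g : X → E) (x : X) (h : a < t.mx f x) :
    ∑ y ∈ ({y | a < t.mx f y} : Finset X).filter (fun y => t.lab f a y = t.lab f a x), t.avg (t.stm f a y) g y
    = ∑ y ∈ ({y | a < t.mx f y} : Finset X).filter (fun y => t.lab f a y = t.lab f a x), g y := by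
  rw [fiber t f a x h, ← t.sum_avg _ g]
  apply Finset.sum_congr rfl
  intro y hy
  rw [mem_cell] at hy
  rw [(t.stm_congr f a x y h hy).2]

lemma sum_stm (f : X → ℝ) (a : ℝ) (g : X → E) :
    ∑ y ∈ ({y | a < t.mx f y} : Finset X), t.avg (t.stm f a y) g y
    = ∑ y ∈ ({y | a < t.mx f y} : Finset X), g y := by
  classical
  rw [← Finset.sum_fiberwise_of_maps_to (t := Finset.image (t.lab f a) {y | a < t.mx f y}) (g := t.lab f a)
    (fun x hx => Finset.mem_image_of_mem _ hx), 
    ← Finset.sum_fiberwise_of_maps_to (t := Finset.image (t.lab f a) {y | a < t.mx f y}) (g := t.lab f a)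
    (f := g) (fun x hx => Finset.mem_image_of_mem _ hx)]
  apply Finset.sum_congr rfl
  intro c hc
  obtain ⟨x, hx, rfl⟩ := Finset.mem_image.1 hc
  exact t.sum_stm_fiber f a g x (by simpa using hx)

lemma doob (p : ℝ) (hp : 1 < p) (f : X → ℝ) (hf : ∀ x, 0 ≤ f x) :
    ∑ x, (t.mx f x)^p ≤ 2^p * (p/(p-1)) * ∑ x, (f x)^p := by
  have hm : ∀ x, 0 ≤ t.mx f x := fun x => (hf x).trans (t.le_mx f x)
  have := layercake p (p+1) 0 0 1 hp (by linarith) le_rfl le_rfl zero_le_one (t.mx f) f hm hf ?_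
  · simpa using this
  intro l hl
  have h1 : ∑ y ∈ ({y | 2*l < t.mx f y} : Finset X), 2*l ≤ ∑ y ∈ ({y | 2*l < t.mx f y} : Finset X), f y := by
    rw [← t.sum_stm f (2*l) f]
    apply Finset.sum_le_sum
    intro y hy
    exact (t.stm_spec f (2*l) y (by simpa using hy)).2.le
  have h2 : ∑ y ∈ ({y | 2*l < t.mx f y} : Finset X), l ≤ ∑ y ∈ ({y | 2*l < t.mx f y} : Finset X), (if l < f y then f y else 0) := by
    have h3 : ∑ y ∈ ({y | 2*l < t.mx f y} : Finset X), f y ≤ ∑ y ∈ ({y | 2*l < t.mx f y} : Finset X), (l + if l < f y then f y else 0) := by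
      apply Finset.sum_le_sum
      intro y _
      split_ifs <;> linarith
    rw [Finset.sum_add_distrib] at h3
    have h4 : ∑ y ∈ ({y | 2*l < t.mx f y} : Finset X), 2*l = ∑ y ∈ ({y | 2*l < t.mx f y} : Finset X), l + ∑ y ∈ ({y | 2*l < t.mx f y} : Finset X), l := by
      rw [← Finset.sum_add_distrib]; simp [two_mul]
    linarith
  have h5 : ∑ y ∈ ({y | 2*l < t.mx f y} : Finset X), (if l < f y then f y else 0) ≤ ∑ y, (if l < f y then f y else 0) := by
    apply Finset.sum_le_sum_of_subset_of_nonneg (Finset.subset_univ _)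
    intro y _ _; split_ifs
    · exact hf y
    · exact le_rfl
  have h6 : ∑ x, (if 2 * l < t.mx f x then (1:ℝ) else 0) = l⁻¹ * ∑ y ∈ ({y | 2*l < t.mx f y} : Finset X), l := by
    rw [Finset.sum_const, Finset.sum_ite, Finset.sum_const, Finset.sum_const_zero]
    simp only [nsmul_eq_mul]; field_simp; ring
  rw [h6]
  calc _ ≤ l⁻¹ * ∑ y, (if l < f y then f y else 0) := by gcongr; exact h2.trans h5
    _ = _ := by
      rw [Finset.mul_sum]; apply Finset.sum_congr rfl
      intro y _; split_ifs <;> simp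

end CZTree

lemma cz_weak {X β : Type*} [Fintype X] [DecidableEq X] [DecidableEq β] {D : ℝ} (t : CZTree X β D) (hD : 1 ≤ D)
    {E : Type*} [NormedAddCommGroup E] [NormedSpace ℝ E] (T : (X → E) →ₗ[ℝ] (X → E))
    (q A B : ℝ) (hq : 1 < q) (hA : 0 ≤ A) (hB : 0 ≤ B)
    (hT : ∀ f, ∑ x, ‖T f x‖^q ≤ A * ∑ x, ‖f x‖^q)
    (hH : ∀ (l : ℕ) (x0 : X) (b : X → E), l ≤ t.n → (∀ x, t.pr l x ≠ t.pr l x0 → b x = 0) → ∑ x, b x = 0 →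
      ∑ x, (if x ∈ t.S l (t.pr l x0) then 0 else ‖T b x‖) ≤ B * ∑ x, ‖b x‖)
    (f : X → E) (l : ℝ) (hl : 0 < l) :
    ∑ x, (if 2 * l < ‖T f x‖ then (1:ℝ) else 0) ≤
      ∑ x, (if l < t.mx (fun x => ‖f x‖) x then (1 + A * D^q + D + B * D) + B * l⁻¹ * t.mx (fun x => ‖f x‖) x
        else A * l^(-q) * (t.mx (fun x => ‖f x‖) x)^q) := by
  classical
  set N : X → ℝ := fun x => ‖f x‖ with hN
  have hN0 : ∀ x, 0 ≤ N x := fun x => norm_nonneg _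
  have hm : ∀ x, 0 ≤ t.mx N x := fun x => (hN0 x).trans (t.le_mx N x)
  by_cases h0 : ∃ x, l < t.avg 0 N x
  · obtain ⟨x0, hx0⟩ := h0
    apply Finset.sum_le_sum
    intro x _
    have : l < t.mx N x := by
      refine lt_of_lt_of_le ?_ (t.avg_zero_le_mx N x)
      rwa [t.avg_congr N (t.h0 x x0)]
    rw [if_pos this]
    have h1 : 0 ≤ B * l⁻¹ * t.mx N x := mul_nonneg (by positivity) (hm x)
    have h2 : 0 ≤ A * D^q := by positivity
    have h3 : 0 ≤ B * D := by positivity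
    split_ifs <;> linarith
  push Not at h0
  set Om : Finset X := {y | l < t.mx N y} with hOm
  have memOm : ∀ x, x ∈ Om ↔ l < t.mx N x := fun x => by simp [hOm]
  have hstm : ∀ x ∈ Om, 0 < t.stm N l x := by
    intro x hx
    by_contra hc
    have h1 := (t.stm_spec N l x ((memOm x).1 hx)).2
    rw [show t.stm N l x = 0 by omega] at h1
    linarith [h0 x]
  have havg : ∀ x ∈ Om, ‖t.avg (t.stm N l x) f x‖ ≤ D * l := by
    intro x hx
    have h1 := hstm x hx
    obtain ⟨j, hj⟩ : ∃ j, t.stm N l x = j + 1 := ⟨t.stm N l x - 1, by omega⟩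
    have h2 := t.stm_min N l x ((memOm x).1 hx) j (by omega)
    have h3 := (t.stm_spec N l x ((memOm x).1 hx)).1
    refine (t.norm_avg_le _ f x).trans ?_
    rw [hj]
    refine (t.avg_doub j (by omega) N hN0 x).trans ?_
    gcongr
  -- good part
  set g : X → E := fun x => if x ∈ Om then t.avg (t.stm N l x) f x else f x with hg
  set L : Finset (ℕ × β) := Om.image (t.lab N l) with hL
  set b : ℕ × β → X → E := fun c x => if x ∈ Om ∧ t.lab N l x = c then f x - g x else 0 with hb
  have hfg : f = g + ∑ c ∈ L, b c := by
    ext x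
    rw [Pi.add_apply, Finset.sum_apply]
    by_cases hx : x ∈ Om
    · rw [Finset.sum_eq_single (t.lab N l x)]
      · simp [hb, hx]
      · intro c _ hc; simp only [hb]; rw [if_neg]; rintro ⟨_, h⟩; exact hc h.symm
      · intro h; exact absurd (Finset.mem_image_of_mem _ hx) h
    · simp [hb, hx, hg]
  have hTf : ∀ x, ‖T f x‖ ≤ ‖T g x‖ + ∑ c ∈ L, ‖T (b c) x‖ := by
    intro x
    conv_lhs => rw [hfg]
    rw [map_add, map_sum, Pi.add_apply, Finset.sum_apply]
    exact (norm_add_le _ _).trans (by gcongr; exact norm_sum_le _ _)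
  set St : ℕ × β → Finset X := fun c => t.S c.1 c.2 with hSt
  have key : ∀ x, (if 2 * l < ‖T f x‖ then (1:ℝ) else 0) ≤ l^(-q) * ‖T g x‖^q
      + ∑ c ∈ L, (if x ∈ St c then 1 else 0) + l⁻¹ * ∑ c ∈ L, (if x ∈ St c then 0 else ‖T (b c) x‖) := by
    intro x
    have n1 : 0 ≤ l^(-q) * ‖T g x‖^q := by positivity
    have n2 : (0:ℝ) ≤ ∑ c ∈ L, (if x ∈ St c then 1 else 0) := Finset.sum_nonneg fun c _ => by split_ifs <;> norm_num
    have n3 : 0 ≤ l⁻¹ * ∑ c ∈ L, (if x ∈ St c then 0 else ‖T (b c) x‖) :=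
      mul_nonneg (by positivity) (Finset.sum_nonneg fun c _ => by split_ifs <;> positivity)
    split_ifs with h
    swap
    · linarith
    by_cases hs : ∃ c ∈ L, x ∈ St c
    · obtain ⟨c, hc, hxc⟩ := hs
      have : (1:ℝ) ≤ ∑ c ∈ L, (if x ∈ St c then 1 else 0) := by
        refine le_trans ?_ (Finset.single_le_sum (f := fun c => if x ∈ St c then (1:ℝ) else 0) (fun c _ => by split_ifs <;> norm_num) hc)
        simp [hxc]
      linarith
    push Not at hs
    by_cases hgx : l < ‖T g x‖
    · have : 1 ≤ l^(-q) * ‖T g x‖^q := by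
        rw [Real.rpow_neg hl.le, ← div_eq_inv_mul, one_le_div (by positivity)]
        gcongr
      linarith
    · have h1 : l ≤ ∑ c ∈ L, ‖T (b c) x‖ := by linarith [hTf x]
      have h2 : ∑ c ∈ L, (if x ∈ St c then 0 else ‖T (b c) x‖) = ∑ c ∈ L, ‖T (b c) x‖ :=
        Finset.sum_congr rfl fun c hc => by simp [hs c hc]
      have : 1 ≤ l⁻¹ * ∑ c ∈ L, (if x ∈ St c then 0 else ‖T (b c) x‖) := by
        rw [h2, ← div_eq_inv_mul, one_le_div hl]; exact h1
      linarith
  have e1 : ∑ x, l^(-q) * ‖T g x‖^q ≤ ∑ x, (if l < t.mx N x then A * D^q else A * l^(-q) * (t.mx N x)^q) := by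
    rw [← Finset.mul_sum]
    calc _ ≤ l^(-q) * (A * ∑ x, ‖g x‖^q) := by gcongr; exact hT g
      _ = ∑ x, l^(-q) * (A * ‖g x‖^q) := by simp only [Finset.mul_sum]
      _ ≤ _ := by
        apply Finset.sum_le_sum
        intro x _
        by_cases hx : x ∈ Om
        · rw [if_pos ((memOm x).1 hx)]
          have h1 : ‖g x‖ ≤ D * l := by simp only [hg, if_pos hx]; exact havg x hx
          calc _ ≤ l^(-q) * (A * (D*l)^q) := by gcongr
            _ = A * D^q * (l^(-q) * l^q) := by rw [Real.mul_rpow (by linarith) hl.le]; ring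
            _ = A * D^q := by rw [← Real.rpow_add hl]; simp
        · rw [if_neg (fun h => hx ((memOm x).2 h))]
          have h1 : ‖g x‖ ≤ t.mx N x := by simp only [hg, if_neg hx]; exact t.le_mx N x
          calc _ ≤ l^(-q) * (A * (t.mx N x)^q) := by gcongr
            _ = _ := by ring
  have fib : ∀ h : X → ℝ, ∑ c ∈ L, ∑ x ∈ Om with t.lab N l x = c, h x = ∑ x ∈ Om, h x := fun h =>
    Finset.sum_fiberwise_of_maps_to (fun x hx => Finset.mem_image_of_mem _ hx) h
  have e2 : ∑ x, ∑ c ∈ L, (if x ∈ St c then (1:ℝ) else 0) ≤ ∑ x ∈ Om, D := by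
    rw [Finset.sum_comm, ← fib]
    apply Finset.sum_le_sum
    intro c hc
    obtain ⟨x, hx, rfl⟩ := Finset.mem_image.1 hc
    rw [t.fiber N l x ((memOm x).1 hx)]
    have := t.star (t.stm N l x) x (t.stm_spec N l x ((memOm x).1 hx)).1
    rw [Finset.sum_const, nsmul_eq_mul, mul_comm]
    simpa [hSt, CZTree.lab, CZTree.cell] using this
  have bsum : ∀ c, ∑ x, ‖b c x‖ = ∑ x ∈ Om with t.lab N l x = c, ‖f x - g x‖ := by
    intro c
    rw [Finset.sum_filter, ← Finset.sum_filter_add_sum_filter_not Finset.univ (fun x => x ∈ Om)]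
    rw [Finset.sum_eq_zero (s := Finset.univ.filter (fun x => ¬ x ∈ Om))]
    · rw [add_zero]
      have : Finset.univ.filter (fun x => x ∈ Om) = Om := by ext; simp
      rw [this]
      apply Finset.sum_congr rfl
      intro x hx
      by_cases h : t.lab N l x = c <;> simp [hb, hx, h]
    · intro x hx
      have : x ∉ Om := by simpa using hx
      simp [hb, this]
  have e3 : ∑ x, l⁻¹ * ∑ c ∈ L, (if x ∈ St c then 0 else ‖T (b c) x‖) ≤
      ∑ x ∈ Om, (B * D + B * l⁻¹ * t.mx N x) := by
    rw [← Finset.mul_sum, Finset.sum_comm]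
    have h1 : ∑ c ∈ L, ∑ x, (if x ∈ St c then 0 else ‖T (b c) x‖) ≤ ∑ c ∈ L, B * ∑ x, ‖b c x‖ := by
      apply Finset.sum_le_sum
      intro c hc
      obtain ⟨x, hx, rfl⟩ := Finset.mem_image.1 hc
      have hx' := (memOm x).1 hx
      refine hH (t.stm N l x) x (b _) (t.stm_spec N l x hx').1 ?_ ?_
      · intro y hy
        simp only [hb]
        rw [if_neg]
        rintro ⟨h1, h2⟩
        have : y ∈ ({y | l < t.mx N y} : Finset X).filter (fun y => t.lab N l y = t.lab N l x) := by
          exact Finset.mem_filter.2 ⟨h1, h2⟩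
        rw [t.fiber N l x hx', t.mem_cell] at this
        exact hy this
      · have h1 : ∑ y, b (t.lab N l x) y = ∑ y ∈ Om with t.lab N l y = t.lab N l x, (f y - g y) := by
          rw [Finset.sum_filter]
          rw [← Finset.sum_filter_add_sum_filter_not Finset.univ (fun x => x ∈ Om)]
          rw [Finset.sum_eq_zero (s := Finset.univ.filter (fun x => ¬ x ∈ Om))]
          · rw [add_zero]
            have : Finset.univ.filter (fun x => x ∈ Om) = Om := by ext; simp
            rw [this]
            apply Finset.sum_congr rfl
            intro y hy
            simp [hb, hy]
          · intro y hy
            have : y ∉ Om := by simpa using hy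
            simp [hb, this]
        rw [h1, Finset.sum_sub_distrib, sub_eq_zero, ← t.sum_stm_fiber N l f x hx']
        apply Finset.sum_congr rfl
        intro y hy
        have : y ∈ Om := (Finset.mem_filter.1 hy).1
        simp [hg, this]
    calc _ ≤ l⁻¹ * ∑ c ∈ L, B * ∑ x, ‖b c x‖ := by gcongr
      _ = l⁻¹ * (B * ∑ x ∈ Om, ‖f x - g x‖) := by
        rw [← Finset.mul_sum]; simp only [bsum]; rw [fib]
      _ = ∑ x ∈ Om, l⁻¹ * (B * ‖f x - g x‖) := by simp only [Finset.mul_sum]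
      _ ≤ _ := by
        apply Finset.sum_le_sum
        intro x hx
        have h1 : ‖g x‖ ≤ D * l := by simp only [hg, if_pos hx]; exact havg x hx
        have h2 : ‖f x‖ ≤ t.mx N x := t.le_mx N x
        calc _ ≤ l⁻¹ * (B * (t.mx N x + D * l)) := by
              gcongr; exact (norm_sub_le _ _).trans (add_le_add h2 h1)
          _ = _ := by field_simp; ring
  have e4 : ∀ h : X → ℝ, ∑ x ∈ Om, h x = ∑ x, if l < t.mx N x then h x else 0 := by
    intro h; rw [hOm, Finset.sum_filter]
  rw [e4] at e2 e3
  calc _ ≤ ∑ x, (l^(-q) * ‖T g x‖^q + ∑ c ∈ L, (if x ∈ St c then 1 else 0) + l⁻¹ * ∑ c ∈ L, (if x ∈ St c then 0 else ‖T (b c) x‖)) :=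
        Finset.sum_le_sum fun x _ => key x
    _ ≤ ∑ x, (if l < t.mx N x then A * D^q else A * l^(-q) * (t.mx N x)^q)
        + ∑ x, (if l < t.mx N x then D else 0) + ∑ x, (if l < t.mx N x then (B * D + B * l⁻¹ * t.mx N x) else 0) := by
      rw [Finset.sum_add_distrib, Finset.sum_add_distrib]
      exact add_le_add (add_le_add e1 e2) e3
    _ ≤ _ := by
      rw [← Finset.sum_add_distrib, ← Finset.sum_add_distrib]
      apply Finset.sum_le_sum
      intro x _
      split_ifs <;> linarith

/-- finite Calderon–Zygmund theorem -/
lemma cz_strong {X β : Type*} [Fintype X] [DecidableEq X] [DecidableEq β] {D : ℝ} (t : CZTree X β D) (hD : 1 ≤ D)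
    {E : Type*} [NormedAddCommGroup E] [NormedSpace ℝ E] (T : (X → E) →ₗ[ℝ] (X → E))
    (p q A B : ℝ) (hp : 1 < p) (hpq : p < q) (hA : 0 ≤ A) (hB : 0 ≤ B)
    (hT : ∀ f, ∑ x, ‖T f x‖^q ≤ A * ∑ x, ‖f x‖^q)
    (hH : ∀ (l : ℕ) (x0 : X) (b : X → E), l ≤ t.n → (∀ x, t.pr l x ≠ t.pr l x0 → b x = 0) → ∑ x, b x = 0 →
      ∑ x, (if x ∈ t.S l (t.pr l x0) then 0 else ‖T b x‖) ≤ B * ∑ x, ‖b x‖)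
    (f : X → E) :
    ∑ x, ‖T f x‖^p ≤ (2^p * ((1 + A * D^q + D + B * D) + A * p / (q-p) + B * p / (p-1))) * (2^p * (p/(p-1)))
      * ∑ x, ‖f x‖^p := by
  have h1 := layercake p q (1 + A * D^q + D + B * D) A B hp hpq (by positivity) hA hB (fun x => ‖T f x‖)
    (t.mx (fun x => ‖f x‖)) (fun x => norm_nonneg _) (fun x => (norm_nonneg _).trans (t.le_mx (fun x => ‖f x‖) x))
    (cz_weak t hD T q A B (by linarith) hA hB hT hH f)
  have h2 := t.doob p hp (fun x => ‖f x‖) (fun x => norm_nonneg _)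
  refine h1.trans ?_
  rw [mul_assoc _ (2^p * (p/(p-1)))]
  have : 0 < p - 1 := by linarith
  have : 0 < q - p := by linarith
  gcongr

/-- p-th power of the mixed norm on a finite product. -/
def mN {X Y H : Type*} [Fintype X] [Fintype Y] [NormedAddCommGroup H] (p q : ℝ) (f : X × Y → H) : ℝ :=
  ∑ x, (∑ y, ‖f (x, y)‖^q)^(p/q)

lemma mN_nonneg {X Y H : Type*} [Fintype X] [Fintype Y] [NormedAddCommGroup H] (p q : ℝ) (f : X × Y → H) :
    0 ≤ mN p q f := by unfold mN; positivity

lemma mN_self {X Y H : Type*} [Fintype X] [Fintype Y] [NormedAddCommGroup H] (q : ℝ) (hq : 1 < q) (f : X × Y → H) :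
    mN q q f = ∑ a, ‖f a‖^q := by
  unfold mN
  rw [div_self (by positivity), Fintype.sum_prod_type]
  simp

/-- mixed Hölder -/
lemma mixed_holder {X Y H : Type*} [Fintype X] [Fintype Y] [NormedAddCommGroup H] [InnerProductSpace ℝ H]
    (p q p' q' : ℝ) (hp : p.HolderConjugate p') (hq : q.HolderConjugate q') (f g : X × Y → H) :
    ∑ a, inner ℝ (f a) (g a) ≤ (mN p q f)^(1/p) * (mN p' q' g)^(1/p') := by
  have h1 : ∀ x, ∑ y, inner ℝ (f (x,y)) (g (x,y)) ≤ (∑ y, ‖f (x,y)‖^q)^(1/q) * (∑ y, ‖g (x,y)‖^q')^(1/q') := by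
    intro x
    refine le_trans (Finset.sum_le_sum fun y _ => real_inner_le_norm _ _) ?_
    exact Real.inner_le_Lp_mul_Lq_of_nonneg _ hq (fun _ _ => norm_nonneg _) (fun _ _ => norm_nonneg _)
  rw [Fintype.sum_prod_type]
  refine (Finset.sum_le_sum fun x _ => h1 x).trans ?_
  refine (Real.inner_le_Lp_mul_Lq_of_nonneg _ hp (fun _ _ => by positivity) (fun _ _ => by positivity)).trans (le_of_eq ?_)
  unfold mN
  congr 2
  · apply Finset.sum_congr rfl; intro x _
    rw [← Real.rpow_mul (by positivity)]; congr 1; ring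
  · apply Finset.sum_congr rfl; intro x _
    rw [← Real.rpow_mul (by positivity)]; congr 1; ring

lemma mixed_dual_elt {X Y H : Type*} [Fintype X] [Fintype Y] [NormedAddCommGroup H] [InnerProductSpace ℝ H]
    (p q p' q' : ℝ) (hp : p.HolderConjugate p') (hq : q.HolderConjugate q') (F : X × Y → H) :
    ∃ g : X × Y → H, ∑ a, inner ℝ (F a) (g a) = mN p q F ∧ mN p' q' g = mN p q F := by
  set s : X → ℝ := fun x => ∑ y, ‖F (x,y)‖^q with hs
  have hs0 : ∀ x, 0 ≤ s x := fun x => by simp only [hs]; positivity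
  have hq1 := hq.lt
  have hp1 := hp.lt
  have hq'1 := hq.symm.lt
  have hp'1 := hp.symm.lt
  have eq' := hq.sub_one_mul_conj
  have ep' := hp.sub_one_mul_conj
  set g : X × Y → H := fun a => ((s a.1)^(p/q-1) * ‖F a‖^(q-2)) • F a with hg
  have hn : ∀ a, ‖g a‖ = (s a.1)^(p/q-1) * ‖F a‖^(q-1) := by
    intro a
    simp only [hg]
    have := hs0 a.1
    rw [norm_smul, Real.norm_of_nonneg (by positivity), mul_assoc]
    congr 1
    by_cases h : ‖F a‖ = 0
    · rw [h, mul_zero, Real.zero_rpow (by linarith)]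
    · rw [← Real.rpow_add_one h]; congr 1; ring
  refine ⟨g, ?_, ?_⟩
  · rw [Fintype.sum_prod_type]
    unfold mN
    apply Finset.sum_congr rfl
    intro x _
    have h1 : ∀ y, inner ℝ (F (x,y)) (g (x,y)) = (s x)^(p/q-1) * ‖F (x,y)‖^q := by
      intro y
      simp only [hg]
      rw [real_inner_smul_right, real_inner_self_eq_norm_sq, mul_assoc]
      congr 1
      by_cases h : ‖F (x,y)‖ = 0
      · rw [h, Real.zero_rpow (x := q) (by linarith)]; simp
      · rw [← Real.rpow_natCast, ← Real.rpow_add (by positivity)]; congr 1; norm_num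
    simp only [h1]
    rw [← Finset.mul_sum]
    change (s x)^(p/q-1) * s x = (s x)^(p/q)
    by_cases h : s x = 0
    · rw [h, mul_zero, Real.zero_rpow (by positivity)]
    · rw [← Real.rpow_add_one h]; congr 1; ring
  · unfold mN
    apply Finset.sum_congr rfl
    intro x _
    have h1 : ∀ y, ‖g (x,y)‖^q' = (s x)^((p/q-1)*q') * ‖F (x,y)‖^q := by
      intro y
      rw [hn, Real.mul_rpow (Real.rpow_nonneg (hs0 x) _) (by positivity), ← Real.rpow_mul (hs0 x), ← Real.rpow_mul (norm_nonneg _), eq']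
    simp only [h1]
    rw [← Finset.mul_sum]
    change ((s x)^((p/q-1)*q') * s x)^(p'/q') = (s x)^(p/q)
    by_cases h : s x = 0
    · rw [h, mul_zero, Real.zero_rpow (by positivity), Real.zero_rpow (by positivity)]
    · rw [← Real.rpow_add_one h, ← Real.rpow_mul (hs0 x)]; congr 1
      have : p'/q' = p' * (1 - 1/q) := by
        have h3 := hq.one_sub_inv
        rw [one_div, h3]; rfl
      rw [show ((p / q - 1) * q' + 1) * (p' / q') = (p/q - 1) * p' * (q'/q') + p'/q' by ring, div_self (by positivity), this]
      have : p' * (p/q) = (p + p')/q := by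
        rw [show p' * (p/q) = (p' * p)/q by ring, show p' * p = p + p' by linarith]
      rw [show (p / q - 1) * p' * 1 + p' * (1 - 1 / q) = p' * (p/q) - p'/q by ring, this]; ring

lemma mixed_dual {X Y H : Type*} [Fintype X] [Fintype Y] [NormedAddCommGroup H] [InnerProductSpace ℝ H]
    (p q p' q' C : ℝ) (hp : p.HolderConjugate p') (hq : q.HolderConjugate q') (hC : 0 ≤ C)
    (T : (X × Y → H) →ₗ[ℝ] (X × Y → H)) (hs : ∀ f g, ∑ a, inner ℝ (T f a) (g a) = ∑ a, inner ℝ (f a) (T g a))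
    (h : ∀ g, mN p' q' (T g) ≤ C * mN p' q' g) (f : X × Y → H) :
    mN p q (T f) ≤ C^(p-1) * mN p q f := by
  obtain ⟨g, h1, h2⟩ := mixed_dual_elt p q p' q' hp hq (T f)
  have hp1 := hp.lt
  have hp'1 := hp.symm.lt
  set M := mN p q (T f) with hM
  have hM0 : 0 ≤ M := mN_nonneg _ _ _
  have hf0 : 0 ≤ mN p q f := mN_nonneg _ _ _
  have h3 : M ≤ (mN p q f)^(1/p) * (C * M)^(1/p') := by
    rw [← h1, hs]
    refine (mixed_holder p q p' q' hp hq f (T g)).trans ?_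
    have := h g
    rw [h2] at this
    have h0 := mN_nonneg p' q' (T g)
    gcongr
    rwa [← hs, h1]
  rcases hM0.eq_or_lt with h0 | h0
  · rw [← h0]; positivity
  have e1 : 1/p + 1/p' = 1 := by simpa using hp.inv_add_inv_eq_one
  have h4 : M^(1/p) ≤ (mN p q f)^(1/p) * C^(1/p') := by
    rw [Real.mul_rpow hC hM0, ← mul_assoc] at h3
    have : M = M^(1/p) * M^(1/p') := by rw [← Real.rpow_add h0, e1, Real.rpow_one]
    have h5 : 0 < M^(1/p') := by positivity
    rw [this] at h3
    have h6 : M^(1/p) * M^(1/p') ≤ (mN p q f)^(1/p) * C^(1/p') * M^(1/p') := by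
      rw [← this] at h3 ⊢; exact h3
    exact le_of_mul_le_mul_right h6 h5
  have h5 := Real.rpow_le_rpow (by positivity) h4 (show 0 ≤ p by linarith)
  rw [← Real.rpow_mul hM0, Real.mul_rpow (by positivity) (by positivity), ← Real.rpow_mul hf0, ← Real.rpow_mul hC] at h5
  rw [one_div_mul_cancel (by positivity), Real.rpow_one, Real.rpow_one] at h5
  have e2 : 1/p' * p = p - 1 := by
    have : 1/p' = 1 - 1/p := by linarith
    rw [this]; field_simp
  rw [e2] at h5
  linarith

lemma cz_conv {X β : Type*} [Fintype X] [DecidableEq X] [DecidableEq β] {D : ℝ} (t : CZTree X β D) (hD : 1 ≤ D)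
    {E : Type*} [NormedAddCommGroup E] [NormedSpace ℝ E] (T : (X → E) →ₗ[ℝ] (X → E))
    (K : X → X → E →ₗ[ℝ] E) (hK : ∀ f x, T f x = ∑ x', K x x' (f x'))
    (p q A B : ℝ) (hp : 1 < p) (hpq : p < q) (hA : 0 ≤ A) (hB : 0 ≤ B)
    (hT : ∀ f, ∑ x, ‖T f x‖^q ≤ A * ∑ x, ‖f x‖^q)
    (hH : ∀ (l : ℕ) (x' x0 : X), l ≤ t.n → t.pr l x' = t.pr l x0 → ∃ κ : X → ℝ,
      (∀ x e, ‖K x x' e - K x x0 e‖ ≤ κ x * ‖e‖) ∧ ∑ x, (if x ∈ t.S l (t.pr l x0) then 0 else κ x) ≤ B)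
    (f : X → E) :
    ∑ x, ‖T f x‖^p ≤ (2^p * ((1 + A * D^q + D + B * D) + A * p / (q-p) + B * p / (p-1))) * (2^p * (p/(p-1)))
      * ∑ x, ‖f x‖^p := by
  refine cz_strong t hD T p q A B hp hpq hA hB hT ?_ f
  intro l x0 b hl hb hs
  have h1 : ∀ x, T b x = ∑ x', (K x x' (b x') - K x x0 (b x')) := by
    intro x
    rw [hK, Finset.sum_sub_distrib, ← map_sum, hs, map_zero, sub_zero]
  have h2 : ∀ x', ∑ x, (if x ∈ t.S l (t.pr l x0) then 0 else ‖K x x' (b x') - K x x0 (b x')‖) ≤ B * ‖b x'‖ := by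
    intro x'
    by_cases h : t.pr l x' = t.pr l x0
    · obtain ⟨κ, k1, k2⟩ := hH l x' x0 hl h
      calc _ ≤ ∑ x, (if x ∈ t.S l (t.pr l x0) then 0 else κ x) * ‖b x'‖ := by
            apply Finset.sum_le_sum; intro x _
            split_ifs
            · simp
            · exact k1 x _
        _ ≤ _ := by rw [← Finset.sum_mul]; gcongr
    · rw [hb x' h]; simp
  calc _ ≤ ∑ x, ∑ x', (if x ∈ t.S l (t.pr l x0) then 0 else ‖K x x' (b x') - K x x0 (b x')‖) := by
        apply Finset.sum_le_sum; intro x _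
        split_ifs
        · simp
        · rw [h1]; exact norm_sum_le _ _
    _ ≤ _ := by
      rw [Finset.sum_comm, Finset.mul_sum]
      exact Finset.sum_le_sum fun x' _ => h2 x'

/-- hypotheses of the finite theorem -/
structure FinOK (A B D : ℝ) {X Y H : Type} [AddCommGroup X] [Fintype X] [DecidableEq X]
    [AddCommGroup Y] [Fintype Y] [DecidableEq Y] [NormedAddCommGroup H] [InnerProductSpace ℝ H]
    (T : (X × Y → H) →ₗ[ℝ] (X × Y → H)) (K : X → Y → H →ₗ[ℝ] H)
    {β1 β2 : Type} [DecidableEq β1] [DecidableEq β2] (t1 : CZTree (X × Y) β1 D) (t2 : CZTree X β2 D) : Prop where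
  hsym : ∀ f g, ∑ a, inner ℝ (T f a) (g a) = ∑ a, inner ℝ (f a) (T g a)
  hL2 : ∀ f, ∑ a, ‖T f a‖^2 ≤ A * ∑ a, ‖f a‖^2
  hK : ∀ f x y, T f (x,y) = ∑ x', ∑ y', K (x-x') (y-y') (f (x',y'))
  hor1 : ∀ (l : ℕ) (a' a0 : X × Y), l ≤ t1.n → t1.pr l a' = t1.pr l a0 → ∃ κ : X × Y → ℝ,
      (∀ a h, ‖K (a.1-a'.1) (a.2-a'.2) h - K (a.1-a0.1) (a.2-a0.2) h‖ ≤ κ a * ‖h‖)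
      ∧ ∑ a, (if a ∈ t1.S l (t1.pr l a0) then 0 else κ a) ≤ B
  hor2 : ∀ (l : ℕ) (x' x0 : X), l ≤ t2.n → t2.pr l x' = t2.pr l x0 → ∃ κ : X → Y → ℝ, (∀ x y, 0 ≤ κ x y) ∧
      (∀ x y h, ‖K (x-x') y h - K (x-x0) y h‖ ≤ κ x y * ‖h‖) ∧
      ∑ x, (if x ∈ t2.S l (t2.pr l x0) then 0 else ∑ y, κ x y) ≤ B

/-- Young's inequality for vector valued convolution -/
lemma young_fin {Y H : Type} [AddCommGroup Y] [Fintype Y] [NormedAddCommGroup H] [NormedSpace ℝ H]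
    (q : ℝ) (hq : 1 < q) [Fact (1 ≤ ENNReal.ofReal q)] (κ : Y → ℝ) (L : Y → H → H) (hL : ∀ y h, ‖L y h‖ ≤ κ y * ‖h‖)
    (hκ : ∀ y, 0 ≤ κ y)
    (e : PiLp (ENNReal.ofReal q) (fun _ : Y => H)) :
    ‖(WithLp.toLp (ENNReal.ofReal q) (fun y => ∑ y', L (y-y') (e y')) : PiLp (ENNReal.ofReal q) (fun _ : Y => H))‖
      ≤ (∑ y, κ y) * ‖e‖ := by
  have hqr : (ENNReal.ofReal q).toReal = q := ENNReal.toReal_ofReal (by linarith)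
  have hq0 : 0 < (ENNReal.ofReal q).toReal := by rw [hqr]; linarith
  have h1 : (WithLp.toLp (ENNReal.ofReal q) (fun y => ∑ y', L (y-y') (e y')) : PiLp (ENNReal.ofReal q) (fun _ : Y => H))
     = ∑ z, (WithLp.toLp (ENNReal.ofReal q) (fun y => L z (e (y-z))) : PiLp (ENNReal.ofReal q) (fun _ : Y => H)) := by
    ext y
    rw [WithLp.ofLp_sum, Finset.sum_apply]
    exact Fintype.sum_equiv (Equiv.subLeft y) _ _ (fun y' => by simp)
  rw [h1, Finset.sum_mul]
  refine (norm_sum_le _ _).trans (Finset.sum_le_sum fun z _ => ?_)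
  rw [PiLp.norm_eq_sum hq0, PiLp.norm_eq_sum hq0, hqr]
  have h2 : ∑ y, ‖L z (e (y-z))‖^q ≤ (κ z)^q * ∑ y, ‖e y‖^q := by
    rw [← Fintype.sum_equiv (Equiv.subRight z) (fun y => ‖e (y - z)‖^q) (fun y => ‖e y‖^q) (fun y => by simp), Finset.mul_sum]
    apply Finset.sum_le_sum; intro y _
    rw [← Real.mul_rpow (hκ z) (norm_nonneg _)]
    gcongr
    exact hL _ _
  refine (Real.rpow_le_rpow (by positivity) h2 (by positivity)).trans ?_
  have := hκ z
  rw [Real.mul_rpow (by positivity) (by positivity), ← Real.rpow_mul this, mul_one_div_cancel (by linarith), Real.rpow_one]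

section
variable {A B D : ℝ} {X Y H : Type} [AddCommGroup X] [Fintype X] [DecidableEq X]
    [AddCommGroup Y] [Fintype Y] [DecidableEq Y] [NormedAddCommGroup H] [InnerProductSpace ℝ H]
    {T : (X × Y → H) →ₗ[ℝ] (X × Y → H)} {K : X → Y → H →ₗ[ℝ] H}
    {β1 β2 : Type} [DecidableEq β1] [DecidableEq β2] {t1 : CZTree (X × Y) β1 D} {t2 : CZTree X β2 D}

def czC (p q A B D : ℝ) : ℝ := (2^p * ((1 + A * D^q + D + B * D) + A * p / (q-p) + B * p / (p-1))) * (2^p * (p/(p-1)))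

lemma czC_nonneg (p q A B D : ℝ) (hp : 1 < p) (hpq : p < q) (hA : 0 ≤ A) (hB : 0 ≤ B) (hD : 1 ≤ D) : 0 ≤ czC p q A B D := by
  unfold czC
  have : 0 < p - 1 := by linarith
  have : 0 < q - p := by linarith
  positivity

lemma FinOK.lt_two (h : FinOK A B D T K t1 t2) (hA : 0 ≤ A) (hB : 0 ≤ B) (hD : 1 ≤ D) (p : ℝ) (hp : 1 < p) (hp2 : p < 2)
    (f : X × Y → H) : mN p p (T f) ≤ czC p 2 A B D * mN p p f := by
  rw [mN_self _ hp, mN_self _ hp]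
  refine cz_conv t1 hD T (fun a a' => K (a.1-a'.1) (a.2-a'.2)) ?_ p 2 A B hp hp2 hA hB ?_ ?_ f
  · rintro f ⟨x,y⟩; rw [h.hK, Fintype.sum_prod_type]
  · intro f; simpa using h.hL2 f
  · intro l a' a0 hl ha; exact h.hor1 l a' a0 hl ha

lemma FinOK.diag (hA : 0 ≤ A) (hB : 0 ≤ B) (hD : 1 ≤ D) (p : ℝ) (hp : 1 < p) : ∃ C : ℝ, 0 ≤ C ∧ ∀ {X Y H : Type} [AddCommGroup X] [Fintype X] [DecidableEq X]
    [AddCommGroup Y] [Fintype Y] [DecidableEq Y] [NormedAddCommGroup H] [InnerProductSpace ℝ H]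
    {T : (X × Y → H) →ₗ[ℝ] (X × Y → H)} {K : X → Y → H →ₗ[ℝ] H}
    {β1 β2 : Type} [DecidableEq β1] [DecidableEq β2] {t1 : CZTree (X × Y) β1 D} {t2 : CZTree X β2 D} 
    (_ : FinOK A B D T K t1 t2) (f : X × Y → H), mN p p (T f) ≤ C * mN p p f := by
  rcases lt_trichotomy p 2 with h2 | h2 | h2
  · exact ⟨czC p 2 A B D, czC_nonneg _ _ _ _ _ hp h2 hA hB hD, fun h => h.lt_two hA hB hD p hp h2⟩
  · subst h2
    refine ⟨A, hA, fun h f => ?_⟩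
    rw [mN_self _ hp, mN_self _ hp]
    simpa using h.hL2 f
  · have hc := Real.HolderConjugate.conjExponent hp
    have h3 : p.conjExponent < 2 := by
      rw [Real.conjExponent, div_lt_iff₀ (by linarith)]; linarith
    have hC := czC_nonneg p.conjExponent 2 A B D hc.symm.lt h3 hA hB hD
    exact ⟨(czC p.conjExponent 2 A B D)^(p-1), by positivity, fun h => 
      mixed_dual p p p.conjExponent p.conjExponent _ hc hc hC _ h.hsym (h.lt_two hA hB hD _ hc.symm.lt h3)⟩

lemma FinOK.lt_q (h : FinOK A B D T K t1 t2) (hA : 0 ≤ A) (hB : 0 ≤ B) (hD : 1 ≤ D) (p q : ℝ) (hp : 1 < p) (hpq : p < q)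
    (A' : ℝ) (hA' : 0 ≤ A') (hT : ∀ f, mN q q (T f) ≤ A' * mN q q f)
    (f : X × Y → H) : mN p q (T f) ≤ czC p q A' B D * mN p q f := by
  have hq : 1 < q := hp.trans hpq
  have : Fact (1 ≤ ENNReal.ofReal q) := ⟨by simpa using hq.le⟩
  have hqr : (ENNReal.ofReal q).toReal = q := ENNReal.toReal_ofReal (by linarith)
  have hq0 : 0 < (ENNReal.ofReal q).toReal := by rw [hqr]; linarith
  have hn : ∀ e : (PiLp (ENNReal.ofReal q) (fun _ : Y => H)), ‖e‖ = (∑ y, ‖e y‖^q)^(1/q) := by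
    intro e; rw [PiLp.norm_eq_sum hq0, hqr]
  have hnp : ∀ (s : ℝ) (e : (PiLp (ENNReal.ofReal q) (fun _ : Y => H))), ‖e‖^s = (∑ y, ‖e y‖^q)^(s/q) := by
    intro s e; rw [hn, ← Real.rpow_mul (by positivity)]; congr 1; ring
  let T' : (X → (PiLp (ENNReal.ofReal q) (fun _ : Y => H))) →ₗ[ℝ] (X → (PiLp (ENNReal.ofReal q) (fun _ : Y => H))) :=
    { toFun := fun F x => WithLp.toLp _ (fun y => T (fun a => F a.1 a.2) (x,y))
      map_add' := by
        intro F G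
        ext x y
        have this : (fun a : X × Y => (F + G) a.1 a.2) = (fun a => F a.1 a.2) + (fun a => G a.1 a.2) := by
          ext a; simp
        simp only [this]; simp
      map_smul' := by
        intro c F
        ext x y
        have : (fun a : X × Y => (c • F) a.1 a.2) = c • (fun a : X × Y => F a.1 a.2) := by
          ext a; simp
        simp only [this]; simp }
  let K' : X → X → (PiLp (ENNReal.ofReal q) (fun _ : Y => H)) →ₗ[ℝ] (PiLp (ENNReal.ofReal q) (fun _ : Y => H)) := fun x x' =>
    { toFun := fun e => WithLp.toLp _ (fun y => ∑ y', K (x-x') (y-y') (e y'))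
      map_add' := by
        intro F G
        ext y
        simp [Finset.sum_add_distrib]
      map_smul' := by
        intro c F
        ext y
        simp [Finset.smul_sum] }
  have key := cz_conv t2 hD T' K' ?_ p q A' B hp hpq hA' hB ?_ ?_ (fun x => WithLp.toLp _ (fun y => f (x,y)))
  · simp only [hnp] at key
    exact key
  · intro F x
    ext y
    simp only [T', K', LinearMap.coe_mk, AddHom.coe_mk]
    rw [h.hK, WithLp.ofLp_sum, Finset.sum_apply]
  · intro F
    simp only [hnp]
    exact hT (fun a => F a.1 a.2)
  · intro l x' x0 hl hx
    obtain ⟨κ, k0, k1, k2⟩ := h.hor2 l x' x0 hl hx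
    refine ⟨fun x => ∑ y, κ x y, fun x e => ?_, ?_⟩
    · have := young_fin q hq (fun y => κ x y) (fun y h => K (x-x') y h - K (x-x0) y h)
        (fun y h => k1 x y h) (fun y => k0 x y) e
      refine le_of_eq_of_le (congrArg norm ?_) this
      ext y
      simp only [K', LinearMap.coe_mk, AddHom.coe_mk]
      simp
    · exact k2

end

/-- finite mixed norm theorem -/
lemma fin_main (A B D : ℝ) (hA : 0 ≤ A) (hB : 0 ≤ B) (hD : 1 ≤ D) (p q : ℝ) (hp : 1 < p) (hq : 1 < q) :
    ∃ C : ℝ, 0 ≤ C ∧ ∀ {X Y H : Type} [AddCommGroup X] [Fintype X] [DecidableEq X]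
    [AddCommGroup Y] [Fintype Y] [DecidableEq Y] [NormedAddCommGroup H] [InnerProductSpace ℝ H]
    {T : (X × Y → H) →ₗ[ℝ] (X × Y → H)} {K : X → Y → H →ₗ[ℝ] H}
    {β1 β2 : Type} [DecidableEq β1] [DecidableEq β2] {t1 : CZTree (X × Y) β1 D} {t2 : CZTree X β2 D}
    (_ : FinOK A B D T K t1 t2) (f : X × Y → H), mN p q (T f) ≤ C * mN p q f := by
  rcases lt_trichotomy p q with h2 | h2 | h2
  · obtain ⟨C, hC, h⟩ := FinOK.diag hA hB hD q hq
    exact ⟨czC p q C B D, czC_nonneg _ _ _ _ _ hp h2 hC hB hD, fun h' => h'.lt_q hA hB hD p q hp h2 C hC (h h')⟩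
  · subst h2
    exact FinOK.diag hA hB hD p hp
  · have hpc := Real.HolderConjugate.conjExponent hp
    have hqc := Real.HolderConjugate.conjExponent hq
    obtain ⟨C, hC, h⟩ := FinOK.diag hA hB hD q.conjExponent hqc.symm.lt
    have h3 : p.conjExponent < q.conjExponent := by
      rw [Real.conjExponent, Real.conjExponent, div_lt_div_iff₀ (by linarith) (by linarith)]; nlinarith
    have h4 := czC_nonneg p.conjExponent q.conjExponent C B D hpc.symm.lt h3 hC hB hD
    exact ⟨(czC p.conjExponent q.conjExponent C B D)^(p-1), by positivity, fun h' =>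
      mixed_dual p q p.conjExponent q.conjExponent _ hpc hqc h4 _ h'.hsym
        (h'.lt_q hA hB hD _ _ hpc.symm.lt h3 C hC (h h'))⟩

section kernel
variable {ι : Type} [Fintype ι] [DecidableEq ι]

/-- character on a general torus -/
def chr (ξ : ι → ℤ) (z : ι → AddCircle (1:ℝ)) : ℂ := ∏ i, fourier (ξ i) (z i)

lemma norm_four (n : ℤ) (z : AddCircle (1:ℝ)) : ‖fourier n z‖ = 1 := by
  rw [fourier_apply]; exact Circle.norm_coe _

lemma norm_chr (ξ : ι → ℤ) (z : ι → AddCircle (1:ℝ)) : ‖chr ξ z‖ = 1 := by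
  simp [chr, norm_four, -fourier_apply]

/-- class of smooth functions with controlled derivatives -/
def Cl (B : ℕ → ℝ) (g : (ι → ℝ) → ℝ) : Prop :=
  ContDiff ℝ (⊤:ℕ∞) g ∧ ∀ N x, ‖iteratedFDeriv ℝ N g x‖ ≤ B N

lemma Cl.bound {B : ℕ → ℝ} {g : (ι → ℝ) → ℝ} (h : Cl B g) (x : ι → ℝ) : ‖g x‖ ≤ B 0 := by
  have := h.2 0 x
  rwa [norm_iteratedFDeriv_zero] at this

lemma Cl.sub {B B' : ℕ → ℝ} {g g' : (ι → ℝ) → ℝ} (h : Cl B g) (h' : Cl B' g') :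
    Cl (fun N => B N + B' N) (fun x => g x - g' x) := by
  refine ⟨h.1.sub h'.1, fun N x => ?_⟩
  have : iteratedFDeriv ℝ N (fun x => g x - g' x) x = iteratedFDeriv ℝ N g x - iteratedFDeriv ℝ N g' x := by
    have e : (fun x => g x - g' x) = g - g' := rfl
    rw [e, iteratedFDeriv_sub_apply]
    · exact (h.1.of_le (by exact_mod_cast le_top)).contDiffAt
    · exact (h'.1.of_le (by exact_mod_cast le_top)).contDiffAt
  rw [this]
  exact (norm_sub_le _ _).trans (add_le_add (h.2 N x) (h'.2 N x))

/-- difference quotient -/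
def dq (h : ℝ) (v : ι → ℝ) (g : (ι → ℝ) → ℝ) (x : ι → ℝ) : ℝ := h⁻¹ * (g (x + h • v) - g x)

lemma Cl.dq {B : ℕ → ℝ} {g : (ι → ℝ) → ℝ} (hg : Cl B g) (h : ℝ) (v : ι → ℝ) (hv : ‖v‖ ≤ 1) :
    Cl (fun N => B (N+1)) (dq h v g) := by
  have h1 : ContDiff ℝ (⊤:ℕ∞) (fun x => g (x + h • v)) := hg.1.comp (contDiff_id.add contDiff_const)
  refine ⟨contDiff_const.mul (h1.sub hg.1), fun N x => ?_⟩
  have e0 : _root_.dq h v g = h⁻¹ • ((fun x => g (x + h • v)) - g) := by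
    ext x; simp [_root_.dq]
  have e1 : iteratedFDeriv ℝ N (_root_.dq h v g) x = h⁻¹ • (iteratedFDeriv ℝ N g (x + h • v) - iteratedFDeriv ℝ N g x) := by
    rw [e0, iteratedFDeriv_const_smul_apply, iteratedFDeriv_sub_apply, iteratedFDeriv_comp_add_right]
    · exact (h1.of_le (by exact_mod_cast le_top)).contDiffAt
    · exact (hg.1.of_le (by exact_mod_cast le_top)).contDiffAt
    · exact ((h1.sub hg.1).of_le (by exact_mod_cast le_top)).contDiffAt
  have e2 : ‖iteratedFDeriv ℝ N g (x + h • v) - iteratedFDeriv ℝ N g x‖ ≤ B (N+1) * ‖(x + h • v) - x‖ := by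
    apply Convex.norm_image_sub_le_of_norm_fderiv_le (𝕜 := ℝ) (s := Set.univ) (f := iteratedFDeriv ℝ N g)
    · intro y _
      exact (hg.1.differentiable_iteratedFDeriv (by exact_mod_cast WithTop.coe_lt_top N)) y
    · intro y _
      rw [norm_fderiv_iteratedFDeriv]; exact hg.2 (N+1) y
    · exact convex_univ
    · trivial
    · trivial
  have hB : 0 ≤ B (N+1) := (norm_nonneg _).trans (hg.2 (N+1) x)
  rw [e1, norm_smul, norm_inv]
  by_cases h0 : h = 0
  · simpa [h0] using hB
  rw [inv_mul_le_iff₀ (by positivity)]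
  refine e2.trans ?_
  rw [add_sub_cancel_left, norm_smul, mul_comm]
  have : ‖h‖ * ‖v‖ ≤ ‖h‖ * 1 := by gcongr
  nlinarith

lemma exists_Cl (g : (ι → ℝ) → ℝ) (hg : ContDiff ℝ (⊤:ℕ∞) g) (hc : HasCompactSupport g) : ∃ B, Cl B g := by
  have : ∀ N : ℕ, ∃ C, ∀ x, ‖iteratedFDeriv ℝ N g x‖ ≤ C := by
    intro N
    exact (hg.continuous_iteratedFDeriv (by exact_mod_cast le_top)).bounded_above_of_compact_support (hc.iteratedFDeriv N)
  choose B hB using this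
  exact ⟨B, hg, hB⟩

/-- chordal distance to zero -/
def rho (z : AddCircle (1:ℝ)) : ℝ := ‖fourier 1 z - 1‖

lemma rho_sq (z : AddCircle (1:ℝ)) : ((rho z ^ 2 : ℝ) : ℂ) = 2 - fourier 1 z - fourier (-1) z := by
  have h1 : fourier (-1) z = conj (fourier 1 z) := by rw [fourier_neg]
  have h2 : (fourier 1 z : ℂ) * conj (fourier 1 z : ℂ) = 1 := by
    rw [Complex.mul_conj, Complex.normSq_eq_norm_sq, norm_four]; simp
  rw [rho, h1, ← Complex.normSq_eq_norm_sq, ← Complex.mul_conj, map_sub, map_one]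
  linear_combination h2

def scl (R : ℝ) (ξ : ι → ℤ) : ι → ℝ := fun i => R⁻¹ * (ξ i : ℝ)

def kern (g : (ι → ℝ) → ℝ) (R : ℝ) (z : ι → AddCircle (1:ℝ)) : ℂ := ∑' ξ : ι → ℤ, (g (scl R ξ) : ℂ) * chr ξ z

def ibox (ι : Type) [Fintype ι] [DecidableEq ι] (N : ℕ) : Finset (ι → ℤ) := Finset.Icc (fun _ => -(N:ℤ)) (fun _ => (N:ℤ))

lemma mem_ibox (N : ℕ) (ξ : ι → ℤ) : ξ ∈ ibox ι N ↔ ∀ i, |ξ i| ≤ N := by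
  simp only [ibox, Finset.mem_Icc, Pi.le_def, abs_le]
  exact ⟨fun h i => ⟨h.1 i, h.2 i⟩, fun h => ⟨fun i => (h i).1, fun i => (h i).2⟩⟩

lemma card_ibox (N : ℕ) : #(ibox ι N) = (2 * N + 1)^(Fintype.card ι) := by
  rw [ibox, Pi.card_Icc]
  simp only [Int.card_Icc, Finset.prod_const, Finset.card_univ]
  congr 1; omega

/-- support condition -/
def Sup (A : ℝ) (g : (ι → ℝ) → ℝ) : Prop := ∀ x i, A < |x i| → g x = 0

lemma Sup.ibox {A : ℝ} {g : (ι → ℝ) → ℝ} (h : Sup A g) {R : ℝ} (hR : 0 < R) (N : ℕ) (hN : A * R < N + 1) (ξ : ι → ℤ)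
    (hξ : ξ ∉ ibox ι N) : g (scl R ξ) = 0 := by
  rw [mem_ibox] at hξ
  push Not at hξ
  obtain ⟨i, hi⟩ := hξ
  refine h _ i ?_
  simp only [scl]
  rw [abs_mul, abs_of_pos (by positivity), ← div_eq_inv_mul, lt_div_iff₀ hR]
  refine hN.trans_le ?_
  have h1 : (N:ℤ) + 1 ≤ |ξ i| := hi
  have : ((N:ℤ) + 1 : ℝ) ≤ (|ξ i| : ℤ) := by exact_mod_cast h1
  simpa using this

lemma kern_eq {A : ℝ} {g : (ι → ℝ) → ℝ} (h : Sup A g) {R : ℝ} (hR : 0 < R) (N : ℕ) (hN : A * R < N + 1)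
    (z : ι → AddCircle (1:ℝ)) : kern g R z = ∑ ξ ∈ ibox ι N, (g (scl R ξ) : ℂ) * chr ξ z := by
  unfold kern
  apply tsum_eq_sum
  intro ξ hξ
  rw [h.ibox hR N hN ξ hξ]; simp

lemma kern_summable {A : ℝ} {g : (ι → ℝ) → ℝ} (h : Sup A g) {R : ℝ} (hR : 0 < R) (v : ι → ℤ)
    (z : ι → AddCircle (1:ℝ)) : Summable (fun ξ : ι → ℤ => (g (scl R (ξ + v)) : ℂ) * chr ξ z) := by
  have h1 : Summable (fun ξ : ι → ℤ => (g (scl R ξ) : ℂ) * chr (ξ - v) z) := by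
    apply summable_of_ne_finset_zero (s := ibox ι (⌈A * R⌉₊))
    intro ξ hξ
    rw [h.ibox hR _ (by linarith [Nat.le_ceil (A*R)]) ξ hξ]; simp
  have := (Equiv.addRight v).summable_iff.2 h1
  refine this.congr (fun ξ => ?_)
  simp [Function.comp_def]

lemma chr_add (ξ η : ι → ℤ) (z : ι → AddCircle (1:ℝ)) : chr (ξ + η) z = chr ξ z * chr η z := by
  simp [chr, Finset.prod_mul_distrib]

lemma chr_single (i : ι) (n : ℤ) (z : ι → AddCircle (1:ℝ)) : chr (Pi.single i n) z = fourier n (z i) := by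
  rw [chr, Finset.prod_eq_single i]
  · simp
  · intro j _ hj; simp [Pi.single_eq_of_ne hj]
  · simp

lemma kern_shift (g : (ι → ℝ) → ℝ) (R : ℝ) (v : ι → ℤ) (z : ι → AddCircle (1:ℝ)) :
    ∑' ξ : ι → ℤ, (g (scl R (ξ + v)) : ℂ) * chr ξ z = chr (-v) z * kern g R z := by
  unfold kern
  rw [← tsum_mul_left, ← (Equiv.addRight v).tsum_eq (fun ξ : ι → ℤ => chr (-v) z * ((g (scl R ξ) : ℂ) * chr ξ z))]
  congr 1
  ext ξ
  simp only [Equiv.coe_addRight]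
  have : chr ξ z = chr (-v) z * chr (ξ + v) z := by rw [← chr_add]; congr 1; abel
  rw [this]; ring

/-- the operator `1 - R²Δ` -/
def lop (R : ℝ) (i : ι) (g : (ι → ℝ) → ℝ) (x : ι → ℝ) : ℝ := g x - dq (-R⁻¹) (Pi.single i 1) (dq R⁻¹ (Pi.single i 1) g) x

lemma lop_eq (R : ℝ) (hR : 0 < R) (i : ι) (g : (ι → ℝ) → ℝ) (ξ : ι → ℤ) :
    lop R i g (scl R ξ) = (1 + 2 * R^2) * g (scl R ξ) - R^2 * g (scl R (ξ + Pi.single i 1)) - R^2 * g (scl R (ξ + Pi.single i (-1))) := by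
  have e1 : scl R ξ + R⁻¹ • Pi.single i 1 = scl R (ξ + Pi.single i 1) := by
    ext j; by_cases h : j = i
    · subst h; simp [scl, mul_add]
    · simp [scl, Pi.single_eq_of_ne h]
  have e2 : scl R ξ + (-R⁻¹) • Pi.single i 1 = scl R (ξ + Pi.single i (-1)) := by
    ext j; by_cases h : j = i
    · subst h; simp [scl, mul_add]
    · simp [scl, Pi.single_eq_of_ne h]
  have e3 : scl R (ξ + Pi.single i (-1)) + R⁻¹ • Pi.single i 1 = scl R ξ := by
    ext j; by_cases h : j = i
    · subst h; simp [scl, mul_add]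
    · simp [scl, Pi.single_eq_of_ne h]
  simp only [lop, dq, e1, e2, e3]
  field_simp
  ring

lemma kern_lop {A : ℝ} {g : (ι → ℝ) → ℝ} (h : Sup A g) {R : ℝ} (hR : 0 < R) (i : ι) (z : ι → AddCircle (1:ℝ)) :
    kern (lop R i g) R z = ((1 + R^2 * rho (z i)^2 : ℝ) : ℂ) * kern g R z := by
  have s0 := kern_summable h hR 0 z
  have s1 := kern_summable h hR (Pi.single i 1) z
  have s2 := kern_summable h hR (Pi.single i (-1)) z
  simp only [add_zero] at s0
  have e : ∀ ξ : ι → ℤ, (lop R i g (scl R ξ) : ℂ) * chr ξ z = (1 + 2 * R^2) * ((g (scl R ξ) : ℂ) * chr ξ z)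
     - R^2 * ((g (scl R (ξ + Pi.single i 1)) : ℂ) * chr ξ z) - R^2 * ((g (scl R (ξ + Pi.single i (-1))) : ℂ) * chr ξ z) := by
    intro ξ
    rw [lop_eq R hR]; push_cast; ring
  have hk : kern g R z = ∑' ξ : ι → ℤ, (g (scl R ξ) : ℂ) * chr ξ z := rfl
  rw [kern]
  simp only [e]
  rw [((s0.mul_left _).sub (s1.mul_left _)).tsum_sub (s2.mul_left _), (s0.mul_left _).tsum_sub (s1.mul_left _),
    tsum_mul_left, tsum_mul_left, tsum_mul_left, kern_shift, kern_shift, ← hk, ← Pi.single_neg, ← Pi.single_neg, neg_neg, chr_single, chr_single]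
  have := rho_sq (z i)
  push_cast at this ⊢
  rw [this]; ring

lemma Sup.lop {A : ℝ} {g : (ι → ℝ) → ℝ} (h : Sup A g) {R : ℝ} (hR : 1 ≤ R) (i : ι) : Sup (A+1) (lop R i g) := by
  intro x j hj
  have hR' : R⁻¹ ≤ 1 := inv_le_one_of_one_le₀ hR
  have hR0 : 0 < R⁻¹ := by positivity
  have key : ∀ s : ℝ, |s| ≤ 1 → g (x + s • Pi.single i 1) = 0 := by
    intro s hs
    apply h _ j
    by_cases hji : j = i
    · subst hji
      simp only [Pi.add_apply, Pi.smul_apply, Pi.single_eq_same, smul_eq_mul, mul_one]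
      have := abs_sub_abs_le_abs_sub (x j) (-s)
      rw [abs_neg, sub_neg_eq_add] at this
      linarith
    · simp only [Pi.add_apply, Pi.smul_apply, Pi.single_eq_of_ne hji, smul_zero, add_zero]
      linarith
  have k0 : g x = 0 := by simpa using key 0 (by simp)
  have k1 := key R⁻¹ (by rwa [abs_of_pos hR0])
  have k2 := key (-R⁻¹) (by rwa [abs_neg, abs_of_pos hR0])
  have k3 : g (x + -R⁻¹ • Pi.single i 1 + R⁻¹ • Pi.single i 1) = 0 := by
    rw [add_assoc, ← add_smul]; simpa using k0
  simp only [_root_.lop, dq, k0, k1, k2, k3]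
  simp

lemma Cl.lop {B : ℕ → ℝ} {g : (ι → ℝ) → ℝ} (hg : Cl B g) (R : ℝ) (i : ι) :
    Cl (fun N => B N + B (N+1+1)) (lop R i g) := by
  have hv : ‖(Pi.single i 1 : ι → ℝ)‖ ≤ 1 := by
    rw [pi_norm_le_iff_of_nonneg zero_le_one]
    intro j
    by_cases h : j = i
    · subst h; simp
    · simp [Pi.single_eq_of_ne h]
  exact hg.sub ((hg.dq _ _ hv).dq _ _ hv)

/-- pointwise kernel bound -/
lemma kern_bound (l : List ι) : ∀ (B : ℕ → ℝ) (A : ℝ), 0 ≤ A → ∃ C : ℝ, 0 ≤ C ∧ ∀ (g : (ι → ℝ) → ℝ) (R : ℝ), 1 ≤ R → Cl B g → Sup A g →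
    ∀ z : ι → AddCircle (1:ℝ), ‖kern g R z‖ * (l.map (fun i => 1 + R^2 * rho (z i)^2)).prod ≤ C * R^(Fintype.card ι) := by
  induction l with
  | nil =>
    intro B A hA
    refine ⟨|B 0| * (2*A+3)^(Fintype.card ι), by positivity, fun g R hR hg hs z => ?_⟩
    have hR0 : 0 < R := by linarith
    simp only [List.map_nil, List.prod_nil, mul_one]
    rw [kern_eq hs hR0 ⌈A*R⌉₊ (by linarith [Nat.le_ceil (A*R)])]
    refine (norm_sum_le _ _).trans ?_
    have h1 : ∀ ξ ∈ ibox ι ⌈A*R⌉₊, ‖(g (scl R ξ) : ℂ) * chr ξ z‖ ≤ |B 0| := by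
      intro ξ _
      rw [norm_mul, norm_chr, mul_one, Complex.norm_real]
      exact (hg.bound _).trans (le_abs_self _)
    refine (Finset.sum_le_card_nsmul _ _ _ h1).trans ?_
    rw [card_ibox, nsmul_eq_mul, mul_comm, mul_assoc, ← mul_pow]
    push_cast
    gcongr
    have := (Nat.ceil_lt_add_one (show 0 ≤ A * R by positivity)).le
    nlinarith
  | cons i l ih =>
    intro B A hA
    obtain ⟨C, hC, h⟩ := ih (fun N => B N + B (N+1+1)) (A+1) (by linarith)
    refine ⟨C, hC, fun g R hR hg hs z => ?_⟩
    have := h (lop R i g) R hR (hg.lop R i) (hs.lop hR i) z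
    rw [kern_lop hs (by linarith), norm_mul, Complex.norm_real, Real.norm_of_nonneg (by positivity)] at this
    simp only [List.map_cons, List.prod_cons]
    linarith
end kernel

lemma rho_nonneg (z : AddCircle (1:ℝ)) : 0 ≤ rho z := norm_nonneg _

lemma four_add (n : ℤ) (z w : AddCircle (1:ℝ)) : (fourier n (z + w) : ℂ) = fourier n z * fourier n w := by
  simp only [fourier_apply, smul_add, AddCircle.toCircle_add, Circle.coe_mul]

lemma rho_add_le (z w : AddCircle (1:ℝ)) : rho (z + w) ≤ rho z + rho w := by
  have : (fourier 1 (z+w) : ℂ) - 1 = fourier 1 z * (fourier 1 w - 1) + (fourier 1 z - 1) := by rw [four_add]; ring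
  unfold rho
  rw [this]
  refine (norm_add_le _ _).trans ?_
  rw [norm_mul, norm_four, one_mul, add_comm]

lemma rho_neg (z : AddCircle (1:ℝ)) : rho (-z) = rho z := by
  have h1 : (fourier 1 z : ℂ) * fourier 1 (-z) = 1 := by rw [← four_add]; simp
  have : (fourier 1 (-z) : ℂ) - 1 = - (fourier 1 (-z) * (fourier 1 z - 1)) := by
    linear_combination h1
  unfold rho
  rw [this, norm_neg, norm_mul, norm_four, one_mul]

lemma rho_coe (x : ℝ) : rho (x : AddCircle (1:ℝ)) = 2 * |Real.sin (Real.pi * x)| := by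
  unfold rho
  rw [fourier_coe_apply]
  have : (2 * Real.pi * I * (1:ℤ) * x / (1:ℝ) : ℂ) = I * ((2 * (Real.pi * x) : ℝ) : ℂ) := by push_cast; ring
  rw [this, mul_comm I, Complex.exp_mul_I]
  have h1 := Complex.normSq_eq_norm_sq (Complex.cos ((2 * (Real.pi * x) : ℝ) : ℂ) + Complex.sin ((2 * (Real.pi * x) : ℝ) : ℂ) * I - 1)
  have h2 : Complex.normSq (Complex.cos ((2 * (Real.pi * x) : ℝ) : ℂ) + Complex.sin ((2 * (Real.pi * x) : ℝ) : ℂ) * I - 1) = (2 * |Real.sin (Real.pi * x)|)^2 := by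
    rw [← Complex.ofReal_cos, ← Complex.ofReal_sin, Complex.normSq_apply]
    simp only [Complex.sub_re, Complex.add_re, Complex.ofReal_re, Complex.mul_re, Complex.I_re, Complex.ofReal_im, Complex.I_im, Complex.one_re,
      Complex.sub_im, Complex.add_im, Complex.mul_im, Complex.one_im]
    rw [Real.cos_two_mul, Real.sin_two_mul, mul_pow, sq_abs]
    have := Real.sin_sq_add_cos_sq (Real.pi * x)
    have h3 : Real.cos (Real.pi * x)^2 = 1 - Real.sin (Real.pi * x)^2 := by linarith
    ring_nf
    rw [show Real.cos (Real.pi * x)^4 = (Real.cos (Real.pi * x)^2)^2 by ring, h3]; ring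
  rw [h2] at h1
  exact ((sq_eq_sq₀ (by positivity) (by positivity)).1 h1).symm

lemma rho_le (x : ℝ) : rho (x : AddCircle (1:ℝ)) ≤ 2 * Real.pi * |x| := by
  rw [rho_coe]
  have := Real.abs_sin_le_abs (x := Real.pi * x)
  rw [abs_mul, abs_of_pos Real.pi_pos] at this
  linarith

lemma le_rho (x : ℝ) (hx : |x| ≤ 1/2) : 4 * |x| ≤ rho (x : AddCircle (1:ℝ)) := by
  rw [rho_coe]
  have h1 : |Real.sin (Real.pi * x)| = Real.sin (Real.pi * |x|) := by
    rcases abs_cases x with ⟨h, h'⟩ | ⟨h, h'⟩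
    · rw [h] at hx ⊢
      exact abs_of_nonneg (Real.sin_nonneg_of_nonneg_of_le_pi (by positivity) (by nlinarith [Real.pi_pos]))
    · rw [h] at hx ⊢
      rw [mul_neg, Real.sin_neg]
      apply abs_of_nonpos
      apply Real.sin_nonpos_of_nonpos_of_neg_pi_le <;> nlinarith [Real.pi_pos]
  have h2 := Real.mul_le_sin (x := Real.pi * |x|) (by positivity) (by nlinarith [Real.pi_pos])
  rw [h1]
  have : 2 / Real.pi * (Real.pi * |x|) = 2 * |x| := by field_simp
  linarith

lemma sum_zmod (M : ℕ) [NeZero M] (h : ℕ → ℝ) : ∑ a : ZMod M, h a.val = ∑ v ∈ Finset.range M, h v := by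
  apply Finset.sum_nbij (i := ZMod.val)
  · intro a _; simp [ZMod.val_lt]
  · intro a _ b _ hab; exact ZMod.val_injective M hab
  · intro v hv
    refine ⟨(v : ZMod M), by simp, ZMod.val_natCast_of_lt (by simpa using hv)⟩
  · intro a _; rfl

lemma toAdd_val (M : ℕ) [NeZero M] (a : ZMod M) : ZMod.toAddCircle a = (((a.val : ℝ) / M : ℝ) : AddCircle (1:ℝ)) := by
  rw [ZMod.toAddCircle_apply]

lemma one_d_aux (t : ℝ) (ht : 0 < t) (ht1 : t ≤ 1) (n : ℕ) :
    ∑ v ∈ Finset.range n, 1 / (1 + t^2 * (v:ℝ)^2) ≤ 4 / t := by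
  have h1 : ∀ v : ℕ, 1 / (1 + t^2 * (v:ℝ)^2) ≤ (4/t) * (1/(1+t*v) - 1/(1+t*((v+1:ℕ):ℝ))) := by
    intro v
    have hv : (0:ℝ) ≤ v := by positivity
    have e : (4/t) * (1/(1+t*v) - 1/(1+t*((v+1:ℕ):ℝ))) = 4 / ((1+t*v) * (1+t*(v+1))) := by
      push_cast
      have : 0 < 1 + t * (v:ℝ) := by positivity
      have : 0 < 1 + t * ((v:ℝ)+1) := by positivity
      field_simp; ring
    rw [e, div_le_div_iff₀ (by positivity) (by positivity)]
    have : 0 ≤ t * v := by positivity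
    nlinarith [sq_nonneg (1 - t * v)]
  refine (Finset.sum_le_sum fun v _ => h1 v).trans ?_
  rw [← Finset.mul_sum, Finset.sum_range_sub']
  have : 0 ≤ 1 / (1 + t * (n:ℝ)) := by positivity
  simp only [Nat.cast_zero, mul_zero, add_zero, div_one]
  have h3 : 0 < 4 / t := by positivity
  nlinarith

lemma one_d_sum (M : ℕ) [NeZero M] (R : ℝ) (hR : 1 ≤ R) (hRM : R ≤ M) :
    ∑ a : ZMod M, 1 / (1 + R^2 * rho (ZMod.toAddCircle a)^2) ≤ 9 * (M / R) := by
  have hM : (0:ℝ) < M := by linarith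
  have hR0 : 0 < R := by linarith
  set t := R / M with ht
  have ht0 : 0 < t := by positivity
  have ht1 : t ≤ 1 := by rw [ht, div_le_one hM]; exact hRM
  have key : ∀ a : ZMod M, 1 / (1 + R^2 * rho (ZMod.toAddCircle a)^2) ≤
      (fun v : ℕ => 1 / (1 + t^2 * (v:ℝ)^2) + 1 / (1 + t^2 * ((M - 1 - v : ℕ):ℝ)^2)) a.val := by
    intro a
    have hv := ZMod.val_lt a
    set v := a.val with hvd
    have gen : ∀ s : ℝ, 0 ≤ s → s / M ≤ rho (ZMod.toAddCircle a) → 1 / (1 + R^2 * rho (ZMod.toAddCircle a)^2) ≤ 1 / (1 + t^2 * s^2) := by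
      intro s hs h
      have : t^2 * s^2 = R^2 * (s / M)^2 := by rw [ht]; field_simp
      rw [this]
      gcongr
    have p1 : 0 ≤ 1 / (1 + t^2 * (v:ℝ)^2) := by positivity
    have p2 : 0 ≤ 1 / (1 + t^2 * ((M - 1 - v : ℕ):ℝ)^2) := by positivity
    have hvM : (v:ℝ) + ((M-1-v : ℕ):ℝ) + 1 = M := by
      have : v + (M-1-v) + 1 = M := by omega
      exact_mod_cast this
    by_cases h : (v:ℝ) / M ≤ 1/2
    · have h1 := le_rho ((v:ℝ)/M) (by rwa [abs_of_nonneg (by positivity)])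
      rw [← toAdd_val, abs_of_nonneg (by positivity)] at h1
      have := gen v (by positivity) (by have : 0 ≤ (v:ℝ)/M := by positivity
                                        linarith)
      dsimp only; linarith
    · push Not at h
      have e : ZMod.toAddCircle a = (((v:ℝ)/M - 1 : ℝ) : AddCircle (1:ℝ)) := by
        rw [toAdd_val, AddCircle.coe_sub, AddCircle.coe_period, sub_zero]
      have h2 : (v:ℝ)/M - 1 = - ((((M-1-v : ℕ):ℝ) + 1)/M) := by
        field_simp; linarith
      have h0 : (0:ℝ) ≤ ((M-1-v : ℕ):ℝ) := by positivity
      have h1 := le_rho ((v:ℝ)/M - 1) (by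
        rw [h2, abs_neg, abs_of_nonneg (by positivity)]
        have := h2; linarith)
      rw [← e, h2, abs_neg, abs_of_nonneg (by positivity)] at h1
      have := gen ((M-1-v : ℕ):ℝ) (by positivity) (by
        refine le_trans ?_ h1
        have h3 : ((M-1-v : ℕ):ℝ)/M ≤ (((M-1-v : ℕ):ℝ) + 1)/M := by gcongr; linarith
        have h4 : 0 ≤ (((M-1-v : ℕ):ℝ) + 1)/M := by positivity
        linarith)
      dsimp only; linarith
  refine (Finset.sum_le_sum fun a _ => key a).trans ?_
  rw [sum_zmod M (fun v : ℕ => 1 / (1 + t^2 * (v:ℝ)^2) + 1 / (1 + t^2 * ((M - 1 - v : ℕ):ℝ)^2)), Finset.sum_add_distrib,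
    Finset.sum_range_reflect (fun v : ℕ => 1 / (1 + t^2 * (v:ℝ)^2))]
  have := one_d_aux t ht0 ht1 M
  have h9 : 1 / t = M / R := by rw [ht]; field_simp
  have h8 : 4 / t = 4 * (1 / t) := by ring
  have : 0 < M / R := by positivity
  linarith

section gridk
variable {ι : Type} [Fintype ι] [DecidableEq ι]

/-- embedding of the grid in the torus -/
def gp {M : ℕ} [NeZero M] (a : ι → ZMod M) : ι → AddCircle (1:ℝ) := fun i => ZMod.toAddCircle (a i)

lemma grid_prod_sum (M : ℕ) [NeZero M] (R : ℝ) (hR : 1 ≤ R) (hRM : R ≤ M) :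
    ∑ a : ι → ZMod M, ∏ i, (1 / (1 + R^2 * rho (gp a i)^2)) ≤ (9 * (M / R))^(Fintype.card ι) := by
  have := Finset.prod_univ_sum (fun _ : ι => (Finset.univ : Finset (ZMod M))) (fun _ a => 1 / (1 + R^2 * rho (ZMod.toAddCircle a)^2))
  rw [Fintype.piFinset_univ] at this
  unfold gp
  rw [← this, Finset.prod_const, Finset.card_univ]
  have h0 : 0 ≤ ∑ a : ZMod M, 1 / (1 + R^2 * rho (ZMod.toAddCircle a)^2) := Finset.sum_nonneg fun _ _ => by positivity
  exact pow_le_pow_left₀ h0 (one_d_sum M R hR hRM) _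

lemma kern_l1 (B : ℕ → ℝ) (A : ℝ) (hA : 0 ≤ A) : ∃ C : ℝ, 0 ≤ C ∧ ∀ (g : (ι → ℝ) → ℝ) (R : ℝ) (M : ℕ) [NeZero M],
    1 ≤ R → R ≤ M → Cl B g → Sup A g →
    (∑ a : ι → ZMod M, ‖kern g R (gp a)‖ ≤ C * M^(Fintype.card ι)) ∧
    ∀ i, (∑ a : ι → ZMod M, ‖kern g R (gp a)‖ * (R * rho (gp a i))) ≤ C * M^(Fintype.card ι) := by
  obtain ⟨C0, hC0, h0⟩ := kern_bound (Finset.univ : Finset ι).toList B A hA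
  have hi := fun i : ι => kern_bound (i :: (Finset.univ : Finset ι).toList) B A hA
  choose Ci hCi hi using hi
  have gen : ∀ (C : ℝ) (R : ℝ) (M : ℕ) [NeZero M] (u : (ι → ZMod M) → ℝ), 0 ≤ C → 1 ≤ R → R ≤ M → (∀ a, u a * ∏ i, (1 + R^2 * rho (gp a i)^2) ≤ C * R^(Fintype.card ι)) →
      ∑ a, u a ≤ C * 9^(Fintype.card ι) * M^(Fintype.card ι) := by
    intro C R M _ u hC hR hRM hu
    have hR0 : 0 < R := by linarith
    have h1 : ∀ a, u a ≤ C * R^(Fintype.card ι) * ∏ i, (1 / (1 + R^2 * rho (gp a i)^2)) := by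
      intro a
      have hp : 0 < ∏ i, (1 + R^2 * rho (gp a i)^2) := Finset.prod_pos fun i _ => by positivity
      rw [Finset.prod_div_distrib, Finset.prod_const_one, mul_one_div, le_div_iff₀ hp]
      exact hu a
    refine (Finset.sum_le_sum fun a _ => h1 a).trans ?_
    rw [← Finset.mul_sum]
    refine (mul_le_mul_of_nonneg_left (grid_prod_sum M R hR hRM) (by positivity)).trans (le_of_eq ?_)
    rw [mul_assoc, ← mul_pow, mul_assoc, ← mul_pow]
    congr 2; field_simp
  refine ⟨(C0 + ∑ i, Ci i) * 9^(Fintype.card ι), by have := Finset.sum_nonneg fun i (_ : i ∈ (Finset.univ : Finset ι)) => hCi i; positivity, fun g R M _ hR hRM hg hs => ⟨?_, fun i => ?_⟩⟩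
  · have hh := fun a : ι → ZMod M => h0 g R hR hg hs (gp a)
    simp only [Finset.prod_map_toList] at hh
    refine (gen C0 R M (fun a => ‖kern g R (gp a)‖) hC0 hR hRM hh).trans ?_
    have := Finset.sum_nonneg fun i (_ : i ∈ (Finset.univ : Finset ι)) => hCi i
    gcongr; linarith
  · have hh := fun a : ι → ZMod M => hi i g R hR hg hs (gp a)
    simp only [List.map_cons, List.prod_cons, Finset.prod_map_toList] at hh
    refine (gen (Ci i) R M (fun a => ‖kern g R (gp a)‖ * (R * rho (gp a i))) (hCi i) hR hRM (fun a => le_trans ?_ (hh a))).trans ?_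
    · have hp : 0 < ∏ i, (1 + R^2 * rho (gp a i)^2) := Finset.prod_pos fun i _ => by positivity
      rw [mul_assoc]
      gcongr
      nlinarith [sq_nonneg (R * rho (gp a i) - 1), sq_nonneg (R * rho (gp a i))]
    · have := Finset.single_le_sum (fun i _ => hCi i) (Finset.mem_univ i)
      gcongr; linarith
end gridk

section
variable {ι : Type} [Fintype ι] [DecidableEq ι]

lemma four_zmod (M : ℕ) [NeZero M] (n : ℤ) (a : ZMod M) :
    (fourier n (ZMod.toAddCircle a) : ℂ) = ZMod.stdAddChar ((n : ZMod M) * a) := by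
  rw [ZMod.stdAddChar_apply, ZMod.toCircle, fourier_apply]
  have : ((n : ZMod M) * a) = n • a := by simp
  rw [this]
  show _ = ((AddCircle.toCircle (ZMod.toAddCircle (n • a)) : Circle) : ℂ)
  rw [map_zsmul]

lemma sum_shift {G E : Type*} [AddCommGroup G] [Fintype G] [AddCommMonoid E] (f : G → E) (b : G) : ∑ a, f (a - b) = ∑ a, f a :=
  Fintype.sum_equiv (Equiv.subRight b) _ _ (fun _ => rfl)

lemma orth1 (M : ℕ) [NeZero M] (n : ℤ) (hn : |n| < M) :
    ∑ a : ZMod M, (fourier n (ZMod.toAddCircle a) : ℂ) = if n = 0 then (M : ℂ) else 0 := by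
  simp_rw [four_zmod]
  have := AddChar.sum_mulShift (n : ZMod M) (ZMod.isPrimitive_stdAddChar M)
  simp_rw [mul_comm (n : ZMod M)]
  rw [this]
  have h : ((n : ZMod M) = 0) ↔ n = 0 := by
    rw [ZMod.intCast_zmod_eq_zero_iff_dvd]
    constructor
    · intro h; exact Int.eq_zero_of_abs_lt_dvd h hn
    · rintro rfl; simp
  simp [h]

lemma orth (M : ℕ) [NeZero M] (ξ : ι → ℤ) (hn : ∀ i, |ξ i| < M) :
    ∑ a : ι → ZMod M, chr ξ (gp a) = if ξ = 0 then (M : ℂ)^(Fintype.card ι) else 0 := by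
  have : ∏ i, ∑ a : ZMod M, (fourier (ξ i) (ZMod.toAddCircle a) : ℂ) = ∑ a : ι → ZMod M, chr ξ (gp a) := by
    rw [Finset.prod_univ_sum]
    simp [chr, gp]
  rw [← this]
  simp_rw [orth1 M _ (hn _)]
  split_ifs with h
  · subst h; simp
  · have : ∃ i, ξ i ≠ 0 := by
      by_contra hc; push Not at hc; exact h (funext hc)
    obtain ⟨i, hi⟩ := this
    exact Finset.prod_eq_zero (Finset.mem_univ i) (by simp [hi])

lemma chr_zadd (ξ : ι → ℤ) (z w : ι → AddCircle (1:ℝ)) : chr ξ (z + w) = chr ξ z * chr ξ w := by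
  simp [chr, four_add, Finset.prod_mul_distrib, -fourier_apply]

lemma chr_conj (ξ : ι → ℤ) (z : ι → AddCircle (1:ℝ)) : conj (chr ξ z) = chr (-ξ) z := by
  simp [chr, map_prod]

lemma chr_neg (ξ : ι → ℤ) (z : ι → AddCircle (1:ℝ)) : chr ξ (-z) = chr (-ξ) z := by
  simp [chr, fourier_apply]

lemma gp_sub {M : ℕ} [NeZero M] (a b : ι → ZMod M) : gp (a - b) = gp a - gp b := by
  funext i; simp [gp]

lemma gp_add {M : ℕ} [NeZero M] (a b : ι → ZMod M) : gp (a + b) = gp a + gp b := by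
  funext i; simp [gp]

lemma four_sub_one (n : ℤ) (z : AddCircle (1:ℝ)) : ‖(fourier n z : ℂ) - 1‖ ≤ |(n:ℝ)| * rho z := by
  have hnat : ∀ n : ℕ, ‖(fourier (n:ℤ) z : ℂ) - 1‖ ≤ (n:ℝ) * rho z := by
    intro n
    induction n with
    | zero => simp
    | succ n ih =>
      have : (fourier ((n+1 : ℕ):ℤ) z : ℂ) - 1 = fourier 1 z * ((fourier (n:ℤ) z : ℂ) - 1) + ((fourier 1 z : ℂ) - 1) := by
        push_cast; rw [fourier_add]; ring
      rw [this]
      refine (norm_add_le _ _).trans ?_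
      rw [norm_mul, norm_four, one_mul]
      push_cast
      have : ‖(fourier 1 z : ℂ) - 1‖ = rho z := rfl
      rw [this]; linarith
  obtain ⟨k, rfl | rfl⟩ := n.eq_nat_or_neg
  · simpa using hnat k
  · have : (fourier (-(k:ℤ)) z : ℂ) - 1 = conj ((fourier (k:ℤ) z : ℂ) - 1) := by rw [fourier_neg]; simp
    rw [this, RCLike.norm_conj]; simpa using hnat k

lemma chr_sub_one (ξ : ι → ℤ) (z : ι → AddCircle (1:ℝ)) : ‖chr ξ z - 1‖ ≤ ∑ i, |(ξ i:ℝ)| * rho (z i) := by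
  have : ∀ s : Finset ι, ‖∏ i ∈ s, (fourier (ξ i) (z i) : ℂ) - 1‖ ≤ ∑ i ∈ s, |(ξ i:ℝ)| * rho (z i) := by
    intro s
    induction s using Finset.induction_on with
    | empty => simp
    | insert a s ha ih =>
      rw [Finset.prod_insert ha, Finset.sum_insert ha]
      have : (fourier (ξ a) (z a) : ℂ) * ∏ i ∈ s, (fourier (ξ i) (z i) : ℂ) - 1 =
        fourier (ξ a) (z a) * (∏ i ∈ s, (fourier (ξ i) (z i) : ℂ) - 1) + (fourier (ξ a) (z a) - 1) := by ring
      rw [this]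
      refine (norm_add_le _ _).trans ?_
      rw [norm_mul, norm_four, one_mul]
      linarith [four_sub_one (ξ a) (z a)]
  exact this _

lemma planch (M : ℕ) [NeZero M] (P : ℕ) (hP : 2 * P < M) (c : (ι → ℤ) → ℂ) :
    ∑ a : ι → ZMod M, ‖∑ ξ ∈ ibox ι P, c ξ * chr ξ (gp a)‖^2 = (M:ℝ)^(Fintype.card ι) * ∑ ξ ∈ ibox ι P, ‖c ξ‖^2 := by
  have : ((∑ a : ι → ZMod M, ‖∑ ξ ∈ ibox ι P, c ξ * chr ξ (gp a)‖^2 : ℝ) : ℂ) = (((M:ℝ)^(Fintype.card ι) * ∑ ξ ∈ ibox ι P, ‖c ξ‖^2 : ℝ) : ℂ) := by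
    push_cast
    simp_rw [← Complex.mul_conj', map_sum, map_mul, Finset.sum_mul_sum, chr_conj]
    rw [Finset.sum_comm, Finset.mul_sum]
    refine Finset.sum_congr rfl fun ξ hξ => ?_
    rw [Finset.sum_comm]
    have : ∀ η ∈ ibox ι P, ∑ a : ι → ZMod M, c ξ * chr ξ (gp a) * (conj (c η) * chr (-η) (gp a)) = if ξ = η then (M:ℂ)^(Fintype.card ι) * (c ξ * conj (c ξ)) else 0 := by
      intro η hη
      have h1 : ∀ a : ι → ZMod M, c ξ * chr ξ (gp a) * (conj (c η) * chr (-η) (gp a)) = c ξ * conj (c η) * chr (ξ - η) (gp a) := by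
        intro a; rw [sub_eq_add_neg, chr_add]; ring
      simp_rw [h1]
      rw [← Finset.mul_sum, orth]
      · by_cases h : ξ = η
        · subst h; simp; ring
        · simp [h, sub_eq_zero]
      · intro i
        rw [mem_ibox] at hξ hη
        have := hξ i; have := hη i
        have h3 := abs_sub (ξ i) (η i)
        simp only [Pi.sub_apply]
        zify at hP
        linarith
    rw [Finset.sum_congr rfl this]
    simp [hξ]
  exact_mod_cast this

def Dk (M : ℕ) [NeZero M] (P : ℕ) (a : ι → ZMod M) : ℂ := ∑ ξ ∈ ibox ι P, chr ξ (gp a)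

lemma repro (M : ℕ) [NeZero M] (N : ℕ) (hN : 4 * N < M) (ξ : ι → ℤ) (hξ : ξ ∈ ibox ι N) (a : ι → ZMod M) :
    ∑ b : ι → ZMod M, chr ξ (gp b) * (Dk M (2*N) (a - b) * Dk M N (a - b)) =
      ((M:ℂ)^(Fintype.card ι) * (2*N+1)^(Fintype.card ι)) * chr ξ (gp a) := by
  rw [← (Equiv.subLeft a).sum_comp]
  simp only [Equiv.subLeft_apply, sub_sub_cancel]
  have h1 : ∀ c : ι → ZMod M, chr ξ (gp (a - c)) * (Dk M (2*N) c * Dk M N c) =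
     chr ξ (gp a) * ∑ η ∈ ibox ι N, ∑ ζ ∈ ibox ι (2*N), chr (ζ + η - ξ) (gp c) := by
    intro c
    rw [gp_sub, sub_eq_add_neg, chr_zadd, chr_neg, mul_assoc]
    congr 1
    unfold Dk
    rw [Finset.sum_mul_sum, Finset.sum_comm, Finset.mul_sum]
    refine Finset.sum_congr rfl fun η _ => ?_
    rw [Finset.mul_sum]
    refine Finset.sum_congr rfl fun ζ _ => ?_
    rw [sub_eq_add_neg, chr_add, chr_add]; ring
  simp_rw [h1]
  rw [← Finset.mul_sum, mul_comm]
  congr 1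
  rw [Finset.sum_comm]
  have h2 : ∀ η ∈ ibox ι N, ∑ c : ι → ZMod M, ∑ ζ ∈ ibox ι (2*N), chr (ζ + η - ξ) (gp c) = (M:ℂ)^(Fintype.card ι) := by
    intro η hη
    rw [Finset.sum_comm]
    rw [mem_ibox] at hξ hη
    have h3 : ∀ ζ ∈ ibox ι (2*N), ∑ c : ι → ZMod M, chr (ζ + η - ξ) (gp c) = if ζ = ξ - η then (M:ℂ)^(Fintype.card ι) else 0 := by
      intro ζ hζ
      rw [orth]
      · have : ζ + η - ξ = 0 ↔ ζ = ξ - η := by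
          rw [sub_eq_zero, eq_sub_iff_add_eq]
        simp [this]
      · intro i
        rw [mem_ibox] at hζ
        have e1 := hξ i; have e2 := hη i; have e3 := hζ i
        simp only [Pi.sub_apply, Pi.add_apply]
        have := abs_sub (ζ i + η i) (ξ i)
        have := abs_add_le (ζ i) (η i)
        zify at hN; push_cast at e3
        linarith
    rw [Finset.sum_congr rfl h3]
    rw [Finset.sum_ite_eq', if_pos]
    rw [mem_ibox]; intro i
    have := abs_sub (ξ i) (η i)
    have := hξ i; have := hη i
    simp only [Pi.sub_apply]; push_cast; linarith
  rw [Finset.sum_congr rfl h2, Finset.sum_const, card_ibox]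
  simp; ring

lemma Dk_l2 (M : ℕ) [NeZero M] (P : ℕ) (hP : 2 * P < M) (a' : ι → ZMod M) :
    ∑ a : ι → ZMod M, ‖Dk M P (a - a')‖^2 = (M:ℝ)^(Fintype.card ι) * (2*P+1)^(Fintype.card ι) := by
  rw [sum_shift (fun a => ‖Dk M P a‖^2)]
  have := planch (ι := ι) M P hP (fun _ => 1)
  simp only [one_mul] at this
  unfold Dk
  rw [this]; simp [card_ibox]

lemma Dk_diff (M : ℕ) [NeZero M] (P : ℕ) (hP : 2 * P < M) (δ : ℝ) (hδ : 0 ≤ δ) (a' a0 : ι → ZMod M)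
    (h : ∀ i, rho (gp a' i - gp a0 i) ≤ δ) :
    ∑ a : ι → ZMod M, ‖Dk M P (a - a') - Dk M P (a - a0)‖^2 ≤ (M:ℝ)^(Fintype.card ι) * (2*P+1)^(Fintype.card ι) * (Fintype.card ι * P * δ)^2 := by
  have h1 : ∀ a : ι → ZMod M, Dk M P (a - a') - Dk M P (a - a0) = ∑ ξ ∈ ibox ι P, (chr (-ξ) (gp a') - chr (-ξ) (gp a0)) * chr ξ (gp a) := by
    intro a
    unfold Dk
    rw [← Finset.sum_sub_distrib]
    refine Finset.sum_congr rfl fun ξ _ => ?_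
    rw [gp_sub, gp_sub, sub_eq_add_neg (gp a), sub_eq_add_neg (gp a), chr_zadd, chr_zadd, chr_neg, chr_neg]; ring
  simp_rw [h1]
  rw [planch M P hP (fun ξ => chr (-ξ) (gp a') - chr (-ξ) (gp a0)), mul_assoc]
  gcongr
  have h2 : ∀ ξ ∈ ibox ι P, ‖chr (-ξ) (gp a') - chr (-ξ) (gp a0)‖^2 ≤ (Fintype.card ι * P * δ)^2 := by
    intro ξ hξ
    gcongr
    have : chr (-ξ) (gp a') - chr (-ξ) (gp a0) = chr (-ξ) (gp a0) * (chr (-ξ) (gp a' - gp a0) - 1) := by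
      have : gp a' = gp a0 + (gp a' - gp a0) := by abel
      conv_lhs => rw [this, chr_zadd]
      ring
    rw [this, norm_mul, norm_chr, one_mul]
    refine (chr_sub_one _ _).trans ?_
    rw [mem_ibox] at hξ
    calc _ ≤ ∑ i : ι, (P:ℝ) * δ := by
          refine Finset.sum_le_sum fun i _ => ?_
          refine mul_le_mul ?_ (h i) (rho_nonneg _) (by positivity)
          simp only [Pi.neg_apply, Int.cast_neg, abs_neg]
          exact_mod_cast hξ i
      _ = _ := by simp; ring
  refine (Finset.sum_le_card_nsmul _ _ _ h2).trans ?_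
  rw [card_ibox]; simp

lemma V_diff (M : ℕ) [NeZero M] (N : ℕ) (hN : 4 * N < M) (δ : ℝ) (hδ : 0 ≤ δ) (a' a0 : ι → ZMod M)
    (h : ∀ i, rho (gp a' i - gp a0 i) ≤ δ) :
    ∑ a : ι → ZMod M, ‖Dk M (2*N) (a - a') * Dk M N (a - a') - Dk M (2*N) (a - a0) * Dk M N (a - a0)‖ ≤
      ((M:ℝ)^(Fintype.card ι) * (2*N+1)^(Fintype.card ι)) * (2^(Fintype.card ι) * (3 * Fintype.card ι * N * δ)) := by
  have cs : ∀ f g : (ι → ZMod M) → ℂ, ∀ a b : ℝ, 0 ≤ a → 0 ≤ b → ∑ x, ‖f x‖^2 ≤ a^2 → ∑ x, ‖g x‖^2 ≤ b^2 → ∑ x, ‖f x * g x‖ ≤ a * b := by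
    intro f g a b ha hb hf hg
    have h1 := Finset.sum_mul_sq_le_sq_mul_sq Finset.univ (fun x => ‖f x‖) (fun x => ‖g x‖)
    simp_rw [norm_mul]
    refine abs_le_of_sq_le_sq' ?_ (by positivity) |>.2
    refine h1.trans ?_
    rw [mul_pow]; gcongr
  set d := Fintype.card ι
  set Z : ℝ := Real.sqrt ((M:ℝ)^d * (2*N+1)^d) with hZ
  have hZ0 : 0 ≤ Z := Real.sqrt_nonneg _
  have hZ2 : Z^2 = (M:ℝ)^d * (2*N+1)^d := Real.sq_sqrt (by positivity)
  have e4 : (M:ℝ)^d * (2*(2*N:ℕ)+1)^d ≤ (2^d * Z)^2 := by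
    rw [mul_pow, hZ2, ← pow_mul, mul_comm d 2, pow_mul, mul_left_comm, ← mul_pow (2^2)]
    gcongr
    push_cast; norm_num; linarith
  have b1 := Dk_l2 (ι := ι) M (2*N) (by omega)
  have b2 := Dk_l2 (ι := ι) M N (by omega)
  have b3 := Dk_diff (ι := ι) M (2*N) (by omega) δ hδ a' a0 h
  have b4 := Dk_diff (ι := ι) M N (by omega) δ hδ a' a0 h
  have c1 := cs (fun a => Dk M (2*N) (a - a') - Dk M (2*N) (a - a0)) (fun a => Dk M N (a - a')) (2^d * Z * (d * (2*N:ℕ) * δ)) Z (by positivity) hZ0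
    (b3.trans (by rw [mul_pow (2^d * Z)]; exact mul_le_mul_of_nonneg_right e4 (sq_nonneg _))) (by rw [b2, hZ2])
  have c2 := cs (fun a => Dk M (2*N) (a - a0)) (fun a => Dk M N (a - a') - Dk M N (a - a0)) (2^d * Z) (Z * (d * N * δ)) (by positivity) (by positivity)
    (by rw [b1]; exact e4) (b4.trans (by rw [mul_pow Z, hZ2]))
  have : ∀ a : ι → ZMod M, ‖Dk M (2*N) (a - a') * Dk M N (a - a') - Dk M (2*N) (a - a0) * Dk M N (a - a0)‖ ≤
     ‖(Dk M (2*N) (a - a') - Dk M (2*N) (a - a0)) * Dk M N (a - a')‖ + ‖Dk M (2*N) (a - a0) * (Dk M N (a - a') - Dk M N (a - a0))‖ := by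
    intro a
    refine le_trans (le_of_eq ?_) (norm_add_le _ _)
    congr 1; ring
  refine (Finset.sum_le_sum fun a _ => this a).trans ?_
  rw [Finset.sum_add_distrib]
  refine (add_le_add c1 c2).trans (le_of_eq ?_)
  rw [← hZ2]; push_cast; ring

lemma kern_smooth (A : ℝ) (hA : 0 ≤ A) : ∃ C : ℝ, 0 ≤ C ∧ ∀ (g : (ι → ℝ) → ℝ) (R : ℝ) (M : ℕ) [NeZero M],
    1 ≤ R → 4 * (A + 1) * R < M → Sup A g → ∀ (δ : ℝ), 0 ≤ δ → ∀ a' a0 : ι → ZMod M,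
    (∀ i, rho (gp a' i - gp a0 i) ≤ δ) →
    ∑ a : ι → ZMod M, ‖kern g R (gp (a - a')) - kern g R (gp (a - a0))‖ ≤ C * (R * δ) * ∑ a : ι → ZMod M, ‖kern g R (gp a)‖ := by
  refine ⟨2^(Fintype.card ι) * (3 * Fintype.card ι * (A + 1)), by positivity, ?_⟩
  intro g R M _ hR hM hS δ hδ a' a0 h
  set d := Fintype.card ι
  set N := ⌈A * R⌉₊ 
  have hN1 : A * R < N + 1 := (Nat.le_ceil _).trans_lt (by linarith)
  have hN2 : (N:ℝ) ≤ (A + 1) * R := by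
    have := Nat.ceil_lt_add_one (a := A * R) (by positivity)
    linarith
  have hN3 : 4 * N < M := by
    have : (4:ℝ) * N < M := by linarith
    exact_mod_cast this
  have hk := fun z => kern_eq hS (by linarith : 0 < R) N hN1 z
  set Z : ℝ := (M:ℝ)^d * (2*N+1)^d with hZ
  have hM0 : 0 < (M:ℝ) := by have := NeZero.pos M; exact_mod_cast this
  have hZ0 : 0 < Z := by positivity
  set V : (ι → ZMod M) → ℂ := fun c => Dk M (2*N) c * Dk M N c with hV
  have hrep : ∀ a : ι → ZMod M, (Z:ℂ) * kern g R (gp a) = ∑ b : ι → ZMod M, kern g R (gp b) * V (a - b) := by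
    intro a
    simp_rw [hk, Finset.sum_mul]
    rw [Finset.sum_comm, Finset.mul_sum]
    refine Finset.sum_congr rfl fun ξ hξ => ?_
    simp_rw [mul_assoc]
    rw [← Finset.mul_sum, repro M N hN3 ξ hξ]
    rw [hZ]; push_cast; ring
  have hd : ∀ a : ι → ZMod M, Z * ‖kern g R (gp (a - a')) - kern g R (gp (a - a0))‖ ≤ ∑ b : ι → ZMod M, ‖kern g R (gp b)‖ * ‖V (a - b - a') - V (a - b - a0)‖ := by
    intro a
    have : (Z:ℂ) * (kern g R (gp (a - a')) - kern g R (gp (a - a0))) = ∑ b : ι → ZMod M, kern g R (gp b) * (V (a - b - a') - V (a - b - a0)) := by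
      rw [mul_sub, hrep, hrep, ← Finset.sum_sub_distrib]
      refine Finset.sum_congr rfl fun b _ => ?_
      rw [sub_right_comm a b a', sub_right_comm a b a0]; ring
    have h2 : Z * ‖kern g R (gp (a - a')) - kern g R (gp (a - a0))‖ = ‖(Z:ℂ) * (kern g R (gp (a - a')) - kern g R (gp (a - a0)))‖ := by
      rw [norm_mul, Complex.norm_real, Real.norm_of_nonneg hZ0.le]
    rw [h2, this]
    refine (norm_sum_le _ _).trans (le_of_eq ?_)
    simp
  have hV1 := V_diff M N hN3 δ hδ a' a0 h
  have key : Z * ∑ a : ι → ZMod M, ‖kern g R (gp (a - a')) - kern g R (gp (a - a0))‖ ≤ Z * (2^(Fintype.card ι) * (3 * Fintype.card ι * (A + 1)) * (R * δ) * ∑ a : ι → ZMod M, ‖kern g R (gp a)‖) := by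
    rw [Finset.mul_sum]
    refine (Finset.sum_le_sum fun a _ => hd a).trans ?_
    rw [Finset.sum_comm]
    have : ∀ b : ι → ZMod M, ∑ a : ι → ZMod M, ‖kern g R (gp b)‖ * ‖V (a - b - a') - V (a - b - a0)‖ ≤ ‖kern g R (gp b)‖ * (Z * (2^d * (3 * d * N * δ))) := by
      intro b
      rw [← Finset.mul_sum, sum_shift (fun a => ‖V (a - a') - V (a - a0)‖)]
      gcongr
    refine (Finset.sum_le_sum fun b _ => this b).trans ?_
    rw [← Finset.sum_mul]
    calc _ ≤ (∑ i : ι → ZMod M, ‖kern g R (gp i)‖) * (Z * (2 ^ d * (3 * ↑d * ((A+1)*R) * δ))) := by gcongr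
      _ = _ := by ring
  exact le_of_mul_le_mul_left key hZ0
end

section
variable {ι : Type} [Fintype ι] [DecidableEq ι]

lemma card_cell1 (n l : ℕ) (hl : l ≤ n) (x : ZMod (2^n)) :
    #{b : ZMod (2^n) | b.val / 2^(n-l) = x.val / 2^(n-l)} = 2^(n-l) := by
  set s := 2^(n-l) with hs
  have hs0 : 0 < s := by positivity
  have hM : 2^n = 2^l * s := by rw [hs, ← pow_add]; congr 1; omega
  have hx := ZMod.val_lt x
  have hc : x.val / s < 2^l := by
    rw [Nat.div_lt_iff_lt_mul hs0, ← hM]; exact hx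
  have h2 : (x.val / s + 1) * s ≤ 2^n := le_trans (Nat.mul_le_mul_right s hc) hM.ge
  have : #(Finset.Ico (x.val / s * s) ((x.val / s + 1) * s)) = s := by
    rw [Nat.card_Ico]; rw [add_mul]; omega
  conv_rhs => rw [← this]
  refine Finset.card_nbij (fun b => b.val) ?_ ?_ ?_
  · intro b hb
    have hb : b.val / s = x.val / s := by simpa using hb
    simp only [Finset.coe_Ico, Set.mem_Ico]
    rw [← hb]
    exact ⟨Nat.div_mul_le_self _ _, Nat.lt_mul_of_div_lt (Nat.lt_succ_self _) hs0⟩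
  · intro a _ b _ h; exact ZMod.val_injective _ h
  · intro v hv
    simp only [Finset.coe_Ico, Set.mem_Ico] at hv
    refine ⟨(v : ZMod (2^n)), ?_, ?_⟩
    · simp only [Finset.coe_filter, Finset.mem_univ, true_and, Set.mem_ofPred_eq]
      rw [ZMod.val_natCast_of_lt (by omega)]
      exact Nat.div_eq_of_lt_le hv.1 hv.2
    · exact ZMod.val_natCast_of_lt (by omega)

def tpr (n : ℕ) {X : Type} (e : X ≃ (ι → ZMod (2^n))) (l : ℕ) (x : X) : ι → ℕ := fun i => (e x i).val / 2^(n-l)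

lemma card_prod (n : ℕ) {X : Type} [Fintype X] (e : X ≃ (ι → ZMod (2^n))) (p : ι → ZMod (2^n) → Prop) [∀ i, DecidablePred (p i)]
    (q : X → Prop) [DecidablePred q] (hq : ∀ x, q x ↔ ∀ i, p i (e x i)) : #{x : X | q x} = ∏ i, #{b : ZMod (2^n) | p i b} := by
  rw [← Fintype.card_piFinset]
  refine Finset.card_equiv e ?_
  intro x
  simp [hq]

lemma card_cell (n : ℕ) {X : Type} [Fintype X] (e : X ≃ (ι → ZMod (2^n))) (l : ℕ) (hl : l ≤ n) (x : X) :
    #{y : X | tpr n e l y = tpr n e l x} = (2^(n-l))^(Fintype.card ι) := by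
  rw [card_prod n e (fun i b => b.val / 2^(n-l) = (e x i).val / 2^(n-l))]
  · simp [card_cell1 n l hl]
  · intro y; simp [tpr, funext_iff]

lemma cell_rho (n : ℕ) {X : Type} (e : X ≃ (ι → ZMod (2^n))) (l : ℕ) (hl : l ≤ n) (x x0 : X)
    (h : tpr n e l x = tpr n e l x0) (i : ι) : rho (gp (e x) i - gp (e x0) i) ≤ 7 * (1/2)^l := by
  have h1 := congrFun h i
  simp only [tpr] at h1
  set s := 2^(n-l) with hs
  have hs0 : 0 < s := by positivity
  have hM : 2^n = 2^l * s := by rw [hs, ← pow_add]; congr 1; omega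
  unfold gp
  rw [toAdd_val, toAdd_val, ← AddCircle.coe_sub]
  refine (rho_le _).trans ?_
  have h2 : |((e x i).val : ℝ) / (2^n : ℕ) - ((e x0 i).val : ℝ) / (2^n:ℕ)| ≤ (1/2)^l := by
    rw [← sub_div, abs_div]
    have h3 : |((e x i).val : ℝ) - (e x0 i).val| ≤ s := by
      have a1 := Nat.div_add_mod (e x i).val s
      have a2 := Nat.div_add_mod (e x0 i).val s
      have a3 := Nat.mod_lt (e x i).val hs0
      have a4 := Nat.mod_lt (e x0 i).val hs0
      rw [h1] at a1
      have : |((e x i).val : ℤ) - (e x0 i).val| ≤ s := by rw [abs_le]; constructor <;> omega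
      exact_mod_cast this
    have hM' : (0:ℝ) < ((2^n:ℕ):ℝ) := by positivity
    rw [abs_of_pos hM', div_le_iff₀ hM']
    refine h3.trans (le_of_eq ?_)
    have : ((2^n:ℕ):ℝ) = ((2^l * s : ℕ):ℝ) := congrArg _ hM
    rw [this]
    push_cast
    rw [← mul_assoc, ← mul_pow]; norm_num
  have : 2 * Real.pi ≤ 7 := by linarith [Real.pi_lt_d2]
  gcongr

open Classical in
def tS (n : ℕ) {X : Type} [Fintype X] (e : X ≃ (ι → ZMod (2^n))) (l : ℕ) (c : ι → ℕ) : Finset X :=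
  {x | ∃ x', tpr n e l x' = c ∧ ∀ i, rho (gp (e x) i - gp (e x') i) < (1/2)^l}

lemma not_mem_tS (n : ℕ) {X : Type} [Fintype X] (e : X ≃ (ι → ZMod (2^n))) (l : ℕ) (x x0 x' : X) (hx : x ∉ tS n e l (tpr n e l x0))
    (h : tpr n e l x' = tpr n e l x0) : ∃ i, (1/2)^l ≤ rho (gp (e x) i - gp (e x') i) := by
  by_contra hc
  push Not at hc
  apply hx
  simp only [tS, Finset.mem_filter, Finset.mem_univ, true_and]
  exact ⟨x', h, hc⟩

lemma count1 (n l : ℕ) (hl : l ≤ n) (b0 : ZMod (2^n)) [DecidablePred fun b : ZMod (2^n) => rho (ZMod.toAddCircle b - ZMod.toAddCircle b0) ≤ 8 * (1/2)^l] :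
    (#{b : ZMod (2^n) | rho (ZMod.toAddCircle b - ZMod.toAddCircle b0) ≤ 8 * (1/2)^l} : ℝ) ≤ 585 * 2^(n-l) := by
  have h1 := one_d_sum (2^n) (2^l) (one_le_pow₀ (by norm_num)) (by push_cast; gcongr; norm_num)
  rw [← sum_shift _ b0] at h1
  have h2 : (#{b : ZMod (2^n) | rho (ZMod.toAddCircle b - ZMod.toAddCircle b0) ≤ 8 * (1/2)^l} : ℝ) ≤
      65 * ∑ a : ZMod (2^n), 1 / (1 + ((2:ℝ)^l)^2 * rho (ZMod.toAddCircle (a - b0))^2) := by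
    rw [Finset.card_filter]; push_cast
    rw [Finset.mul_sum]
    refine Finset.sum_le_sum fun b _ => ?_
    split_ifs with h
    · rw [map_sub, mul_one_div, le_div_iff₀ (by positivity), one_mul]
      have : ((2:ℝ)^l * rho (ZMod.toAddCircle b - ZMod.toAddCircle b0)) ≤ 8 := by
        calc _ ≤ (2:ℝ)^l * (8 * (1/2)^l) := by gcongr
          _ = 8 * (2 * (1/2))^l := by rw [mul_pow]; ring
          _ = 8 := by norm_num
      have h0 : 0 ≤ ((2:ℝ)^l * rho (ZMod.toAddCircle b - ZMod.toAddCircle b0)) := by have := rho_nonneg (ZMod.toAddCircle b - ZMod.toAddCircle b0); positivity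
      nlinarith
    · positivity
  refine h2.trans ?_
  calc _ ≤ 65 * (9 * (((2^n:ℕ):ℝ) / 2^l)) := by gcongr
    _ = _ := by
      rw [pow_sub₀ _ (by norm_num) hl]; push_cast; ring

lemma card_star (n : ℕ) {X : Type} [Fintype X] (e : X ≃ (ι → ZMod (2^n))) (l : ℕ) (hl : l ≤ n) (x0 : X) :
    (#(tS n e l (tpr n e l x0)) : ℝ) ≤ 585^(Fintype.card ι) * (2^(n-l))^(Fintype.card ι) := by
  classical
  have h1 : tS n e l (tpr n e l x0) ⊆ ({x : X | ∀ i, rho (gp (e x) i - gp (e x0) i) ≤ 8 * (1/2)^l} : Finset X) := by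
    intro x hx
    simp only [tS, Finset.mem_filter, Finset.mem_univ, true_and] at hx ⊢
    obtain ⟨x', h, hx⟩ := hx
    intro i
    have a1 := cell_rho n e l hl x' x0 h i
    have a2 := rho_add_le (gp (e x) i - gp (e x') i) (gp (e x') i - gp (e x0) i)
    rw [sub_add_sub_cancel] at a2
    linarith [hx i]
  have h2 := Finset.card_le_card h1
  rw [card_prod n e (fun i b => rho (ZMod.toAddCircle b - gp (e x0) i) ≤ 8 * (1/2)^l) _ (by intro x; rfl)] at h2
  have h3 : (#(tS n e l (tpr n e l x0)) : ℝ) ≤ ∏ i : ι, (#{b : ZMod (2^n) | rho (ZMod.toAddCircle b - gp (e x0) i) ≤ 8 * (1/2)^l} : ℝ) := by exact_mod_cast h2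
  refine h3.trans ?_
  refine (Finset.prod_le_prod (fun _ _ => by positivity) (fun i _ => count1 n l hl (e x0 i))).trans ?_
  simp [mul_pow]

def cellTree (n : ℕ) {X : Type} [Fintype X] (e : X ≃ (ι → ZMod (2^n))) (D : ℝ) (hD : 585^(Fintype.card ι) ≤ D) : CZTree X (ι → ℕ) D where
  n := n
  pr := tpr n e
  S := tS n e
  h0 := by
    intro x y; funext i
    simp only [tpr, Nat.sub_zero]
    rw [Nat.div_eq_of_lt (ZMod.val_lt _), Nat.div_eq_of_lt (ZMod.val_lt _)]
  nest := by
    intro l x y h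
    funext i
    have h1 := congrFun h i
    simp only [tpr] at h1 ⊢
    by_cases hl : l < n
    · have : n - l = (n - (l+1)) + 1 := by omega
      rw [this, pow_succ, ← Nat.div_div_eq_div_mul, ← Nat.div_div_eq_div_mul, h1]
    · have e1 : n - l = 0 := by omega
      have e2 : n - (l+1) = 0 := by omega
      rw [e1]; rw [e2] at h1; exact h1
  inj := by
    intro x y h
    apply e.injective
    funext i
    have h1 := congrFun h i
    simp only [tpr, Nat.sub_self, pow_zero, Nat.div_one] at h1
    exact ZMod.val_injective _ h1
  doub := by
    intro l x hl
    rw [card_cell n e l hl.le, card_cell n e (l+1) hl]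
    push_cast
    refine le_trans ?_ (mul_le_mul_of_nonneg_right hD (by positivity))
    rw [← mul_pow]
    have : n - l = (n - (l+1)) + 1 := by omega
    rw [this, pow_succ, mul_comm]
    gcongr; norm_num
  star := by
    intro l x hl
    rw [card_cell n e l hl]
    push_cast
    exact (card_star n e l hl x).trans (mul_le_mul_of_nonneg_right hD (by positivity))
end

section
variable {ι : Type} [Fintype ι] [DecidableEq ι]

lemma geo_min (l J : ℕ) (c : ℕ → ℝ) (h1 : ∀ j, c j ≤ 2^j / 2^l) (h2 : ∀ j, c j ≤ 2^l / 2^j) : ∑ j ∈ Finset.range J, c j ≤ 3 := by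
  have a1 : ∀ J, ∑ j ∈ Finset.range J, c j ≤ 2^J / 2^l := by
    intro J
    induction J with
    | zero => simp
    | succ J ih =>
      rw [Finset.sum_range_succ]
      have := h1 J
      have e : (2:ℝ)^(J+1) / 2^l = 2^J / 2^l + 2^J / 2^l := by rw [pow_succ]; ring
      linarith
  have a2 : ∀ t, ∑ j ∈ Finset.range (l + t), c j ≤ 3 - 2 * (2^l / 2^(l+t)) := by
    intro t
    induction t with
    | zero =>
      have := a1 l
      rw [div_self (by positivity)] at this
      simp only [add_zero]
      rw [div_self (by positivity)]; linarith
    | succ t ih =>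
      rw [← add_assoc, Finset.sum_range_succ]
      have := h2 (l+t)
      have e : (2:ℝ)^l / 2^(l+t) = 2 * (2^l / 2^(l+t+1)) := by rw [pow_succ (2:ℝ) (l+t)]; field_simp
      linarith
  rcases le_total l J with h | h
  · obtain ⟨t, rfl⟩ := Nat.exists_eq_add_of_le h
    have := a2 t
    have : (0:ℝ) ≤ 2^l / 2^(l+t) := by positivity
    linarith
  · have := a1 J
    have : (2:ℝ)^J / 2^l ≤ 1 := by
      rw [div_le_one (by positivity)]; gcongr; norm_num
    linarith

lemma hor_sum (B : ℕ → ℝ) (A : ℝ) (hA : 0 ≤ A) (g : ℕ → (ι → ℝ) → ℝ) (hCl : ∀ j, Cl B (g j)) (hS : ∀ j, Sup A (g j)) :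
    ∃ C : ℝ, 0 ≤ C ∧ ∀ J M l : ℕ, ∀ [NeZero M], 4 * (A + 1) * 2^J < (M:ℝ) → ∀ a' a0 : ι → ZMod M,
      (∀ i, rho (gp a' i - gp a0 i) ≤ 7 * (1/2)^l) → ∀ (P : (ι → ZMod M) → Prop) [DecidablePred P],
      (∀ a, ¬ P a → ∃ i, (1/2)^l ≤ rho (gp a i - gp a' i)) → (∀ a, ¬ P a → ∃ i, (1/2)^l ≤ rho (gp a i - gp a0 i)) →
      ∑ a, (if P a then 0 else ∑ j ∈ Finset.range J, ‖kern (g j) (2^j) (gp (a - a')) - kern (g j) (2^j) (gp (a - a0))‖) ≤ C * M^(Fintype.card ι) := by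
  obtain ⟨C1, hC1, h1⟩ := kern_l1 (ι := ι) B A hA
  obtain ⟨C2, hC2, h2⟩ := kern_smooth (ι := ι) A hA
  set d := Fintype.card ι
  set C3 : ℝ := max (C2 * 7 * C1) (2 * d * C1)
  have hC3 : 0 ≤ C3 := le_max_of_le_left (by positivity)
  refine ⟨3 * C3, by positivity, ?_⟩
  intro J M l _ hM a' a0 hclose P _ hP' hP0
  have hM0 : 0 < (M:ℝ) := by have := NeZero.pos M; exact_mod_cast this
  have hkM : ∀ j, j < J → (4 * (A+1) * 2^j < (M:ℝ)) ∧ ((2:ℝ)^j ≤ M) := by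
    intro j hj
    have e : (2:ℝ)^j ≤ 2^J := by gcongr; norm_num
    have e0 : (0:ℝ) < 2^j := by positivity
    constructor
    · refine lt_of_le_of_lt ?_ hM; gcongr
    · nlinarith
  have swap : ∑ a, (if P a then 0 else ∑ j ∈ Finset.range J, ‖kern (g j) (2^j) (gp (a - a')) - kern (g j) (2^j) (gp (a - a0))‖) =
     ∑ j ∈ Finset.range J, ∑ a, (if P a then 0 else ‖kern (g j) (2^j) (gp (a - a')) - kern (g j) (2^j) (gp (a - a0))‖) := by
    rw [Finset.sum_comm]
    refine Finset.sum_congr rfl fun a _ => ?_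
    split_ifs <;> simp
  rw [swap]
  have near : ∀ j, j < J → ∑ a, (if P a then 0 else ‖kern (g j) (2^j) (gp (a - a')) - kern (g j) (2^j) (gp (a - a0))‖) ≤ C3 * M^d * (2^j / 2^l) := by
    intro j hj
    obtain ⟨e1, e2⟩ := hkM j hj
    have r1 : (1:ℝ) ≤ 2^j := one_le_pow₀ (by norm_num)
    have b1 := h2 (g j) (2^j) M r1 e1 (hS j) (7 * (1/2)^l) (by positivity) a' a0 hclose
    have b2 := (h1 (g j) (2^j) M r1 e2 (hCl j) (hS j)).1
    calc _ ≤ ∑ a : ι → ZMod M, ‖kern (g j) (2^j) (gp (a - a')) - kern (g j) (2^j) (gp (a - a0))‖ := by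
          refine Finset.sum_le_sum fun a _ => ?_
          split_ifs
          · positivity
          · exact le_rfl
      _ ≤ _ := b1
      _ ≤ C2 * (2^j * (7 * (1/2)^l)) * (C1 * M^d) := by gcongr
      _ = (C2 * 7 * C1) * M^d * (2^j / 2^l) := by rw [one_div, inv_pow]; ring
      _ ≤ _ := by gcongr; exact le_max_left _ _
  have far1 : ∀ j, j < J → ∀ b : ι → ZMod M, (∀ a, ¬ P a → ∃ i, (1/2)^l ≤ rho (gp a i - gp b i)) →
      ∑ a, (if P a then 0 else ‖kern (g j) (2^j) (gp (a - b))‖) ≤ d * C1 * M^d * (2^l / 2^j) := by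
    intro j hj b hb
    obtain ⟨e1, e2⟩ := hkM j hj
    have r1 : (1:ℝ) ≤ 2^j := one_le_pow₀ (by norm_num)
    have b2 := (h1 (g j) (2^j) M r1 e2 (hCl j) (hS j)).2
    calc _ ≤ ∑ a : ι → ZMod M, ∑ i, (2^l / 2^j) * (‖kern (g j) (2^j) (gp (a - b))‖ * (2^j * rho (gp (a - b) i))) := by
          refine Finset.sum_le_sum fun a _ => ?_
          have hnn : ∀ i : ι, (0:ℝ) ≤ (2^l / 2^j) * (‖kern (g j) (2^j) (gp (a - b))‖ * (2^j * rho (gp (a - b) i))) := by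
            intro i; have := rho_nonneg (gp (a - b) i); positivity
          split_ifs with h
          · exact Finset.sum_nonneg fun i _ => hnn i
          · obtain ⟨i, hi⟩ := hb a h
            refine le_trans ?_ (Finset.single_le_sum (fun i _ => hnn i) (Finset.mem_univ i))
            rw [gp_sub a b] at *
            simp only [Pi.sub_apply]
            have : (2:ℝ)^l / 2^j * (‖kern (g j) (2^j) (gp a - gp b)‖ * (2^j * rho (gp a i - gp b i))) = ‖kern (g j) (2^j) (gp a - gp b)‖ * (2^l * rho (gp a i - gp b i)) := by
              field_simp
            rw [this]
            have h3 : 1 ≤ (2:ℝ)^l * rho (gp a i - gp b i) := by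
              calc (1:ℝ) = 2^l * (1/2)^l := by rw [← mul_pow]; norm_num
                _ ≤ _ := by gcongr
            nlinarith [norm_nonneg (kern (g j) (2^j) (gp a - gp b))]
      _ = ∑ i, (2^l / 2^j) * ∑ a : ι → ZMod M, (‖kern (g j) (2^j) (gp a)‖ * (2^j * rho (gp a i))) := by
          rw [Finset.sum_comm]
          refine Finset.sum_congr rfl fun i _ => ?_
          rw [← Finset.mul_sum, sum_shift (fun a => ‖kern (g j) (2^j) (gp a)‖ * (2^j * rho (gp a i)))]
      _ ≤ ∑ i : ι, (2^l / 2^j) * (C1 * M^d) := by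
          refine Finset.sum_le_sum fun i _ => ?_
          gcongr; exact b2 i
      _ = _ := by simp [d]; ring
  have far : ∀ j, j < J → ∑ a, (if P a then 0 else ‖kern (g j) (2^j) (gp (a - a')) - kern (g j) (2^j) (gp (a - a0))‖) ≤ C3 * M^d * (2^l / 2^j) := by
    intro j hj
    have f1 := far1 j hj a' hP'
    have f2 := far1 j hj a0 hP0
    calc _ ≤ ∑ a, ((if P a then 0 else ‖kern (g j) (2^j) (gp (a - a'))‖) + (if P a then 0 else ‖kern (g j) (2^j) (gp (a - a0))‖)) := by
          refine Finset.sum_le_sum fun a _ => ?_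
          split_ifs
          · simp
          · exact norm_sub_le _ _
      _ ≤ (2 * d * C1) * M^d * (2^l / 2^j) := by rw [Finset.sum_add_distrib]; linarith
      _ ≤ _ := by gcongr; exact le_max_right _ _
  have hpos : 0 ≤ C3 * (M:ℝ)^d := by positivity
  calc _ ≤ ∑ j ∈ Finset.range J, C3 * M^d * min (2^j/2^l) (2^l/2^j) := by
        refine Finset.sum_le_sum fun j hj => ?_
        rw [Finset.mem_range] at hj
        rw [mul_min_of_nonneg _ _ hpos]
        exact le_min (near j hj) (far j hj)
    _ ≤ C3 * M^d * 3 := by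
        rw [← Finset.mul_sum]; gcongr
        exact geo_min l J _ (fun j => min_le_left _ _) (fun j => min_le_right _ _)
    _ = _ := by ring
end

section
variable {ι : Type} [Fintype ι] [DecidableEq ι]

abbrev Th (J ν : ℕ) := Option (Fin J) × Fin ν
abbrev HS (J ν : ℕ) := EuclideanSpace ℂ (Th J ν)

def pj {J : ℕ} (ν : ℕ) (j : Fin J) : Th J ν ≃ Th J ν := (Equiv.swap none (some j)).prodCongr (Equiv.refl _)
def cj {J : ℕ} (ν : ℕ) (j : Fin J) (t : Th J ν) : ℝ := if t.1 = none ∨ t.1 = some j then 1 else 0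

lemma cj_pj {J ν : ℕ} (j : Fin J) (t : Th J ν) : cj ν j (pj ν j t) = cj ν j t := by
  obtain ⟨a, i⟩ := t
  rcases a with _ | a
  · simp [cj, pj]
  · by_cases h : a = j
    · subst h; simp [cj, pj]
    · have : Equiv.swap none (some j) (some a) = some a := by
        apply Equiv.swap_apply_of_ne_of_ne <;> simp [h]
      simp [cj, pj, this]

lemma pj_pj {J ν : ℕ} (j : Fin J) (t : Th J ν) : pj ν j (pj ν j t) = t := by
  obtain ⟨a, i⟩ := t
  simp [pj]

lemma cj_01 {J ν : ℕ} (j : Fin J) (t : Th J ν) : 0 ≤ cj ν j t ∧ cj ν j t ≤ 1 := by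
  unfold cj; split_ifs <;> norm_num

def Ej {J : ℕ} (ν : ℕ) (j : Fin J) : HS J ν →ₗ[ℂ] HS J ν where
  toFun h := WithLp.toLp 2 (fun t => (cj ν j t : ℂ) * h (pj ν j t))
  map_add' x y := by ext t; simp [mul_add]
  map_smul' c x := by ext t; simp; ring

lemma Ej_apply {J ν : ℕ} (j : Fin J) (h : HS J ν) (t : Th J ν) : Ej ν j h t = (cj ν j t : ℂ) * h (pj ν j t) := rfl

lemma norm_Ej {J ν : ℕ} (j : Fin J) (h : HS J ν) : ‖Ej ν j h‖ ≤ ‖h‖ := by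
  rw [EuclideanSpace.norm_eq, EuclideanSpace.norm_eq]
  apply Real.sqrt_le_sqrt
  rw [← (pj ν j).sum_comp (fun t => ‖h t‖^2)]
  refine Finset.sum_le_sum fun t _ => ?_
  rw [Ej_apply, norm_mul]
  have := cj_01 j t
  rw [Complex.norm_real, Real.norm_of_nonneg this.1]
  have h2 : cj ν j t * ‖h (pj ν j t)‖ ≤ ‖h (pj ν j t)‖ := mul_le_of_le_one_left (norm_nonneg (h (pj ν j t))) this.2
  exact pow_le_pow_left₀ (mul_nonneg this.1 (norm_nonneg _)) h2 2

lemma inner_Ej {J ν : ℕ} (j : Fin J) (c : ℂ) (h h' : HS J ν) : inner ℝ (c • Ej ν j h) h' = inner ℝ h (conj c • Ej ν j h') := by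
  simp only [PiLp.inner_apply, PiLp.smul_apply, Ej_apply]
  rw [← (pj ν j).sum_comp]
  refine Finset.sum_congr rfl fun t _ => ?_
  rw [cj_pj, pj_pj]
  simp only [Complex.inner, smul_eq_mul, map_mul, Complex.conj_conj, Complex.conj_ofReal]
  congr 1
  ring

/-- the matrix kernel -/
def kap (g : ℕ → (ι → ℝ) → ℝ) (J ν : ℕ) (z : ι → AddCircle (1:ℝ)) : HS J ν →ₗ[ℝ] HS J ν :=
  ∑ j : Fin J, (kern (g j) (2^(j:ℕ)) z • Ej ν j).restrictScalars ℝ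

lemma kap_apply (g : ℕ → (ι → ℝ) → ℝ) (J ν : ℕ) (z : ι → AddCircle (1:ℝ)) (h : HS J ν) :
    kap g J ν z h = ∑ j : Fin J, kern (g j) (2^(j:ℕ)) z • Ej ν j h := by
  simp [kap]

lemma kap_diff (g : ℕ → (ι → ℝ) → ℝ) (J ν : ℕ) (z w : ι → AddCircle (1:ℝ)) (h : HS J ν) :
    ‖kap g J ν z h - kap g J ν w h‖ ≤ (∑ j ∈ Finset.range J, ‖kern (g j) (2^j) z - kern (g j) (2^j) w‖) * ‖h‖ := by
  rw [kap_apply, kap_apply, ← Finset.sum_sub_distrib, Finset.sum_range, Finset.sum_mul]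
  refine (norm_sum_le _ _).trans (Finset.sum_le_sum fun j _ => ?_)
  rw [← sub_smul, norm_smul]
  gcongr; exact norm_Ej j h

lemma kern_neg (g : (ι → ℝ) → ℝ) (R : ℝ) (z : ι → AddCircle (1:ℝ)) : kern g R (-z) = conj (kern g R z) := by
  unfold kern
  rw [Complex.conj_tsum]
  refine tsum_congr fun ξ => ?_
  rw [map_mul, Complex.conj_ofReal, chr_conj, chr_neg]

lemma inner_kap (g : ℕ → (ι → ℝ) → ℝ) (J ν : ℕ) (z : ι → AddCircle (1:ℝ)) (h h' : HS J ν) :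
    inner ℝ (kap g J ν z h) h' = inner ℝ h (kap g J ν (-z) h') := by
  rw [kap_apply, kap_apply, sum_inner, inner_sum]
  refine Finset.sum_congr rfl fun j _ => ?_
  rw [inner_Ej, kern_neg]

lemma bessel (M : ℕ) [NeZero M] (P : ℕ) (hP : 2 * P < M) (f : (ι → ZMod M) → ℂ) :
    (M:ℝ)^(Fintype.card ι) * ∑ ξ ∈ ibox ι P, ‖((M:ℂ)^(Fintype.card ι))⁻¹ * ∑ a, chr (-ξ) (gp a) * f a‖^2 ≤ ∑ a, ‖f a‖^2 := by
  set d := Fintype.card ι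
  set fh : (ι → ℤ) → ℂ := fun ξ => ((M:ℂ)^d)⁻¹ * ∑ a, chr (-ξ) (gp a) * f a with hfh
  have h1 := planch M P hP fh
  set Q := (M:ℝ)^d * ∑ ξ ∈ ibox ι P, ‖fh ξ‖^2 with hQ
  have hM0 : (M:ℂ) ≠ 0 := by have := NeZero.ne M; exact_mod_cast this
  have hQ0 : 0 ≤ Q := by positivity
  have h2 : (Q:ℂ) = ∑ a, f a * conj (∑ ξ ∈ ibox ι P, fh ξ * chr ξ (gp a)) := by
    rw [hQ]; push_cast
    simp_rw [map_sum, Finset.mul_sum]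
    rw [Finset.sum_comm]
    refine Finset.sum_congr rfl fun ξ _ => ?_
    rw [← Complex.conj_mul']
    have : (M:ℂ)^d * (conj (fh ξ) * fh ξ) = conj (fh ξ) * ∑ a, chr (-ξ) (gp a) * f a := by
      rw [hfh]; field_simp
    rw [this, Finset.mul_sum]
    refine Finset.sum_congr rfl fun a _ => ?_
    rw [map_mul (starRingEnd ℂ) (fh ξ), chr_conj]; ring
  have h3 : Q ≤ ∑ a, ‖f a‖ * ‖∑ ξ ∈ ibox ι P, fh ξ * chr ξ (gp a)‖ := by
    have : Q = ‖(Q:ℂ)‖ := by rw [Complex.norm_real, Real.norm_of_nonneg hQ0]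
    rw [this, h2]
    refine (norm_sum_le _ _).trans (le_of_eq ?_)
    simp_rw [norm_mul, RCLike.norm_conj]
  have h4 := Finset.sum_mul_sq_le_sq_mul_sq Finset.univ (fun a => ‖f a‖) (fun a => ‖∑ ξ ∈ ibox ι P, fh ξ * chr ξ (gp a)‖)
  rw [h1] at h4
  have h5 : Q^2 ≤ (∑ a, ‖f a‖^2) * Q := le_trans (by gcongr) h4
  rcases hQ0.eq_or_lt with h | h
  · rw [← h]; positivity
  · nlinarith

lemma arrow_bound (J ν : ℕ) (γ : Fin J → ℝ) (L : ℝ) (hL : ∑ j, γ j^2 ≤ L) (w : Th J ν → ℂ) :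
    ∑ t, ‖∑ j, (γ j : ℂ) * ((cj ν j t : ℂ) * w (pj ν j t))‖^2 ≤ L * ∑ t, ‖w t‖^2 := by
  have hL0 : 0 ≤ L := le_trans (by positivity) hL
  rw [Fintype.sum_prod_type, Fintype.sum_prod_type, Fintype.sum_option, Fintype.sum_option]
  have h1 : ∀ i : Fin ν, ‖∑ j, (γ j : ℂ) * ((cj ν j (none, i) : ℂ) * w (pj ν j (none, i)))‖^2 ≤ L * ∑ j, ‖w (some j, i)‖^2 := by
    intro i
    have : ∀ j, (γ j : ℂ) * ((cj ν j (none, i) : ℂ) * w (pj ν j (none, i))) = γ j * w (some j, i) := by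
      intro j; simp [cj, pj]
    simp_rw [this]
    have h2 : ‖∑ j, (γ j : ℂ) * w (some j, i)‖ ≤ ∑ j, |γ j| * ‖w (some j, i)‖ := by
      refine (norm_sum_le _ _).trans (le_of_eq ?_); simp
    have h3 := Finset.sum_mul_sq_le_sq_mul_sq Finset.univ (fun j => |γ j|) (fun j => ‖w (some j, i)‖)
    simp only [sq_abs] at h3
    calc _ ≤ (∑ j, |γ j| * ‖w (some j, i)‖)^2 := by gcongr
      _ ≤ _ := h3
      _ ≤ _ := by gcongr
  have h2 : ∀ (j' : Fin J) (i : Fin ν), ‖∑ j, (γ j : ℂ) * ((cj ν j (some j', i) : ℂ) * w (pj ν j (some j', i)))‖^2 = γ j'^2 * ‖w (none, i)‖^2 := by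
    intro j' i
    rw [Finset.sum_eq_single j']
    · simp [cj, pj, mul_pow]
    · intro j _ hj; simp [cj, hj.symm]
    · simp
  simp_rw [h2]
  have h3 := Finset.sum_le_sum (s := Finset.univ) fun i _ => h1 i
  rw [← Finset.mul_sum, Finset.sum_comm] at h3
  have h4 : ∑ j : Fin J, ∑ i : Fin ν, γ j^2 * ‖w (none, i)‖^2 ≤ L * ∑ i, ‖w (none, i)‖^2 := by
    simp_rw [← Finset.mul_sum]
    rw [← Finset.sum_mul]; gcongr
  linarith

lemma kap_l2 (A : ℝ) (hA : 0 ≤ A) (g : ℕ → (ι → ℝ) → ℝ) (hS : ∀ j, Sup A (g j)) (L : ℝ)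
    (hL : ∀ ξ J, ∑ j ∈ Finset.range J, (g j (scl (2^j) ξ))^2 ≤ L) (J ν M : ℕ) [NeZero M] (hM : 4 * (A + 1) * 2^J < (M:ℝ)) (f : (ι → ZMod M) → HS J ν) :
    ∑ a, ‖((M:ℝ)^(Fintype.card ι))⁻¹ • ∑ a', kap g J ν (gp (a - a')) (f a')‖^2 ≤ L * ∑ a, ‖f a‖^2 := by
  set d := Fintype.card ι
  set N := ⌈A * 2^J⌉₊
  have hN1 : A * 2^J < N + 1 := (Nat.le_ceil _).trans_lt (by linarith)
  have hJ1 : (1:ℝ) ≤ 2^J := one_le_pow₀ (by norm_num)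
  have hN2 : (N:ℝ) ≤ (A + 1) * 2^J := by
    have := Nat.ceil_lt_add_one (a := A * 2^J) (by positivity)
    linarith
  have hN3 : 2 * N < M := by
    have : (2:ℝ) * N < M := by nlinarith
    exact_mod_cast this
  have hk : ∀ (j : Fin J) z, kern (g j) (2^(j:ℕ)) z = ∑ ξ ∈ ibox ι N, (g j (scl (2^(j:ℕ)) ξ) : ℂ) * chr ξ z := by
    intro j z
    refine kern_eq (hS j) (by positivity) N (lt_of_le_of_lt ?_ hN1) z
    have : (2:ℝ)^(j:ℕ) ≤ 2^J := by gcongr; norm_num; exact j.2.le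
    gcongr
  set fh : (ι → ℤ) → Th J ν → ℂ := fun ξ t => ((M:ℂ)^d)⁻¹ * ∑ a, chr (-ξ) (gp a) * f a t with hfh
  have hT : ∀ a t, (((M:ℝ)^d)⁻¹ • ∑ a', kap g J ν (gp (a - a')) (f a')) t =
      ∑ ξ ∈ ibox ι N, (∑ j : Fin J, (g j (scl (2^(j:ℕ)) ξ) : ℂ) * ((cj ν j t : ℂ) * fh ξ (pj ν j t))) * chr ξ (gp a) := by
    intro a t
    rw [PiLp.smul_apply]
    simp_rw [kap_apply]
    simp only [WithLp.ofLp_sum, Finset.sum_apply, PiLp.smul_apply, Ej_apply, hk, smul_eq_mul, Finset.sum_mul, hfh, Finset.mul_sum, Complex.real_smul]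
    rw [Finset.sum_comm]
    rw [Finset.sum_congr rfl fun j _ => Finset.sum_comm]
    rw [Finset.sum_comm]
    refine Finset.sum_congr rfl fun ξ _ => Finset.sum_congr rfl fun j _ => Finset.sum_congr rfl fun a' _ => ?_
    rw [gp_sub, sub_eq_add_neg, chr_zadd, chr_neg]
    push_cast; ring
  simp_rw [EuclideanSpace.norm_sq_eq, hT]
  rw [Finset.sum_comm]
  simp_rw [planch M N hN3]
  rw [← Finset.mul_sum, Finset.sum_comm]
  have hb : ∀ ξ, ∑ t, ‖∑ j : Fin J, (g j (scl (2^(j:ℕ)) ξ) : ℂ) * ((cj ν j t : ℂ) * fh ξ (pj ν j t))‖^2 ≤ L * ∑ t, ‖fh ξ t‖^2 := by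
    intro ξ
    refine arrow_bound J ν (fun j => g j (scl (2^(j:ℕ)) ξ)) L ?_ (fh ξ)
    have := hL ξ J
    rwa [Finset.sum_range] at this
  have hL0 : 0 ≤ L := by have := hL 0 0; simpa using this
  calc _ ≤ (M:ℝ)^d * ∑ ξ ∈ ibox ι N, L * ∑ t, ‖fh ξ t‖^2 := by
        gcongr with ξ hξ; exact hb ξ
    _ = L * ∑ t, ((M:ℝ)^d * ∑ ξ ∈ ibox ι N, ‖fh ξ t‖^2) := by
        rw [← Finset.mul_sum, Finset.sum_comm, ← Finset.mul_sum]; ring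
    _ ≤ L * ∑ t, ∑ a, ‖f a t‖^2 := by
        gcongr with t _
        exact bessel M N hN3 (fun a => f a t)
    _ = _ := by rw [Finset.sum_comm]
end

section
abbrev GX (m n : ℕ) := Fin m → ZMod (2^n)

def el (m k n : ℕ) : GX m n × GX k n ≃ (Fin m ⊕ Fin k → ZMod (2^n)) := (Equiv.sumArrowEquivProdArrow _ _ _).symm

lemma el_sub (m k n : ℕ) (a b : GX m n × GX k n) : el m k n (a.1 - b.1, a.2 - b.2) = el m k n a - el m k n b := by
  funext i; rcases i with i | i <;> rfl

lemma el_sub' (m k n : ℕ) (a b : GX m n × GX k n) : el m k n (a - b) = el m k n a - el m k n b := el_sub m k n a b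

def Kd {m k : ℕ} (g : ℕ → (Fin m ⊕ Fin k → ℝ) → ℝ) (J ν n : ℕ) (x : GX m n) (y : GX k n) : HS J ν →ₗ[ℝ] HS J ν :=
  (((2^n:ℕ):ℝ)^(m+k))⁻¹ • kap g J ν (gp (el m k n (x, y)))

def Td {m k : ℕ} (g : ℕ → (Fin m ⊕ Fin k → ℝ) → ℝ) (J ν n : ℕ) : (GX m n × GX k n → HS J ν) →ₗ[ℝ] (GX m n × GX k n → HS J ν) where
  toFun f := fun a => ∑ x', ∑ y', Kd g J ν n (a.1 - x') (a.2 - y') (f (x', y'))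
  map_add' f f' := by funext a; simp [Finset.sum_add_distrib]
  map_smul' c f := by funext a; simp [Finset.smul_sum]

lemma Td_apply {m k : ℕ} (g : ℕ → (Fin m ⊕ Fin k → ℝ) → ℝ) (J ν n : ℕ) (f : GX m n × GX k n → HS J ν) (a : GX m n × GX k n) :
    Td g J ν n f a = ∑ b, Kd g J ν n (a.1 - b.1) (a.2 - b.2) (f b) := by
  simp [Td, Fintype.sum_prod_type]

theorem disc_main (m k : ℕ) (B : ℕ → ℝ) (A : ℝ) (hA : 0 ≤ A) (g : ℕ → (Fin m ⊕ Fin k → ℝ) → ℝ) (hCl : ∀ j, Cl B (g j)) (hS : ∀ j, Sup A (g j)) (L : ℝ)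
    (hL : ∀ ξ J, ∑ j ∈ Finset.range J, (g j (scl (2^j) ξ))^2 ≤ L) (p q : ℝ) (hp : 1 < p) (hq : 1 < q) :
    ∃ C : ℝ, 0 ≤ C ∧ ∀ J ν n : ℕ, 4 * (A + 1) * 2^J < ((2^n:ℕ):ℝ) → ∀ f : GX m n × GX k n → HS J ν,
      mN p q (Td g J ν n f) ≤ C * mN p q f := by
  obtain ⟨B1, hB1, hor⟩ := hor_sum B A hA g hCl hS
  have hL0 : 0 ≤ L := by have := hL 0 0; simpa using this
  obtain ⟨C, hC, hmain⟩ := fin_main L B1 (585^(m+k)) hL0 hB1 (one_le_pow₀ (by norm_num)) p q hp hq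
  refine ⟨C, hC, fun J ν n hn f => ?_⟩
  have hcard : Fintype.card (Fin m ⊕ Fin k) = m + k := by simp
  rw [hcard] at hor
  have hM0 : (0:ℝ) < ((2^n:ℕ):ℝ)^(m+k) := by positivity
  let t1 := cellTree n (el m k n) (585^(m+k)) (by rw [hcard])
  let t2 : CZTree (GX m n) (Fin m → ℕ) (585^(m+k)) := cellTree n (Equiv.refl _) (585^(m+k)) (by simp only [Fintype.card_fin]; gcongr <;> first | norm_num | omega)
  have hKn : ∀ (a b : GX m n × GX k n) h, ‖Kd g J ν n a.1 a.2 h - Kd g J ν n b.1 b.2 h‖ ≤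
      (((2^n:ℕ):ℝ)^(m+k))⁻¹ * (∑ j ∈ Finset.range J, ‖kern (g j) (2^j) (gp (el m k n a)) - kern (g j) (2^j) (gp (el m k n b))‖) * ‖h‖ := by
    intro a b h
    simp only [Kd, LinearMap.smul_apply]
    rw [← smul_sub, norm_smul, Real.norm_of_nonneg (by positivity), mul_assoc]
    gcongr
    exact kap_diff g J ν _ _ h
  have OK : FinOK L B1 (585^(m+k)) (Td g J ν n) (Kd g J ν n) t1 t2 := by
    refine ⟨?_, ?_, ?_, ?_, ?_⟩
    · intro f f'
      simp_rw [Td_apply, sum_inner, inner_sum]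
      rw [Finset.sum_comm]
      refine Finset.sum_congr rfl fun b _ => Finset.sum_congr rfl fun a _ => ?_
      simp only [Kd, LinearMap.smul_apply, real_inner_smul_left, real_inner_smul_right]
      rw [inner_kap, el_sub m k n a b, el_sub m k n b a, gp_sub, gp_sub, neg_sub]
    · intro f
      have := kap_l2 A hA g hS L hL J ν (2^n) hn (fun a => f ((el m k n).symm a))
      rw [hcard] at this
      rw [← (el m k n).sum_comp, ← (el m k n).sum_comp (fun a => ‖f ((el m k n).symm a)‖^2)] at this
      simp only [Equiv.symm_apply_apply] at this
      refine le_trans (le_of_eq ?_) this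
      refine Finset.sum_congr rfl fun a _ => ?_
      congr 2
      rw [Td_apply, Finset.smul_sum, ← (el m k n).sum_comp]
      refine Finset.sum_congr rfl fun b _ => ?_
      simp only [Kd, LinearMap.smul_apply, el_sub, Equiv.symm_apply_apply]
    · intro f x y; rfl
    · intro l a' a0 hl h
      refine ⟨fun a => (((2^n:ℕ):ℝ)^(m+k))⁻¹ * (∑ j ∈ Finset.range J, ‖kern (g j) (2^j) (gp (el m k n (a - a'))) - kern (g j) (2^j) (gp (el m k n (a - a0)))‖), fun a h => hKn (a - a') (a - a0) h, ?_⟩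
      have key := hor J (2^n) l hn (el m k n a') (el m k n a0) (cell_rho n (el m k n) l hl a' a0 h)
        (fun a => (el m k n).symm a ∈ tS n (el m k n) l (tpr n (el m k n) l a0))
        (fun a ha => by
          have := not_mem_tS n (el m k n) l _ a0 a' ha h
          simpa using this)
        (fun a ha => by
          have := not_mem_tS n (el m k n) l _ a0 a0 ha rfl
          simpa using this)
      rw [← (el m k n).sum_comp] at key
      simp only [Equiv.symm_apply_apply, ← el_sub'] at key
      rw [← mul_le_mul_iff_of_pos_left hM0, Finset.mul_sum, mul_comm _ B1]
      refine le_trans (le_of_eq ?_) key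
      refine Finset.sum_congr rfl fun a _ => ?_
      change (_ * if a ∈ tS n (el m k n) l (tpr n (el m k n) l a0) then _ else _) = _
      split_ifs
      · simp
      · rw [mul_inv_cancel_left₀ hM0.ne']
    · intro l x' x0 hl h
      have hx : ∀ (x x'' : GX m n) (y : GX k n), el m k n (x, y) - el m k n (x'', 0) = el m k n (x - x'', y) := by
        intro x x'' y
        have := el_sub m k n (x, y) (x'', 0)
        simpa using this.symm
      refine ⟨fun x y => (((2^n:ℕ):ℝ)^(m+k))⁻¹ * (∑ j ∈ Finset.range J, ‖kern (g j) (2^j) (gp (el m k n (x - x', y))) - kern (g j) (2^j) (gp (el m k n (x - x0, y)))‖), fun x y => by positivity, fun x y h => hKn (x - x', y) (x - x0, y) h, ?_⟩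
      have hcell := cell_rho n (Equiv.refl (GX m n)) l hl x' x0 h
      have key := hor J (2^n) l hn (el m k n (x', 0)) (el m k n (x0, 0)) (by
          intro i
          rcases i with i | i
          · exact hcell i
          · have : gp (el m k n (x', 0)) (Sum.inr i) - gp (el m k n (x0, 0)) (Sum.inr i) = 0 := sub_self _
            rw [this]; simp [rho])
        (fun a => ((el m k n).symm a).1 ∈ tS n (Equiv.refl (GX m n)) l (tpr n (Equiv.refl (GX m n)) l x0))
        (fun a ha => by
          obtain ⟨i, hi⟩ := not_mem_tS n (Equiv.refl (GX m n)) l _ x0 x' ha h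
          exact ⟨Sum.inl i, hi⟩)
        (fun a ha => by
          obtain ⟨i, hi⟩ := not_mem_tS n (Equiv.refl (GX m n)) l _ x0 x0 ha rfl
          exact ⟨Sum.inl i, hi⟩)
      rw [← (el m k n).sum_comp, Fintype.sum_prod_type] at key
      simp only [Equiv.symm_apply_apply, hx] at key
      rw [← mul_le_mul_iff_of_pos_left hM0, Finset.mul_sum, mul_comm _ B1]
      refine le_trans (le_of_eq ?_) key
      refine Finset.sum_congr rfl fun x _ => ?_
      change (_ * if x ∈ tS n (Equiv.refl (GX m n)) l (tpr n (Equiv.refl (GX m n)) l x0) then _ else _) = _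
      split_ifs
      · simp
      · rw [← Finset.mul_sum, mul_inv_cancel_left₀ hM0.ne']
  exact hmain OK f
end

/-- A measurable partition into finitely many cells of equal mass. -/
structure Cells {Ω X : Type*} [MeasurableSpace Ω] [Fintype X] (μ : Measure Ω) (I : Ω → X) (c : ℝ≥0∞) : Prop where
  meas : ∀ x, MeasurableSet (I ⁻¹' {x})
  vol : ∀ x, μ (I ⁻¹' {x}) = c
  c0 : c ≠ 0
  cT : c ≠ ∞

lemma Cells.lint {Ω X : Type*} [MeasurableSpace Ω] [Fintype X] {μ : Measure Ω} {I : Ω → X} {c : ℝ≥0∞} (h : Cells μ I c)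
    (g : Ω → ℝ≥0∞) : ∫⁻ ω, g ω ∂μ = ∑ x, ∫⁻ ω in I ⁻¹' {x}, g ω ∂μ := by
  have hU : (⋃ x, I ⁻¹' {x}) = Set.univ := by
    ext ω; simp
  rw [← setLIntegral_univ g, ← hU, lintegral_iUnion h.meas, tsum_fintype]
  intro x y hxy
  refine Set.disjoint_left.2 fun ω h1 h2 => hxy ?_
  simp at h1 h2
  rw [← h1, h2]

lemma Cells.lint_comp {Ω X : Type*} [MeasurableSpace Ω] [Fintype X] {μ : Measure Ω} {I : Ω → X} {c : ℝ≥0∞} (h : Cells μ I c)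
    (H : X → ℝ≥0∞) : ∫⁻ ω, H (I ω) ∂μ = c * ∑ x, H x := by
  rw [h.lint, Finset.mul_sum]
  refine Finset.sum_congr rfl fun x _ => ?_
  rw [setLIntegral_congr_fun (g := fun _ => H x) (h.meas x)]
  · rw [setLIntegral_const, h.vol, mul_comm]
  · intro ω hω
    simp at hω
    simp [hω]

lemma avg_jensen {Ω : Type*} [MeasurableSpace Ω] {μ : Measure Ω} {c : ℝ≥0∞} (hc : μ Set.univ = c) (c0 : c ≠ 0) (cT : c ≠ ∞)
    (g : Ω → ℝ≥0∞) (hg : AEMeasurable g μ) (p : ℝ) (hp : 1 < p) :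
    (c⁻¹ * ∫⁻ ω, g ω ∂μ)^p ≤ c⁻¹ * ∫⁻ ω, g ω ^ p ∂μ := by
  have hpq := Real.HolderConjugate.conjExponent hp
  have h1 := ENNReal.lintegral_mul_le_Lp_mul_Lq μ hpq hg (aemeasurable_const (b := (1:ℝ≥0∞)))
  simp only [Pi.mul_apply, mul_one, ENNReal.one_rpow, lintegral_const, one_mul, hc] at h1
  have hp0 : 0 < p := by linarith
  calc (c⁻¹ * ∫⁻ ω, g ω ∂μ)^p ≤ (c⁻¹ * ((∫⁻ ω, g ω ^ p ∂μ)^(1/p) * c^(1/p.conjExponent)))^p := by gcongr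
    _ = c⁻¹ * ∫⁻ ω, g ω ^ p ∂μ := by
      rw [ENNReal.mul_rpow_of_nonneg _ _ hp0.le, ENNReal.mul_rpow_of_nonneg _ _ hp0.le, ← ENNReal.rpow_mul, ← ENNReal.rpow_mul]
      rw [one_div_mul_cancel hp0.ne', ENNReal.rpow_one]
      have : 1/p.conjExponent * p = p - 1 := by
        unfold Real.conjExponent
        field_simp [(by linarith : p - 1 ≠ 0)]
      rw [this, ENNReal.inv_rpow, ENNReal.rpow_sub _ _ c0 cT, ENNReal.rpow_one, ENNReal.div_eq_inv_mul]
      have e0 : c^p ≠ 0 := by simp [c0, cT, hp0.le]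
      have eT : c^p ≠ ∞ := by simp [c0, cT, hp0.le]
      calc _ = ((c^p)⁻¹ * c^p) * (c⁻¹ * ∫⁻ ω, g ω ^ p ∂μ) := by ring
        _ = _ := by rw [ENNReal.inv_mul_cancel e0 eT, one_mul]

lemma mink_fin {Ω Y : Type*} [MeasurableSpace Ω] [Fintype Y] {μ : Measure Ω} (G : Y → Ω → ℝ≥0∞) (hG : ∀ y, Measurable (G y))
    (q : ℝ) (hq : 1 < q) : (∑ y, (∫⁻ ω, G y ω ∂μ)^q)^(1/q) ≤ ∫⁻ ω, (∑ y, (G y ω)^q)^(1/q) ∂μ := by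
  have hq0 : 0 < q := by linarith
  have hpq := Real.HolderConjugate.conjExponent hq
  set A : Y → ℝ≥0∞ := fun y => ∫⁻ ω, G y ω ∂μ with hA
  set S := ∑ y, (A y)^q with hS
  have hAle : ∀ y, A y ≤ ∫⁻ ω, (∑ y, (G y ω)^q)^(1/q) ∂μ := by
    intro y
    refine lintegral_mono fun ω => ?_
    calc G y ω = ((G y ω)^q)^(1/q) := by rw [← ENNReal.rpow_mul, mul_one_div_cancel hq0.ne', ENNReal.rpow_one]
      _ ≤ _ := by
        gcongr
        exact Finset.single_le_sum (f := fun y => (G y ω)^q) (fun _ _ => zero_le) (Finset.mem_univ y)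
  by_cases hT : S = ∞
  · obtain ⟨y, -, hy⟩ := ENNReal.sum_eq_top.1 hT
    have : A y = ∞ := by
      by_contra hne
      exact ENNReal.rpow_ne_top_of_nonneg hq0.le hne hy
    have h2 := hAle y
    rw [this, top_le_iff] at h2
    rw [h2]; exact le_top
  by_cases h0 : S = 0
  · change S^(1/q) ≤ _
    rw [h0, ENNReal.zero_rpow_of_pos (by positivity)]; exact zero_le
  have hAT : ∀ y, A y ≠ ∞ := by
    intro y hy
    apply hT
    rw [hS, ENNReal.sum_eq_top]
    exact ⟨y, Finset.mem_univ _, by rw [hy, ENNReal.top_rpow_of_pos hq0]⟩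
  have key : S ≤ S^(1/q.conjExponent) * ∫⁻ ω, (∑ y, (G y ω)^q)^(1/q) ∂μ := by
    calc S = ∑ y, ∫⁻ ω, (A y)^(q-1) * G y ω ∂μ := by
          refine Finset.sum_congr rfl fun y _ => ?_
          rw [lintegral_const_mul _ (hG y)]
          change _ = A y^(q-1) * A y
          by_cases hz : A y = 0
          · simp [hz, hq0]
          nth_rewrite 3 [← ENNReal.rpow_one (A y)]
          rw [← ENNReal.rpow_add _ _ hz (hAT y)]; simp
      _ = ∫⁻ ω, ∑ y, (A y)^(q-1) * G y ω ∂μ := by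
          rw [lintegral_finsetSum]
          intro y _; exact (hG y).const_mul _
      _ ≤ ∫⁻ ω, S^(1/q.conjExponent) * (∑ y, (G y ω)^q)^(1/q) ∂μ := by
          refine lintegral_mono fun ω => ?_
          refine (ENNReal.inner_le_Lp_mul_Lq _ _ _ hpq.symm).trans ?_
          have hcp : 0 ≤ 1 / q.conjExponent := by have := hpq.symm.pos; positivity
          gcongr
          refine (Finset.sum_le_sum fun y _ => le_of_eq ?_)
          rw [← ENNReal.rpow_mul]
          have : (q-1)*q.conjExponent = q := by
            unfold Real.conjExponent
            field_simp [(by linarith : q - 1 ≠ 0)]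
          rw [this]
      _ = _ := by
          rw [lintegral_const_mul]
          exact Measurable.pow_const (Finset.measurable_sum _ fun y _ => (hG y).pow_const _) _
  have e0 : S^(1/q.conjExponent) ≠ 0 := by simp [h0, hT]
  have eT : S^(1/q.conjExponent) ≠ ∞ := ENNReal.rpow_ne_top_of_nonneg (by have := hpq.symm.pos; positivity) hT
  have : S^(1/q) = S / S^(1/q.conjExponent) := by
    nth_rewrite 2 [← ENNReal.rpow_one S]
    rw [← ENNReal.rpow_sub _ _ h0 hT]
    congr 1
    have := hpq.inv_add_inv_eq_one
    simp only [one_div]; linarith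
  change S^(1/q) ≤ _
  rw [this, ENNReal.div_le_iff e0 eT, mul_comm]
  exact key

/-- continuous mixed norm (power p) -/
def Nmix {m k : ℕ} (p q : ℝ) (G : Torus m × Torus k → ℝ≥0∞) : ℝ≥0∞ := ∫⁻ x, (∫⁻ y, G (x,y) ^ q) ^ (p/q)

lemma avg_contract {Ω Λ X Y : Type*} [MeasurableSpace Ω] [MeasurableSpace Λ] [Fintype X] [Fintype Y] {μ : Measure Ω} {ν : Measure Λ}
    [SFinite ν]
    {I : Ω → X} {I' : Λ → Y} {c c' : ℝ≥0∞} (h : Cells μ I c) (h' : Cells ν I' c') (G : Ω × Λ → ℝ≥0∞) (hG : Measurable G)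
    (p q : ℝ) (hp : 1 < p) (hq : 1 < q) :
    c * ∑ x, (c' * ∑ y, (c⁻¹ * ∫⁻ s in I ⁻¹' {x}, c'⁻¹ * ∫⁻ t in I' ⁻¹' {y}, G (s,t) ∂ν ∂μ)^q)^(p/q)
      ≤ ∫⁻ s, (∫⁻ t, G (s,t)^q ∂ν)^(p/q) ∂μ := by
  have hp0 : 0 < p := by linarith
  have hq0 : 0 < q := by linarith
  have hGy : ∀ y, Measurable fun s => c'⁻¹ * ∫⁻ t in I' ⁻¹' {y}, G (s,t) ∂ν := fun y =>
    (Measurable.lintegral_prod_right' hG).const_mul _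
  have hGq : Measurable fun s => ∫⁻ t, G (s,t)^q ∂ν := Measurable.lintegral_prod_right' (f := fun z => G z ^ q) (hG.pow_const _)
  have step1 : ∀ s, c' * ∑ y, (c'⁻¹ * ∫⁻ t in I' ⁻¹' {y}, G (s,t) ∂ν)^q ≤ ∫⁻ t, G (s,t)^q ∂ν := by
    intro s
    rw [h'.lint, Finset.mul_sum]
    refine Finset.sum_le_sum fun y _ => ?_
    have := avg_jensen (μ := ν.restrict (I' ⁻¹' {y})) (c := c') (by rw [Measure.restrict_apply_univ, h'.vol]) h'.c0 h'.cT
      (fun t => G (s,t)) (hG.comp measurable_prodMk_left).aemeasurable q hq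
    calc _ ≤ c' * (c'⁻¹ * ∫⁻ t in I' ⁻¹' {y}, G (s,t)^q ∂ν) := by gcongr
      _ = _ := by rw [← mul_assoc, ENNReal.mul_inv_cancel h'.c0 h'.cT, one_mul]
  rw [h.lint, Finset.mul_sum]
  refine Finset.sum_le_sum fun x _ => ?_
  have step2 : (c' * ∑ y, (c⁻¹ * ∫⁻ s in I ⁻¹' {x}, c'⁻¹ * ∫⁻ t in I' ⁻¹' {y}, G (s,t) ∂ν ∂μ)^q)^(1/q)
      ≤ c⁻¹ * ∫⁻ s in I ⁻¹' {x}, (∫⁻ t, G (s,t)^q ∂ν)^(1/q) ∂μ := by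
    have hm := mink_fin (μ := μ.restrict (I ⁻¹' {x})) (fun y s => c'⁻¹ * ∫⁻ t in I' ⁻¹' {y}, G (s,t) ∂ν) hGy q hq
    calc _ = c⁻¹ * (c'^(1/q) * (∑ y, (∫⁻ s in I ⁻¹' {x}, c'⁻¹ * ∫⁻ t in I' ⁻¹' {y}, G (s,t) ∂ν ∂μ)^q)^(1/q)) := by
          simp_rw [ENNReal.mul_rpow_of_nonneg _ _ hq0.le]
          rw [← Finset.mul_sum, ENNReal.mul_rpow_of_nonneg _ _ (by positivity), ENNReal.mul_rpow_of_nonneg _ _ (by positivity),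
            ← ENNReal.rpow_mul, mul_one_div_cancel hq0.ne', ENNReal.rpow_one]
          ring
      _ ≤ c⁻¹ * (c'^(1/q) * ∫⁻ s in I ⁻¹' {x}, (∑ y, (c'⁻¹ * ∫⁻ t in I' ⁻¹' {y}, G (s,t) ∂ν)^q)^(1/q) ∂μ) := by gcongr
      _ = c⁻¹ * ∫⁻ s in I ⁻¹' {x}, c'^(1/q) * (∑ y, (c'⁻¹ * ∫⁻ t in I' ⁻¹' {y}, G (s,t) ∂ν)^q)^(1/q) ∂μ := by
          rw [lintegral_const_mul]
          exact Measurable.pow_const (Finset.measurable_sum _ fun y _ => (hGy y).pow_const _) _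
      _ ≤ _ := by
          gcongr with s
          rw [← ENNReal.mul_rpow_of_nonneg _ _ (by positivity)]
          gcongr
          exact step1 s
  have hj := avg_jensen (μ := μ.restrict (I ⁻¹' {x})) (c := c) (by rw [Measure.restrict_apply_univ, h.vol]) h.c0 h.cT
      (fun s => (∫⁻ t, G (s,t)^q ∂ν)^(1/q)) (hGq.pow_const _).aemeasurable p hp
  calc _ = c * ((c' * ∑ y, (c⁻¹ * ∫⁻ s in I ⁻¹' {x}, c'⁻¹ * ∫⁻ t in I' ⁻¹' {y}, G (s,t) ∂ν ∂μ)^q)^(1/q))^p := by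
        rw [← ENNReal.rpow_mul]; congr 2; ring
    _ ≤ c * (c⁻¹ * ∫⁻ s in I ⁻¹' {x}, ((∫⁻ t, G (s,t)^q ∂ν)^(1/q))^p ∂μ) := by
        gcongr
        exact (by gcongr : _ ≤ _).trans hj
    _ = _ := by
        rw [← mul_assoc, ENNReal.mul_inv_cancel h.c0 h.cT, one_mul]
        simp_rw [← ENNReal.rpow_mul]
        congr! 3; ring

instance instProbCircle : IsProbabilityMeasure (volume : Measure (AddCircle (1:ℝ))) :=
  ⟨by rw [AddCircle.measure_univ]; simp⟩

instance instProbTorus (m : ℕ) : IsProbabilityMeasure (volume : Measure (Torus m)) := by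
  rw [volume_pi]; infer_instance

instance instProbTT (m k : ℕ) : IsProbabilityMeasure (volume : Measure (Torus m × Torus k)) := by
  rw [Measure.volume_eq_prod]; infer_instance

def idx (M : ℕ) (z : AddCircle (1:ℝ)) : ZMod M := ((⌊(M:ℝ) * (AddCircle.equivIco 1 0 z : ℝ)⌋₊ : ℕ) : ZMod M)

lemma idx_meas_comp (M : ℕ) {α : Type*} [MeasurableSpace α] (f : ZMod M → α) : Measurable fun z => f (idx M z) := by
  have h1 : Measurable fun z : AddCircle (1:ℝ) => ((AddCircle.equivIco 1 0 z : ℝ)) :=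
    measurable_subtype_coe.comp (AddCircle.measurableEquivIco 1 0).measurable
  have h2 : Measurable fun z : AddCircle (1:ℝ) => ⌊(M:ℝ) * (AddCircle.equivIco 1 0 z : ℝ)⌋₊ :=
    Nat.measurable_floor.comp (h1.const_mul _)
  exact (measurable_from_nat (f := fun j : ℕ => f (j : ZMod M))).comp h2

lemma idx_meas (M : ℕ) (a : ZMod M) : MeasurableSet (idx M ⁻¹' {a}) := by
  classical
  have := idx_meas_comp M (fun b => if b = a then (1:ℕ) else 0)
  convert this (measurableSet_singleton 1) using 1
  ext z
  by_cases h : idx M z = a <;> simp [h]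

lemma idx_coe (M : ℕ) [NeZero M] (t : ℝ) (h0 : 0 ≤ t) (h1 : t < 1) :
    idx M (t : AddCircle (1:ℝ)) = ((⌊(M:ℝ) * t⌋₊ : ℕ) : ZMod M) ∧ ⌊(M:ℝ) * t⌋₊ < M := by
  constructor
  · unfold idx
    rw [AddCircle.equivIco_coe_eq (by simp [h0, h1])]
  · have hM : (0:ℝ) < M := by exact_mod_cast Nat.pos_of_ne_zero (NeZero.ne M)
    rw [Nat.floor_lt (by positivity)]
    nlinarith

lemma circle_rep (z : AddCircle (1:ℝ)) : ∃ t : ℝ, 0 ≤ t ∧ t < 1 ∧ z = (t : AddCircle (1:ℝ)) := by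
  refine ⟨AddCircle.equivIco 1 0 z, ?_, ?_, ?_⟩
  · exact (AddCircle.equivIco 1 0 z).2.1
  · simpa using (AddCircle.equivIco 1 0 z).2.2
  · exact (AddCircle.coe_equivIco).symm

lemma idx_vol (M : ℕ) [NeZero M] (a : ZMod M) : volume (idx M ⁻¹' {a}) = (M:ℝ≥0∞)⁻¹ := by
  have hM : (0:ℝ) < M := by exact_mod_cast Nat.pos_of_ne_zero (NeZero.ne M)
  have hp := AddCircle.measurePreserving_mk (1:ℝ) 0
  rw [← hp.measure_preimage (idx_meas M a).nullMeasurableSet, Measure.restrict_congr_set Ico_ae_eq_Ioc.symm, Measure.restrict_apply']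
  · have : (fun t : ℝ => (t : AddCircle (1:ℝ))) ⁻¹' (idx M ⁻¹' {a}) ∩ Set.Ico 0 (0+1) = Set.Ico ((a.val:ℝ)/M) ((a.val+1:ℝ)/M) := by
      ext t
      simp only [Set.mem_inter_iff, Set.mem_preimage, Set.mem_singleton_iff, Set.mem_Ico, zero_add]
      have hv : a.val < M := ZMod.val_lt a
      have hv' : (a.val:ℝ) + 1 ≤ M := by exact_mod_cast hv
      constructor
      · rintro ⟨h1, h2, h3⟩
        obtain ⟨h4, h5⟩ := idx_coe M t h2 h3
        rw [h4] at h1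
        have h6 : a.val = ⌊(M:ℝ) * t⌋₊ := by rw [← h1, ZMod.val_cast_of_lt h5]
        have h7 := (Nat.floor_eq_iff (by positivity)).1 h6.symm
        constructor
        · rw [div_le_iff₀ hM]; linarith [h7.1]
        · rw [lt_div_iff₀ hM]; linarith [h7.2]
      · rintro ⟨h1, h2⟩
        have ht0 : 0 ≤ t := le_trans (by positivity) h1
        rw [div_le_iff₀ hM] at h1
        rw [lt_div_iff₀ hM] at h2
        have ht1 : t < 1 := by nlinarith
        obtain ⟨h4, h5⟩ := idx_coe M t ht0 ht1
        refine ⟨?_, ht0, ht1⟩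
        rw [h4, (Nat.floor_eq_iff (by positivity)).2 ⟨by linarith, by linarith⟩]
        exact ZMod.natCast_zmod_val a
    erw [this]
    rw [Real.volume_Ico]
    have : ((a.val:ℝ)+1)/M - (a.val:ℝ)/M = (M:ℝ)⁻¹ := by field_simp; ring
    rw [this, ENNReal.ofReal_inv_of_pos hM, ENNReal.ofReal_natCast]
  · exact measurableSet_Ico

lemma idx_near (M : ℕ) [NeZero M] (z : AddCircle (1:ℝ)) : ‖ZMod.toAddCircle (idx M z) - z‖ ≤ (M:ℝ)⁻¹ := by
  have hM : (0:ℝ) < M := by exact_mod_cast Nat.pos_of_ne_zero (NeZero.ne M)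
  obtain ⟨t, h0, h1, rfl⟩ := circle_rep z
  obtain ⟨h4, h5⟩ := idx_coe M t h0 h1
  rw [toAdd_val, h4, ZMod.val_cast_of_lt h5, ← AddCircle.coe_sub]
  refine QuotientAddGroup.norm_mk_le_norm.trans ?_
  have h6 := Nat.floor_le (by positivity : 0 ≤ (M:ℝ) * t)
  have h7 := Nat.lt_floor_add_one ((M:ℝ) * t)
  rw [Real.norm_eq_abs, abs_le]
  constructor
  · have : t ≤ ((⌊(M:ℝ) * t⌋₊:ℝ) + 1)/M := by rw [le_div_iff₀ hM]; linarith
    rw [add_div, one_div] at this; linarith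
  · have : (⌊(M:ℝ) * t⌋₊:ℝ)/M ≤ t := by rw [div_le_iff₀ hM]; linarith
    have := inv_pos.2 hM
    linarith

def tidx (m M : ℕ) (z : Torus m) : Fin m → ZMod M := fun i => idx M (z i)

lemma tidx_cells (m M : ℕ) [NeZero M] : Cells (volume : Measure (Torus m)) (tidx m M) (((M:ℝ≥0∞)⁻¹)^m) := by
  have hpre : ∀ a : Fin m → ZMod M, tidx m M ⁻¹' {a} = Set.pi Set.univ (fun i => idx M ⁻¹' {a i}) := by
    intro a; ext z; simp [tidx, funext_iff]
  refine ⟨fun a => ?_, fun a => ?_, ?_, ?_⟩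
  · rw [hpre]; exact MeasurableSet.univ_pi fun i => idx_meas M _
  · rw [hpre, volume_pi, Measure.pi_pi]; simp [idx_vol]
  · simp
  · simp [NeZero.ne M]

lemma gp_tidx_meas (m M : ℕ) [NeZero M] : Measurable fun z : Torus m => (gp (tidx m M z) : Torus m) := by
  refine measurable_pi_lambda _ fun i => ?_
  exact (idx_meas_comp M (fun a => ZMod.toAddCircle a)).comp (measurable_pi_apply i)

def zz {m k : ℕ} (z : Torus m × Torus k) : Fin m ⊕ Fin k → AddCircle (1:ℝ) := Sum.elim z.1 z.2

lemma zz_cont {m k : ℕ} : Continuous (zz (m := m) (k := k)) := by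
  refine continuous_pi fun i => ?_
  rcases i with i | i
  · exact (continuous_apply i).comp continuous_fst
  · exact (continuous_apply i).comp continuous_snd

def pn (m k n : ℕ) (z : Torus m × Torus k) : Torus m × Torus k := (gp (tidx m (2^n) z.1), gp (tidx k (2^n) z.2))

lemma pn_meas (m k n : ℕ) : Measurable (pn m k n) :=
  ((gp_tidx_meas m (2^n)).comp measurable_fst).prodMk ((gp_tidx_meas k (2^n)).comp measurable_snd)

lemma idx_tendsto (z : AddCircle (1:ℝ)) : Filter.Tendsto (fun n : ℕ => ZMod.toAddCircle (idx (2^n) z)) Filter.atTop (nhds z) := by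
  rw [tendsto_iff_norm_sub_tendsto_zero]
  refine squeeze_zero (fun _ => norm_nonneg _) (fun n => idx_near (2^n) z) ?_
  have := tendsto_pow_atTop_nhds_zero_of_lt_one (r := (1/2:ℝ)) (by norm_num) (by norm_num)
  refine this.congr fun n => ?_
  simp

lemma pn_tendsto (m k : ℕ) (z : Torus m × Torus k) : Filter.Tendsto (fun n => pn m k n z) Filter.atTop (nhds z) := by
  refine Filter.Tendsto.prodMk_nhds ?_ ?_
  · exact tendsto_pi_nhds.2 fun i => idx_tendsto (z.1 i)
  · exact tendsto_pi_nhds.2 fun i => idx_tendsto (z.2 i)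

lemma zz_pn (m k n : ℕ) (z : Torus m × Torus k) : zz (pn m k n z) = gp (el m k n (tidx m (2^n) z.1, tidx k (2^n) z.2)) := by
  ext i; rcases i with i | i <;> rfl

lemma ENN_liminf_rpow (a : ℕ → ℝ≥0∞) (s : ℝ) (hs : 0 < s) :
    (Filter.liminf a Filter.atTop)^s = Filter.liminf (fun n => a n ^ s) Filter.atTop := by
  exact (Monotone.map_liminf_of_continuousAt (ENNReal.monotone_rpow_of_nonneg hs.le) a
    (ENNReal.continuous_rpow_const.continuousAt))

lemma Nmix_fatou {m k : ℕ} (p q : ℝ) (hp : 0 < p) (hq : 0 < q) (Gn : ℕ → Torus m × Torus k → ℝ≥0∞) (G : Torus m × Torus k → ℝ≥0∞)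
    (hm : ∀ n, Measurable (Gn n)) (hG : ∀ᵐ z, Filter.Tendsto (fun n => Gn n z) Filter.atTop (nhds (G z))) :
    Nmix p q G ≤ Filter.liminf (fun n => Nmix p q (Gn n)) Filter.atTop := by
  unfold Nmix
  rw [Measure.volume_eq_prod] at hG
  have hG' := Measure.ae_ae_of_ae_prod hG
  refine le_trans ?_ (lintegral_liminf_le fun n => ?_)
  · refine lintegral_mono_ae ?_
    filter_upwards [hG'] with x hx
    rw [← ENN_liminf_rpow _ _ (div_pos hp hq)]
    gcongr
    refine le_trans ?_ (lintegral_liminf_le fun n => ?_)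
    · refine lintegral_mono_ae ?_
      filter_upwards [hx] with y hy
      rw [← ENN_liminf_rpow _ _ hq, hy.liminf_eq]
    · exact ((hm n).comp measurable_prodMk_left).pow_const _
  · exact (Measurable.lintegral_prod_right' (f := fun z => Gn n z ^ q) ((hm n).pow_const _)).pow_const _

lemma chr_cont {ι : Type} [Fintype ι] [DecidableEq ι] (ξ : ι → ℤ) : Continuous (chr ξ) := by
  unfold chr
  exact continuous_finsetProd _ fun i _ => (fourier (ξ i)).continuous.comp (continuous_apply i)

lemma kern_cont {ι : Type} [Fintype ι] [DecidableEq ι] {A : ℝ} {g : (ι → ℝ) → ℝ} (h : Sup A g) {R : ℝ} (hR : 0 < R) :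
    Continuous (kern g R) := by
  obtain ⟨N, hN⟩ := exists_nat_gt (A*R)
  have : kern g R = fun z => ∑ ξ ∈ ibox ι N, (g (scl R ξ) : ℂ) * chr ξ z := by
    funext z; exact kern_eq h hR N (by linarith) z
  rw [this]
  exact continuous_finsetSum _ fun ξ _ => continuous_const.mul (chr_cont ξ)

lemma kern_bdd {ι : Type} [Fintype ι] [DecidableEq ι] {A : ℝ} {g : (ι → ℝ) → ℝ} (h : Sup A g) {R : ℝ} (hR : 0 < R) :
    ∃ C : ℝ, 0 ≤ C ∧ ∀ z, ‖kern g R z‖ ≤ C := by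
  obtain ⟨N, hN⟩ := exists_nat_gt (A*R)
  refine ⟨∑ ξ ∈ ibox ι N, |g (scl R ξ)|, by positivity, fun z => ?_⟩
  rw [kern_eq h hR N (by linarith) z]
  refine (norm_sum_le _ _).trans (Finset.sum_le_sum fun ξ _ => ?_)
  rw [norm_mul, norm_chr, mul_one, Complex.norm_real, Real.norm_eq_abs]

lemma kap_cont {ι : Type} [Fintype ι] [DecidableEq ι] {A : ℝ} {g : ℕ → (ι → ℝ) → ℝ} (h : ∀ j, Sup A (g j)) (J ν : ℕ) :
    Continuous fun v : (ι → AddCircle (1:ℝ)) × HS J ν => kap g J ν v.1 v.2 := by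
  simp_rw [kap_apply]
  refine continuous_finsetSum _ fun j _ => ?_
  refine Continuous.smul ((kern_cont (h j) (by positivity)).comp continuous_fst) ?_
  exact (LinearMap.continuous_of_finiteDimensional (Ej ν j)).comp continuous_snd

lemma kap_bdd {ι : Type} [Fintype ι] [DecidableEq ι] {A : ℝ} {g : ℕ → (ι → ℝ) → ℝ} (h : ∀ j, Sup A (g j)) (J ν : ℕ) :
    ∃ C : ℝ, 0 ≤ C ∧ ∀ z (v : HS J ν), ‖kap g J ν z v‖ ≤ C * ‖v‖ := by
  choose C hC hb using fun j : Fin J => kern_bdd (h j) (R := 2^(j:ℕ)) (by positivity)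
  refine ⟨∑ j, C j, Finset.sum_nonneg fun j _ => hC j, fun z v => ?_⟩
  rw [kap_apply, Finset.sum_mul]
  refine (norm_sum_le _ _).trans (Finset.sum_le_sum fun j _ => ?_)
  rw [norm_smul]
  exact mul_le_mul (hb j z) (norm_Ej j v) (norm_nonneg _) (hC j)

def TT {m k : ℕ} (g : ℕ → (Fin m ⊕ Fin k → ℝ) → ℝ) (J ν : ℕ) (F : Torus m × Torus k → HS J ν) (z : Torus m × Torus k) : HS J ν :=
  ∫ w, kap g J ν (zz z - zz w) (F w)

def cellsum (m k n : ℕ) : Torus m × Torus k → GX m n × GX k n := fun z => (tidx m (2^n) z.1, tidx k (2^n) z.2)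

lemma cellsum_pre (m k n : ℕ) (a : GX m n × GX k n) :
    cellsum m k n ⁻¹' {a} = (tidx m (2^n) ⁻¹' {a.1}) ×ˢ (tidx k (2^n) ⁻¹' {a.2}) := by
  ext z; simp [cellsum, Prod.ext_iff]

lemma cellsum_meas (m k n : ℕ) (a : GX m n × GX k n) : MeasurableSet (cellsum m k n ⁻¹' {a}) := by
  rw [cellsum_pre]
  exact ((tidx_cells m (2^n)).meas _).prod ((tidx_cells k (2^n)).meas _)

lemma cellsum_cells (m k n : ℕ) : Cells (volume : Measure (Torus m × Torus k)) (cellsum m k n) ((((2^n:ℕ):ℝ≥0∞)⁻¹)^(m+k)) := by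
  refine ⟨cellsum_meas m k n, fun a => ?_, (by simp), ?_⟩
  · rw [cellsum_pre, Measure.volume_eq_prod, Measure.prod_prod, (tidx_cells m (2^n)).vol, (tidx_cells k (2^n)).vol, pow_add]
  · have := (tidx_cells (m+k) (2^n)).cT
    exact this

def avgF {m k J ν : ℕ} (n : ℕ) (F : Torus m × Torus k → HS J ν) (a : GX m n × GX k n) : HS J ν :=
  (((2^n:ℕ):ℝ)^(m+k)) • ∫ w in cellsum m k n ⁻¹' {a}, F w

lemma Td_avg {m k : ℕ} {A : ℝ} {g : ℕ → (Fin m ⊕ Fin k → ℝ) → ℝ} (h : ∀ j, Sup A (g j)) (J ν n : ℕ)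
    (F : Torus m × Torus k → HS J ν) (hF : Integrable F) (z : Torus m × Torus k) :
    Td g J ν n (avgF n F) (cellsum m k n z) = ∫ w, kap g J ν (zz (pn m k n z) - zz (pn m k n w)) (F w) := by
  have hd : Pairwise (Function.onFun Disjoint (fun a => cellsum m k n ⁻¹' {a})) := by
    intro x y hxy
    refine Set.disjoint_left.2 fun ω h1 h2 => hxy ?_
    simp at h1 h2
    rw [← h1, h2]
  have hU : (⋃ a, cellsum m k n ⁻¹' {a}) = Set.univ := by ext ω; simp
  have hloc : ∀ b, Set.EqOn (fun w => kap g J ν (zz (pn m k n z) - zz (pn m k n w)) (F w))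
      (fun w => kap g J ν (zz (pn m k n z) - gp (el m k n b)) (F w)) (cellsum m k n ⁻¹' {b}) := by
    intro b w hw
    have hw' : cellsum m k n w = b := hw
    simp only
    rw [zz_pn m k n w, ← hw']
    rfl
  have hIntg : ∀ b, IntegrableOn (fun w => kap g J ν (zz (pn m k n z) - gp (el m k n b)) (F w)) (cellsum m k n ⁻¹' {b}) := by
    intro b
    exact (ContinuousLinearMap.integrable_comp (LinearMap.toContinuousLinearMap (kap g J ν (zz (pn m k n z) - gp (el m k n b)))) hF).integrableOn
  rw [← setIntegral_univ (f := fun w => kap g J ν (zz (pn m k n z) - zz (pn m k n w)) (F w)), ← hU, integral_iUnion_fintype (cellsum_meas m k n) hd]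
  · rw [Td_apply]
    refine Finset.sum_congr rfl fun b _ => ?_
    rw [setIntegral_congr_fun (cellsum_meas m k n b) (hloc b)]
    have := ContinuousLinearMap.integral_comp_comm (LinearMap.toContinuousLinearMap (kap g J ν (zz (pn m k n z) - gp (el m k n b)))) (hF.integrableOn (s := cellsum m k n ⁻¹' {b}))
    simp only [LinearMap.coe_toContinuousLinearMap'] at this
    rw [this]
    simp only [Kd, avgF, LinearMap.smul_apply]
    rw [LinearMap.map_smul, smul_smul, inv_mul_cancel₀ (by positivity), one_smul, el_sub, gp_sub, zz_pn]
    rfl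
  · intro b
    exact (hIntg b).congr_fun (fun w hw => (hloc b hw).symm) (cellsum_meas m k n b)

lemma Td_tendsto {m k : ℕ} {A : ℝ} {g : ℕ → (Fin m ⊕ Fin k → ℝ) → ℝ} (h : ∀ j, Sup A (g j)) (J ν : ℕ)
    (F : Torus m × Torus k → HS J ν) (hF : Integrable F) (z : Torus m × Torus k) :
    Filter.Tendsto (fun n => Td g J ν n (avgF n F) (cellsum m k n z)) Filter.atTop (nhds (TT g J ν F z)) := by
  simp_rw [Td_avg h J ν _ F hF]
  obtain ⟨C, hC, hb⟩ := kap_bdd h J ν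
  refine tendsto_integral_of_dominated_convergence (fun w => C * ‖F w‖) ?_ (hF.norm.const_mul _) ?_ ?_
  · intro n
    have h1 : Measurable fun w => zz (pn m k n z) - zz (pn m k n w) := by
      have : Measurable fun w => zz (pn m k n w) := zz_cont.measurable.comp (pn_meas m k n)
      exact measurable_const.sub this
    have h2 : AEStronglyMeasurable (fun w => (zz (pn m k n z) - zz (pn m k n w), F w)) volume := h1.aestronglyMeasurable.prodMk hF.1
    have h3 := (kap_cont h J ν).comp_aestronglyMeasurable h2
    exact h3
  · intro n; exact Filter.Eventually.of_forall fun w => hb _ _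
  · refine Filter.Eventually.of_forall fun w => ?_
    have h1 : Filter.Tendsto (fun n => (zz (pn m k n z) - zz (pn m k n w), F w)) Filter.atTop (nhds (zz z - zz w, F w)) := by
      refine Filter.Tendsto.prodMk_nhds ?_ tendsto_const_nhds
      exact ((zz_cont.tendsto z).comp (pn_tendsto m k z)).sub ((zz_cont.tendsto w).comp (pn_tendsto m k w))
    have h3 := ((kap_cont h J ν).tendsto (zz z - zz w, F w)).comp h1
    exact h3

lemma mN_enn {X Y H : Type*} [Fintype X] [Fintype Y] [NormedAddCommGroup H] (p q : ℝ) (hp : 0 < p) (hq : 0 < q) (f : X × Y → H) :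
    ENNReal.ofReal (mN p q f) = ∑ x, (∑ y, ‖f (x,y)‖ₑ^q)^(p/q) := by
  unfold mN
  rw [ENNReal.ofReal_sum_of_nonneg (fun _ _ => by positivity)]
  refine Finset.sum_congr rfl fun x _ => ?_
  rw [← ENNReal.ofReal_rpow_of_nonneg (Finset.sum_nonneg fun _ _ => by positivity) (by positivity),
    ENNReal.ofReal_sum_of_nonneg (fun _ _ => by positivity)]
  congr 1
  refine Finset.sum_congr rfl fun y _ => ?_
  rw [← ENNReal.ofReal_rpow_of_nonneg (norm_nonneg _) hq.le, ofReal_norm]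

lemma Nmix_cell {m k : ℕ} {H : Type*} [NormedAddCommGroup H] (p q : ℝ) (hp : 0 < p) (hq : 0 < q) (n : ℕ) (f : GX m n × GX k n → H) :
    Nmix p q (fun z => ‖f (cellsum m k n z)‖ₑ) =
      ((((2^n:ℕ):ℝ≥0∞)⁻¹)^m) * ∑ x, (((((2^n:ℕ):ℝ≥0∞)⁻¹)^k) * ∑ y, ‖f (x,y)‖ₑ^q)^(p/q) := by
  unfold Nmix cellsum
  simp only
  rw [← (tidx_cells m (2^n)).lint_comp]
  refine lintegral_congr fun x => ?_
  rw [(tidx_cells k (2^n)).lint_comp (fun y => ‖f (tidx m (2^n) x, y)‖ₑ^q)]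

lemma Nmix_cell' {m k : ℕ} {H : Type*} [NormedAddCommGroup H] (p q : ℝ) (hp : 0 < p) (hq : 0 < q) (n : ℕ) (f : GX m n × GX k n → H) :
    Nmix p q (fun z => ‖f (cellsum m k n z)‖ₑ) =
      ((((2^n:ℕ):ℝ≥0∞)⁻¹)^m) * (((((2^n:ℕ):ℝ≥0∞)⁻¹)^k)^(p/q) * ENNReal.ofReal (mN p q f)) := by
  rw [Nmix_cell p q hp hq, mN_enn p q hp hq, Finset.mul_sum (Finset.univ) _ (((((2^n:ℕ):ℝ≥0∞)⁻¹)^k)^(p/q))]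
  congr 1
  refine Finset.sum_congr rfl fun x _ => ?_
  rw [ENNReal.mul_rpow_of_nonneg _ _ (by positivity)]

lemma Nmix_mono {m k : ℕ} (p q : ℝ) (hp : 0 < p) (hq : 0 < q) (G G' : Torus m × Torus k → ℝ≥0∞) (h : ∀ z, G z ≤ G' z) :
    Nmix p q G ≤ Nmix p q G' := by
  unfold Nmix
  gcongr with x y
  exact h _

lemma Nmix_avg {m k J ν : ℕ} (p q : ℝ) (hp : 1 < p) (hq : 1 < q) (n : ℕ) (F : Torus m × Torus k → HS J ν) (hF : StronglyMeasurable F) :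
    Nmix p q (fun z => ‖avgF n F (cellsum m k n z)‖ₑ) ≤ Nmix p q (fun z => ‖F z‖ₑ) := by
  have hq0 : 0 < q := by linarith
  have hp0 : 0 < p := by linarith
  rw [Nmix_cell p q hp0 hq0]
  refine le_trans ?_ (avg_contract (tidx_cells m (2^n)) (tidx_cells k (2^n)) (fun z => ‖F z‖ₑ) hF.enorm p q hp hq)
  gcongr with x _ y _
  unfold avgF
  rw [enorm_smul]
  refine (mul_le_mul_right (enorm_integral_le_lintegral_enorm _) _).trans ?_
  rw [cellsum_pre, Measure.volume_eq_prod, setLIntegral_prod _ hF.enorm.aemeasurable, lintegral_const_mul, ← mul_assoc]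
  · gcongr
    rw [← ENNReal.inv_pow, ← ENNReal.inv_pow, inv_inv, inv_inv, ← pow_add]
    rw [← ofReal_norm, Real.norm_of_nonneg (by positivity), ENNReal.ofReal_pow (by positivity), ENNReal.ofReal_natCast]
  · exact (Measurable.lintegral_prod_right' hF.enorm)

theorem cont_main (m k : ℕ) (B : ℕ → ℝ) (A : ℝ) (hA : 0 ≤ A) (g : ℕ → (Fin m ⊕ Fin k → ℝ) → ℝ) (hCl : ∀ j, Cl B (g j)) (hS : ∀ j, Sup A (g j)) (L : ℝ)
    (hL : ∀ ξ J, ∑ j ∈ Finset.range J, (g j (scl (2^j) ξ))^2 ≤ L) (p q : ℝ) (hp : 1 < p) (hq : 1 < q) :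
    ∃ C : ℝ, 0 ≤ C ∧ ∀ J ν : ℕ, ∀ F : Torus m × Torus k → HS J ν, StronglyMeasurable F → Integrable F →
      Nmix p q (fun z => ‖TT g J ν F z‖ₑ) ≤ ENNReal.ofReal C * Nmix p q (fun z => ‖F z‖ₑ) := by
  have hq0 : 0 < q := by linarith
  have hp0 : 0 < p := by linarith
  obtain ⟨C, hC, hmain⟩ := disc_main m k B A hA g hCl hS L hL p q hp hq
  refine ⟨C, hC, fun J ν F hF hFi => ?_⟩
  refine (Nmix_fatou p q hp0 hq0 (fun n z => ‖Td g J ν n (avgF n F) (cellsum m k n z)‖ₑ) _ (fun n => ?_)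
    (Filter.Eventually.of_forall fun z => (Td_tendsto hS J ν F hFi z).enorm)).trans ?_
  · have : Measurable fun z => Td g J ν n (avgF n F) (cellsum m k n z) := by
      intro s hs
      have : (fun z => Td g J ν n (avgF n F) (cellsum m k n z)) ⁻¹' s = ⋃ a ∈ {a | Td g J ν n (avgF n F) a ∈ s}, cellsum m k n ⁻¹' {a} := by
        ext z; simp
      rw [this]
      exact MeasurableSet.biUnion (Set.to_countable _) fun a _ => cellsum_meas m k n a
    exact this.enorm
  · refine Filter.liminf_le_of_frequently_le' (Filter.Eventually.frequently ?_)
    obtain ⟨N, hN⟩ := pow_unbounded_of_one_lt (4 * (A + 1) * 2^J) (one_lt_two (α := ℝ))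
    filter_upwards [Filter.eventually_ge_atTop N] with n hn
    have h1 : 4 * (A + 1) * 2^J < ((2^n:ℕ):ℝ) := by
      push_cast
      exact hN.trans_le (pow_le_pow_right₀ (by norm_num) hn)
    have h2 := hmain J ν n h1 (avgF n F)
    refine le_trans ?_ (mul_le_mul_right (Nmix_avg p q hp hq n F hF) _)
    rw [Nmix_cell' p q hp0 hq0, Nmix_cell' p q hp0 hq0]
    calc _ ≤ ((((2^n:ℕ):ℝ≥0∞)⁻¹)^m) * (((((2^n:ℕ):ℝ≥0∞)⁻¹)^k)^(p/q) * ENNReal.ofReal (C * mN p q (avgF n F))) := by gcongr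
      _ = _ := by rw [ENNReal.ofReal_mul hC]; ring

section Mult
variable {m k : ℕ}

instance instHaarTT (m k : ℕ) : (volume : Measure (Torus m × Torus k)).IsAddHaarMeasure := by
  rw [Measure.volume_eq_prod]
  exact Measure.prod.instIsAddHaarMeasure _ _

lemma zz_add (z w : Torus m × Torus k) : zz (z + w) = zz z + zz w := by
  funext i; rcases i with i | i <;> rfl

lemma zz_surj (x : Fin m ⊕ Fin k → AddCircle (1:ℝ)) : zz (fun i => x (Sum.inl i), fun i => x (Sum.inr i)) = x := by
  funext i; rcases i with i | i <;> rfl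

lemma int_chr (ξ : Fin m ⊕ Fin k → ℤ) : ∫ z : Torus m × Torus k, chr ξ (zz z) = if ξ = 0 then 1 else 0 := by
  split_ifs with h
  · subst h
    have : ∀ z : Torus m × Torus k, chr (0 : Fin m ⊕ Fin k → ℤ) (zz z) = 1 := by
      intro z; simp [chr, fourier_zero, -fourier_apply]
    simp [this]
  · obtain ⟨i, hi⟩ := Function.ne_iff.1 h
    have hi' : ξ i ≠ 0 := hi
    set t : AddCircle (1:ℝ) := ((1 / 2 / (ξ i : ℝ) : ℝ) : AddCircle (1:ℝ)) with ht
    have h1 : (fourier (ξ i) t : ℂ) = -1 := by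
      have := fourier_add_half_inv_index (T := (1:ℝ)) hi' one_pos 0
      rw [zero_add] at this
      rw [ht, this]; simp
    set s : Fin m ⊕ Fin k → AddCircle (1:ℝ) := Pi.single i t with hs
    have h2 : chr ξ s = -1 := by
      unfold chr
      rw [Finset.prod_eq_single i]
      · rw [hs, Pi.single_eq_same, h1]
      · intro j _ hj
        rw [hs, Pi.single_eq_of_ne hj]; simp
      · simp
    have h3 := integral_add_right_eq_self (μ := (volume : Measure (Torus m × Torus k))) (fun z => chr ξ (zz z)) (fun i => s (Sum.inl i), fun i => s (Sum.inr i))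
    simp_rw [zz_add, zz_surj, chr_zadd, h2] at h3
    rw [integral_mul_const] at h3
    have : (2:ℂ) * ∫ z : Torus m × Torus k, chr ξ (zz z) = 0 := by linear_combination -h3
    simpa using this

/-- Fourier coefficient, indexed by the sum type -/
def fc (v : Torus m × Torus k → ℂ) (ξ : Fin m ⊕ Fin k → ℤ) : ℂ := ∫ w, v w * chr (-ξ) (zz w)

/-- Fourier multiplier -/
def mulOp (a : (Fin m ⊕ Fin k → ℤ) → ℝ) (v : Torus m × Torus k → ℂ) (z : Torus m × Torus k) : ℂ :=
  ∑' ξ, (a ξ : ℂ) * fc v ξ * chr ξ (zz z)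

def FS (a : (Fin m ⊕ Fin k → ℤ) → ℝ) : Prop := ∃ s : Finset (Fin m ⊕ Fin k → ℤ), ∀ ξ, ξ ∉ s → a ξ = 0

lemma mulOp_eq (a : (Fin m ⊕ Fin k → ℤ) → ℝ) (s : Finset (Fin m ⊕ Fin k → ℤ)) (hs : ∀ ξ, ξ ∉ s → a ξ = 0)
    (v : Torus m × Torus k → ℂ) (z : Torus m × Torus k) :
    mulOp a v z = ∑ ξ ∈ s, (a ξ : ℂ) * fc v ξ * chr ξ (zz z) := by
  unfold mulOp
  apply tsum_eq_sum
  intro ξ hξ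
  simp [hs ξ hξ]

lemma mulOp_cont (a : (Fin m ⊕ Fin k → ℤ) → ℝ) (ha : FS a) (v : Torus m × Torus k → ℂ) : Continuous (mulOp a v) := by
  obtain ⟨s, hs⟩ := ha
  have : mulOp a v = fun z => ∑ ξ ∈ s, (a ξ : ℂ) * fc v ξ * chr ξ (zz z) := by funext z; exact mulOp_eq a s hs v z
  rw [this]
  exact continuous_finsetSum _ fun ξ _ => continuous_const.mul ((chr_cont ξ).comp zz_cont)

lemma cont_integrable {E : Type*} [NormedAddCommGroup E] (f : Torus m × Torus k → E) (hf : Continuous f) : Integrable f :=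
  (hf.integrable_of_hasCompactSupport (HasCompactSupport.of_compactSpace f))

lemma fc_chr (ξ η : Fin m ⊕ Fin k → ℤ) : fc (fun z : Torus m × Torus k => chr η (zz z)) ξ = if ξ = η then 1 else 0 := by
  unfold fc
  have : ∀ w : Torus m × Torus k, chr η (zz w) * chr (-ξ) (zz w) = chr (η - ξ) (zz w) := by
    intro w
    unfold chr
    rw [← Finset.prod_mul_distrib]
    refine Finset.prod_congr rfl fun i _ => ?_
    rw [← fourier_add]; rfl
  simp_rw [this]
  rw [int_chr]
  simp only [sub_eq_zero, eq_comm]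

lemma fc_sum {α : Type*} (s : Finset α) (c : α → ℂ) (f : α → Torus m × Torus k → ℂ) (hf : ∀ i ∈ s, Integrable (f i)) (ξ : Fin m ⊕ Fin k → ℤ) :
    fc (fun z => ∑ i ∈ s, c i * f i z) ξ = ∑ i ∈ s, c i * fc (f i) ξ := by
  unfold fc
  simp_rw [Finset.sum_mul, mul_assoc]
  rw [integral_finsetSum]
  · refine Finset.sum_congr rfl fun i _ => ?_
    rw [integral_const_mul]
  · intro i hi
    refine Integrable.const_mul ?_ _
    refine (hf i hi).mul_bdd (c := 1) ((chr_cont _).comp zz_cont).aestronglyMeasurable ?_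
    exact Filter.Eventually.of_forall fun z => (norm_chr _ _).le

lemma fc_mulOp (a : (Fin m ⊕ Fin k → ℤ) → ℝ) (ha : FS a) (v : Torus m × Torus k → ℂ) (ξ : Fin m ⊕ Fin k → ℤ) :
    fc (mulOp a v) ξ = a ξ * fc v ξ := by
  obtain ⟨s, hs⟩ := ha
  have : mulOp a v = fun z => ∑ ξ ∈ s, ((a ξ : ℂ) * fc v ξ) * chr ξ (zz z) := by funext z; exact mulOp_eq a s hs v z
  rw [this, fc_sum s (fun ξ => (a ξ : ℂ) * fc v ξ) (fun ξ z => chr ξ (zz z)) (fun ξ _ => cont_integrable _ ((chr_cont ξ).comp zz_cont))]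
  simp_rw [fc_chr]
  simp only [mul_ite, mul_one, mul_zero, Finset.sum_ite_eq]
  split_ifs with h
  · rfl
  · simp [hs ξ h]

lemma mulOp_mulOp (a b : (Fin m ⊕ Fin k → ℤ) → ℝ) (hb : FS b) (v : Torus m × Torus k → ℂ) (z : Torus m × Torus k) :
    mulOp a (mulOp b v) z = mulOp (fun ξ => a ξ * b ξ) v z := by
  unfold mulOp
  refine tsum_congr fun ξ => ?_
  have := fc_mulOp b hb v ξ
  unfold mulOp at this
  rw [this]
  push_cast; ring

lemma mulOp_sum {α : Type*} (t : Finset α) (a : α → (Fin m ⊕ Fin k → ℤ) → ℝ) (ha : ∀ i, FS (a i)) (v : Torus m × Torus k → ℂ) (z : Torus m × Torus k) :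
    mulOp (fun ξ => ∑ i ∈ t, a i ξ) v z = ∑ i ∈ t, mulOp (a i) v z := by
  unfold mulOp
  rw [← Summable.tsum_finsetSum]
  · refine tsum_congr fun ξ => ?_
    push_cast
    rw [Finset.sum_mul, Finset.sum_mul]
  · intro i _
    obtain ⟨s, hs⟩ := ha i
    exact summable_of_ne_finset_zero (s := s) fun ξ hξ => by simp [hs ξ hξ]

lemma FS_scl {A : ℝ} {g : (Fin m ⊕ Fin k → ℝ) → ℝ} (h : Sup A g) {R : ℝ} (hR : 0 < R) : FS (fun ξ => g (scl R ξ)) := by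
  obtain ⟨N, hN⟩ := exists_nat_gt (A*R)
  exact ⟨ibox _ N, fun ξ hξ => h.ibox hR N (by linarith) ξ hξ⟩

lemma mulOp_conv {A : ℝ} {g : (Fin m ⊕ Fin k → ℝ) → ℝ} (h : Sup A g) {R : ℝ} (hR : 0 < R) (v : Torus m × Torus k → ℂ) (hv : Integrable v)
    (z : Torus m × Torus k) : ∫ w, kern g R (zz z - zz w) * v w = mulOp (fun ξ => g (scl R ξ)) v z := by
  obtain ⟨N, hN⟩ := exists_nat_gt (A*R)
  rw [mulOp_eq _ (ibox _ N) (fun ξ hξ => h.ibox hR N (by linarith) ξ hξ)]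
  simp_rw [kern_eq h hR N (by linarith), Finset.sum_mul]
  rw [integral_finsetSum]
  · refine Finset.sum_congr rfl fun ξ _ => ?_
    unfold fc
    rw [mul_assoc, mul_comm (∫ w, _), ← mul_assoc, ← integral_const_mul]
    refine integral_congr_ae (Filter.Eventually.of_forall fun w => ?_)
    simp only
    rw [sub_eq_add_neg, chr_zadd, chr_neg]; ring
  · intro ξ _
    refine hv.bdd_mul (c := ‖(g (scl R ξ) : ℂ)‖) ?_ ?_
    · exact (continuous_const.mul ((chr_cont ξ).comp (continuous_const.sub zz_cont))).aestronglyMeasurable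
    · exact Filter.Eventually.of_forall fun w => by rw [norm_mul, norm_chr, mul_one]
end Mult

section Cut
variable {m k : ℕ}

def phs (φ : (Fin m → ℝ) × (Fin k → ℝ) → ℝ) (η : Fin m ⊕ Fin k → ℝ) : ℝ := φ (fun i => η (Sum.inl i), fun i => η (Sum.inr i))

def gg (φ : (Fin m → ℝ) × (Fin k → ℝ) → ℝ) (j : ℕ) (η : Fin m ⊕ Fin k → ℝ) : ℝ :=
  if j = 0 then phs φ η else phs φ η - phs φ (fun i => 2 * η i)

def csym (φ : (Fin m → ℝ) × (Fin k → ℝ) → ℝ) (j : ℕ) (ξ : Fin m ⊕ Fin k → ℤ) : ℝ :=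
  if j = 0 then 0 else phs φ (scl (2^(j-1)) ξ)

def psy (φ : (Fin m → ℝ) × (Fin k → ℝ) → ℝ) (j : ℕ) (ξ : Fin m ⊕ Fin k → ℤ) : ℝ := gg φ j (scl (2^j) ξ)

lemma psy_eq (φ : (Fin m → ℝ) × (Fin k → ℝ) → ℝ) (j : ℕ) (ξ : Fin m ⊕ Fin k → ℤ) : psy φ j ξ = csym φ (j+1) ξ - csym φ j ξ := by
  unfold psy gg csym
  by_cases hj : j = 0
  · subst hj; simp
  · obtain ⟨i, rfl⟩ := Nat.exists_eq_succ_of_ne_zero hj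
    simp only [Nat.succ_eq_add_one, Nat.add_eq_zero_iff, one_ne_zero, and_false, if_false, Nat.add_sub_cancel]
    congr 2
    funext l
    simp only [scl, pow_succ]
    field_simp

def ln (ξ : Fin m ⊕ Fin k → ℤ) : ℝ := eLen (fun i => (ξ (Sum.inl i) : ℝ), fun i => (ξ (Sum.inr i) : ℝ))

lemma eLen_scl (R : ℝ) (hR : 0 < R) (ξ : Fin m ⊕ Fin k → ℤ) :
    eLen (fun i => scl R ξ (Sum.inl i), fun i => scl R ξ (Sum.inr i)) = R⁻¹ * ln ξ := by
  unfold ln eLen scl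
  simp only [mul_pow, ← Finset.mul_sum, ← mul_add]
  rw [Real.sqrt_mul (by positivity), Real.sqrt_sq (by positivity)]

variable {φ : (Fin m → ℝ) × (Fin k → ℝ) → ℝ}

lemma csym_one (hφ : IsLPCutoff φ) (j : ℕ) (ξ : Fin m ⊕ Fin k → ℤ) (h : ln ξ ≤ 2^j) : csym φ (j+1) ξ = 1 := by
  unfold csym
  simp only [Nat.add_eq_zero_iff, one_ne_zero, and_false, if_false, Nat.add_sub_cancel]
  apply hφ.eq_one
  rw [eLen_scl _ (by positivity), ← div_eq_inv_mul]
  exact div_le_one_of_le₀ h (by positivity)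

lemma csym_zero (hφ : IsLPCutoff φ) (j : ℕ) (ξ : Fin m ⊕ Fin k → ℤ) (h : 2^j ≤ ln ξ) : csym φ j ξ = 0 := by
  unfold csym
  split_ifs with hj
  · rfl
  obtain ⟨i, rfl⟩ := Nat.exists_eq_succ_of_ne_zero hj
  apply hφ.eq_zero
  simp only [Nat.succ_eq_add_one, Nat.add_sub_cancel] at *
  rw [eLen_scl _ (by positivity), ← div_eq_inv_mul, le_div_iff₀ (by positivity)]
  rw [pow_succ] at h; linarith

lemma csym_mem (hφ : IsLPCutoff φ) (j : ℕ) (ξ : Fin m ⊕ Fin k → ℤ) : 0 ≤ csym φ j ξ ∧ csym φ j ξ ≤ 1 := by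
  unfold csym
  split_ifs with hj
  · norm_num
  · exact hφ.mem_Icc _

lemma psy_sq (hφ : IsLPCutoff φ) (j : ℕ) (ξ : Fin m ⊕ Fin k → ℤ) : (psy φ j ξ)^2 ≤ 1 := by
  rw [psy_eq]
  have h1 := csym_mem hφ j ξ
  have h2 := csym_mem hφ (j+1) ξ
  rw [sq_le_one_iff_abs_le_one, abs_le]
  constructor <;> linarith

lemma psy_ne (hφ : IsLPCutoff φ) (j : ℕ) (ξ : Fin m ⊕ Fin k → ℤ) (h : psy φ j ξ ≠ 0) :
    ln ξ < 2^(j+1) ∧ ∀ i, j = i + 1 → 2^i < ln ξ := by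
  rw [psy_eq] at h
  constructor
  · by_contra hc
    push Not at hc
    apply h
    rw [csym_zero hφ (j+1) ξ hc, csym_zero hφ j ξ (le_trans (pow_le_pow_right₀ (by norm_num) (by omega)) hc), sub_zero]
  · rintro i rfl
    by_contra hc
    push Not at hc
    apply h
    rw [csym_one hφ i ξ hc, csym_one hφ (i+1) ξ (hc.trans (pow_le_pow_right₀ (by norm_num) (by omega))), sub_self]

lemma psy_near (hφ : IsLPCutoff φ) (i j : ℕ) (ξ : Fin m ⊕ Fin k → ℤ) (h : psy φ i ξ ≠ 0) (h' : psy φ j ξ ≠ 0) : j ≤ i + 1 := by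
  by_contra hc
  push Not at hc
  obtain ⟨l, rfl⟩ : ∃ l, j = l + 1 := ⟨j-1, by omega⟩
  have h1 := (psy_ne hφ i ξ h).1
  have h2 := (psy_ne hφ _ ξ h').2 l rfl
  have : (2:ℝ)^(i+1) ≤ 2^l := pow_le_pow_right₀ (by norm_num) (by omega)
  linarith

lemma psy_L (hφ : IsLPCutoff φ) (ξ : Fin m ⊕ Fin k → ℤ) (J : ℕ) : ∑ j ∈ Finset.range J, (psy φ j ξ)^2 ≤ 2 := by
  classical
  by_cases hne : ∃ j, psy φ j ξ ≠ 0
  · set j0 := Nat.find hne with hj0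
    have h0 := Nat.find_spec hne
    have hsub : ∀ j ∈ Finset.range J, psy φ j ξ ≠ 0 → j ∈ ({j0, j0+1} : Finset ℕ) := by
      intro j _ hj
      have h1 := Nat.find_min' hne hj
      have h2 := psy_near hφ j0 j ξ h0 hj
      simp only [Finset.mem_insert, Finset.mem_singleton]; omega
    calc ∑ j ∈ Finset.range J, (psy φ j ξ)^2 ≤ ∑ j ∈ ({j0, j0+1} : Finset ℕ), (psy φ j ξ)^2 := by
          rw [← Finset.sum_filter_ne_zero]
          refine Finset.sum_le_sum_of_subset_of_nonneg ?_ (fun _ _ _ => sq_nonneg _)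
          intro j hj
          rw [Finset.mem_filter] at hj
          exact hsub j hj.1 (fun h => hj.2 (by rw [h]; norm_num))
      _ ≤ ∑ j ∈ ({j0, j0+1} : Finset ℕ), (1:ℝ) := Finset.sum_le_sum fun j _ => psy_sq hφ j ξ
      _ ≤ 2 := by
        rw [Finset.sum_const, Finset.card_pair (by omega)]; norm_num
  · push Not at hne
    simp [hne]

lemma psy_tilde (hφ : IsLPCutoff φ) (j : ℕ) (ξ : Fin m ⊕ Fin k → ℤ) :
    psy φ j ξ * (∑ i ∈ Finset.Ico (j-1) (j+2), psy φ i ξ) = psy φ j ξ := by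
  by_cases h : psy φ j ξ = 0
  · rw [h, zero_mul]
  have e : ∑ i ∈ Finset.Ico (j-1) (j+2), psy φ i ξ = csym φ (j+2) ξ - csym φ (j-1) ξ := by
    rw [Finset.sum_Ico_eq_sub _ (by omega)]
    simp_rw [psy_eq]
    rw [Finset.sum_range_sub (fun i => csym φ i ξ), Finset.sum_range_sub (fun i => csym φ i ξ)]; ring
  obtain ⟨h1, h2⟩ := psy_ne hφ j ξ h
  rw [e, csym_one hφ (j+1) ξ h1.le]
  have : csym φ (j-1) ξ = 0 := by
    by_cases hj : j = 0
    · subst hj; simp [csym]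
    · obtain ⟨i, rfl⟩ := Nat.exists_eq_succ_of_ne_zero hj
      exact csym_zero hφ i ξ (h2 i rfl).le
  rw [this]; ring

lemma psy_sum (J : ℕ) (ξ : Fin m ⊕ Fin k → ℤ) : ∑ i ∈ Finset.range J, psy φ i ξ = csym φ J ξ := by
  simp_rw [psy_eq]
  rw [Finset.sum_range_sub (fun i => csym φ i ξ)]; simp [csym]

lemma abs_le_eLen (v : (Fin m → ℝ) × (Fin k → ℝ)) : (∀ i, |v.1 i| ≤ eLen v) ∧ (∀ i, |v.2 i| ≤ eLen v) := by
  have h1 : 0 ≤ ∑ i, v.1 i^2 := Finset.sum_nonneg fun _ _ => sq_nonneg _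
  have h2 : 0 ≤ ∑ i, v.2 i^2 := Finset.sum_nonneg fun _ _ => sq_nonneg _
  constructor
  · intro i
    refine Real.abs_le_sqrt ?_
    have := Finset.single_le_sum (f := fun i => v.1 i^2) (fun _ _ => sq_nonneg _) (Finset.mem_univ i)
    linarith
  · intro i
    refine Real.abs_le_sqrt ?_
    have := Finset.single_le_sum (f := fun i => v.2 i^2) (fun _ _ => sq_nonneg _) (Finset.mem_univ i)
    linarith

lemma phs_Sup (hφ : IsLPCutoff φ) : Sup 2 (phs φ) := by
  intro x i hi
  apply hφ.eq_zero
  rcases i with i | i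
  · exact hi.le.trans ((abs_le_eLen (fun i => x (Sum.inl i), fun i => x (Sum.inr i))).1 i)
  · exact hi.le.trans ((abs_le_eLen (fun i => x (Sum.inl i), fun i => x (Sum.inr i))).2 i)

lemma phs2_Sup (hφ : IsLPCutoff φ) : Sup 2 (fun η => phs φ (fun i => 2 * η i)) := by
  intro x i hi
  refine phs_Sup hφ _ i ?_
  rw [abs_mul, abs_two]; linarith [abs_nonneg (x i)]

lemma gg_Sup (hφ : IsLPCutoff φ) (j : ℕ) : Sup 2 (gg φ j) := by
  intro x i hi
  unfold gg
  have h1 := phs_Sup hφ x i hi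
  have h2 := phs2_Sup hφ x i hi
  simp only at h2
  split_ifs
  · exact h1
  · rw [h1, h2, sub_zero]

lemma Sup_compact {g : (Fin m ⊕ Fin k → ℝ) → ℝ} {A : ℝ} (h : Sup A g) : HasCompactSupport g := by
  refine HasCompactSupport.intro (K := Set.pi Set.univ (fun _ => Set.Icc (-A) A)) (isCompact_univ_pi fun _ => isCompact_Icc) ?_
  intro x hx
  simp only [Set.mem_pi, Set.mem_univ, true_implies, not_forall] at hx
  obtain ⟨i, hi⟩ := hx
  refine h x i ?_
  by_contra hc
  push Not at hc
  exact hi (abs_le.1 hc)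

lemma phs_smooth (hφ : IsLPCutoff φ) : ContDiff ℝ (⊤:ℕ∞) (phs φ) := by
  unfold phs
  refine hφ.smooth.comp ?_
  refine ContDiff.prodMk ?_ ?_
  · exact contDiff_pi.2 fun i => contDiff_apply ℝ ℝ _
  · exact contDiff_pi.2 fun i => contDiff_apply ℝ ℝ _

lemma phs2_smooth (hφ : IsLPCutoff φ) : ContDiff ℝ (⊤:ℕ∞) (fun η : Fin m ⊕ Fin k → ℝ => phs φ (fun i => 2 * η i)) := by
  refine (phs_smooth hφ).comp ?_
  exact contDiff_pi.2 fun i => contDiff_const.mul (contDiff_apply ℝ ℝ _)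

lemma Cl_nonneg {B : ℕ → ℝ} {g : (Fin m ⊕ Fin k → ℝ) → ℝ} (h : Cl B g) (N : ℕ) : 0 ≤ B N := (norm_nonneg _).trans (h.2 N 0)

lemma gg_Cl (hφ : IsLPCutoff φ) : ∃ B, (∀ j, Cl B (gg φ j)) ∧ Cl B (phs φ) := by
  obtain ⟨B, hB⟩ := exists_Cl _ (phs_smooth hφ) (Sup_compact (phs_Sup hφ))
  obtain ⟨B', hB'⟩ := exists_Cl _ (phs2_smooth hφ) (Sup_compact (phs2_Sup hφ))
  have h1 : Cl (fun N => B N + B' N) (phs φ) := ⟨hB.1, fun N x => (hB.2 N x).trans (by have := Cl_nonneg hB' N; linarith)⟩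
  refine ⟨fun N => B N + B' N, fun j => ?_, h1⟩
  by_cases hj : j = 0
  · subst hj
    have : gg φ 0 = phs φ := by funext x; simp [gg]
    rw [this]; exact h1
  · have : gg φ j = fun η => phs φ η - phs φ (fun i => 2 * η i) := by funext x; simp [gg, hj]
    rw [this]; exact hB.sub hB'

lemma psy_FS (hφ : IsLPCutoff φ) (j : ℕ) : FS (psy φ j) := FS_scl (gg_Sup hφ j) (by positivity)

lemma chr_split (ξ : (Fin m → ℤ) × (Fin k → ℤ)) (z : Torus m × Torus k) :
    eChar ξ.1 z.1 * eChar ξ.2 z.2 = chr (Sum.elim ξ.1 ξ.2) (zz z) := by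
  unfold eChar chr zz
  rw [Fintype.prod_sum_type]; rfl

lemma fcoef_eq (v : Torus m × Torus k → ℂ) (ξ : (Fin m → ℤ) × (Fin k → ℤ)) : fcoef v ξ = fc v (Sum.elim ξ.1 ξ.2) := by
  unfold fcoef fc
  simp_rw [chr_split, chr_conj]

lemma psiCut_eq (j : ℕ) (ξ : (Fin m → ℤ) × (Fin k → ℤ)) : psiCut φ j ξ = psy φ j (Sum.elim ξ.1 ξ.2) := by
  rw [psy_eq]
  unfold psiCut csym phs
  by_cases hj : j = 0
  · subst hj
    simp [scl, latCoe]
  · simp only [hj, if_false, Nat.add_eq_zero_iff, and_false, one_ne_zero, Nat.add_sub_cancel]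
    rfl

lemma lpProj_eq (j : ℕ) (v : Torus m × Torus k → ℂ) (z : Torus m × Torus k) : lpProj φ j v z = mulOp (psy φ j) v z := by
  unfold lpProj mulOp
  rw [← (Equiv.sumArrowEquivProdArrow (Fin m) (Fin k) ℤ).symm.tsum_eq]
  refine tsum_congr fun ξ => ?_
  rw [psiCut_eq, fcoef_eq, chr_split]
  rfl
end Cut

section Dens
variable {m k : ℕ} {φ : (Fin m → ℝ) × (Fin k → ℝ) → ℝ}

lemma kern_L1 (hφ : IsLPCutoff φ) : ∃ C : ℝ, 0 ≤ C ∧ ∀ J : ℕ, ∫⁻ w : Torus m × Torus k, ‖kern (phs φ) (2^J) (zz w)‖ₑ ≤ ENNReal.ofReal C := by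
  obtain ⟨B, -, hB⟩ := gg_Cl hφ
  obtain ⟨C, hC, hk⟩ := kern_l1 (ι := Fin m ⊕ Fin k) B 2 (by norm_num)
  refine ⟨C, hC, fun J => ?_⟩
  have hcont := kern_cont (phs_Sup hφ) (R := 2^J) (by positivity)
  have h1 : ∀ w : Torus m × Torus k, ‖kern (phs φ) (2^J) (zz w)‖ₑ = Filter.liminf (fun n => ‖kern (phs φ) (2^J) (zz (pn m k n w))‖ₑ) Filter.atTop := by
    intro w
    have h3 := ((hcont.tendsto (zz w)).comp ((zz_cont.tendsto w).comp (pn_tendsto m k w))).enorm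
    exact h3.liminf_eq.symm
  rw [lintegral_congr h1]
  refine (lintegral_liminf_le fun n => ?_).trans ?_
  · exact (hcont.measurable.comp (zz_cont.measurable.comp (pn_meas m k n))).enorm
  · refine Filter.liminf_le_of_frequently_le' (Filter.Eventually.frequently ?_)
    filter_upwards [Filter.eventually_ge_atTop J] with n hn
    have h2 : ∫⁻ w : Torus m × Torus k, ‖kern (phs φ) (2^J) (zz (pn m k n w))‖ₑ =
        ∫⁻ w : Torus m × Torus k, (fun a => ‖kern (phs φ) (2^J) (gp (el m k n a))‖ₑ) (cellsum m k n w) := by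
      refine lintegral_congr fun w => ?_
      rw [zz_pn]; rfl
    rw [h2, (cellsum_cells m k n).lint_comp (fun a => ‖kern (phs φ) (2^J) (gp (el m k n a))‖ₑ)]
    have h3 := (hk (phs φ) (2^J) (2^n) (one_le_pow₀ (by norm_num)) (by push_cast; exact pow_le_pow_right₀ (by norm_num) hn) hB (phs_Sup hφ)).1
    rw [← (el m k n).sum_comp] at h3
    have h4 : ∑ a, ‖kern (phs φ) (2^J) (gp (el m k n a))‖ₑ ≤ ENNReal.ofReal C * (((2^n:ℕ):ℝ≥0∞))^(m+k) := by
      have h5 := ENNReal.ofReal_le_ofReal h3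
      rw [ENNReal.ofReal_sum_of_nonneg (fun _ _ => norm_nonneg _), ENNReal.ofReal_mul hC, ENNReal.ofReal_pow (by positivity), ENNReal.ofReal_natCast] at h5
      simp only [ofReal_norm] at h5
      simpa using h5
    calc _ ≤ ((((2^n:ℕ):ℝ≥0∞)⁻¹)^(m+k)) * (ENNReal.ofReal C * (((2^n:ℕ):ℝ≥0∞))^(m+k)) := by gcongr
      _ = ENNReal.ofReal C * ((((2^n:ℕ):ℝ≥0∞)⁻¹) * ((2^n:ℕ):ℝ≥0∞))^(m+k) := by rw [mul_pow]; ring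
      _ = _ := by rw [ENNReal.inv_mul_cancel (by simp) (by simp), one_pow, mul_one]

lemma csym_succ (J : ℕ) : csym φ (J+1) = fun ξ => phs φ (scl (2^J) ξ) := by
  funext ξ; simp [csym]

lemma S_L1 (hφ : IsLPCutoff φ) : ∃ C : ℝ, 0 ≤ C ∧ ∀ (J : ℕ) (v : Torus m × Torus k → ℂ), StronglyMeasurable v → Integrable v →
    ∫⁻ z, ‖mulOp (csym φ (J+1)) v z‖ₑ ≤ ENNReal.ofReal C * ∫⁻ z, ‖v z‖ₑ := by
  obtain ⟨C, hC, hk⟩ := kern_L1 hφ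
  refine ⟨C, hC, fun J v hv hvi => ?_⟩
  have hcont := kern_cont (phs_Sup hφ) (R := 2^J) (by positivity)
  have hsub : ∀ z w : Torus m × Torus k, zz z - zz w = zz (z - w) := by
    intro z w; funext i; rcases i with i | i <;> rfl
  calc ∫⁻ z, ‖mulOp (csym φ (J+1)) v z‖ₑ ≤ ∫⁻ z, ∫⁻ w, ‖kern (phs φ) (2^J) (zz (z - w))‖ₑ * ‖v w‖ₑ := by
        refine lintegral_mono fun z => ?_
        simp only
        rw [csym_succ, ← mulOp_conv (phs_Sup hφ) (by positivity) v hvi]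
        refine (enorm_integral_le_lintegral_enorm _).trans (le_of_eq ?_)
        simp_rw [enorm_mul, hsub]
    _ = ∫⁻ w, ∫⁻ z, ‖kern (phs φ) (2^J) (zz (z - w))‖ₑ * ‖v w‖ₑ := by
        rw [lintegral_lintegral_swap]
        have ha : Measurable fun p : (Torus m × Torus k) × (Torus m × Torus k) => ‖kern (phs φ) (2^J) (zz (p.1 - p.2))‖ₑ := by
          have : BorelSpace ((Torus m × Torus k) × (Torus m × Torus k)) := Prod.borelSpace
          have h3 := (hcont.comp (zz_cont.comp (continuous_fst.sub continuous_snd))).measurable.enorm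
          exact h3
        have hb : Measurable fun p : (Torus m × Torus k) × (Torus m × Torus k) => ‖v p.2‖ₑ := by
          exact hv.enorm.comp measurable_snd
        exact (ha.mul hb).aemeasurable
    _ = ∫⁻ w, (∫⁻ z : Torus m × Torus k, ‖kern (phs φ) (2^J) (zz z)‖ₑ) * ‖v w‖ₑ := by
        refine lintegral_congr fun w => ?_
        have hm : Measurable fun z : Torus m × Torus k => ‖kern (phs φ) (2^J) (zz (z - w))‖ₑ := by
          have h3 := (hcont.comp (zz_cont.comp (continuous_id.sub (continuous_const (y := w))))).measurable.enorm
          exact h3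
        rw [lintegral_mul_const _ hm]
        rw [lintegral_sub_right_eq_self (fun z => ‖kern (phs φ) (2^J) (zz z)‖ₑ) w]
    _ = (∫⁻ z : Torus m × Torus k, ‖kern (phs φ) (2^J) (zz z)‖ₑ) * ∫⁻ w, ‖v w‖ₑ := by rw [lintegral_const_mul _ hv.enorm]
    _ ≤ _ := by gcongr; exact hk J

lemma trig_dense (v : Torus m × Torus k → ℂ) (hv : Integrable v) (ε : ℝ) (hε : 0 < ε) :
    ∃ (s : Finset (Fin m ⊕ Fin k → ℤ)) (c : (Fin m ⊕ Fin k → ℤ) → ℂ),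
      ∫⁻ z, ‖v z - ∑ ξ ∈ s, c ξ * chr ξ (zz z)‖ₑ ≤ ENNReal.ofReal ε := by
  obtain ⟨f, hf, -⟩ := (memLp_one_iff_integrable.2 hv).exists_boundedContinuous_eLpNorm_sub_le (by simp) (ε := ENNReal.ofReal (ε/2)) (by simp [hε])
  rw [eLpNorm_one_eq_lintegral_enorm] at hf
  let h : C(UnitAddTorus (Fin m ⊕ Fin k), ℂ) := ⟨fun x => f (fun i => x (Sum.inl i), fun i => x (Sum.inr i)), by
    refine f.continuous.comp ?_
    fun_prop⟩
  have hmem : h ∈ (Submodule.span ℂ (Set.range (UnitAddTorus.mFourier (d := Fin m ⊕ Fin k)))).topologicalClosure := by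
    rw [UnitAddTorus.span_mFourier_closure_eq_top]; trivial
  have hmem' : h ∈ closure ((Submodule.span ℂ (Set.range (UnitAddTorus.mFourier (d := Fin m ⊕ Fin k))) : Set _)) := hmem
  obtain ⟨y, hy, hd⟩ := Metric.mem_closure_iff.1 hmem' (ε/2) (by positivity)
  obtain ⟨c, hc⟩ := (Finsupp.mem_span_range_iff_exists_finsupp).1 hy
  refine ⟨c.support, c, ?_⟩
  have hyz : ∀ z : Torus m × Torus k, ∑ ξ ∈ c.support, c ξ * chr ξ (zz z) = y (zz z) := by
    intro z
    rw [← hc, Finsupp.sum]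
    rw [ContinuousMap.coe_sum, Finset.sum_apply]
    rfl
  have hfy : ∀ z : Torus m × Torus k, ‖f z - y (zz z)‖ₑ ≤ ENNReal.ofReal (ε/2) := by
    intro z
    rw [← ofReal_norm]
    refine ENNReal.ofReal_le_ofReal ?_
    have h1 := ContinuousMap.dist_apply_le_dist (f := h) (g := y) (zz z)
    rw [dist_eq_norm] at h1
    exact h1.trans hd.le
  calc ∫⁻ z, ‖v z - ∑ ξ ∈ c.support, c ξ * chr ξ (zz z)‖ₑ ≤ ∫⁻ z, (‖(v - f) z‖ₑ + ENNReal.ofReal (ε/2)) := by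
        refine lintegral_mono fun z => ?_
        simp only
        rw [hyz]
        have : v z - y (zz z) = (v - f) z + (f z - y (zz z)) := by simp
        rw [this]
        exact (enorm_add_le _ _).trans (add_le_add le_rfl (hfy z))
    _ = (∫⁻ z, ‖(v - f) z‖ₑ) + ENNReal.ofReal (ε/2) := by
        rw [lintegral_add_right _ measurable_const]; simp
    _ ≤ ENNReal.ofReal (ε/2) + ENNReal.ofReal (ε/2) := by gcongr
    _ = _ := by rw [← ENNReal.ofReal_add (by positivity) (by positivity)]; congr 1; ring

lemma mulOp_sub (a : (Fin m ⊕ Fin k → ℤ) → ℝ) (ha : FS a) (v t : Torus m × Torus k → ℂ) (hv : Integrable v) (ht : Integrable t) (z : Torus m × Torus k) :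
    mulOp a (fun w => v w - t w) z = mulOp a v z - mulOp a t z := by
  obtain ⟨s, hs⟩ := ha
  rw [mulOp_eq a s hs, mulOp_eq a s hs, mulOp_eq a s hs, ← Finset.sum_sub_distrib]
  refine Finset.sum_congr rfl fun ξ _ => ?_
  have hb : ∀ v : Torus m × Torus k → ℂ, Integrable v → Integrable fun w => v w * chr (-ξ) (zz w) := by
    intro v hv
    refine hv.mul_bdd (c := 1) ((chr_cont _).comp zz_cont).aestronglyMeasurable ?_
    exact Filter.Eventually.of_forall fun z => (norm_chr _ _).le
  have : fc (fun w => v w - t w) ξ = fc v ξ - fc t ξ := by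
    unfold fc
    rw [← integral_sub (hb v hv) (hb t ht)]
    simp_rw [sub_mul]
  rw [this]; ring

lemma mulOp_trig (a : (Fin m ⊕ Fin k → ℤ) → ℝ) (s : Finset (Fin m ⊕ Fin k → ℤ)) (c : (Fin m ⊕ Fin k → ℤ) → ℂ) (ha : ∀ ξ ∈ s, a ξ = 1)
    (z : Torus m × Torus k) : mulOp a (fun w => ∑ ξ ∈ s, c ξ * chr ξ (zz w)) z = ∑ ξ ∈ s, c ξ * chr ξ (zz z) := by
  have h1 : ∀ ξ, fc (fun w : Torus m × Torus k => ∑ ξ ∈ s, c ξ * chr ξ (zz w)) ξ = if ξ ∈ s then c ξ else 0 := by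
    intro ξ
    rw [fc_sum s c (fun ξ z => chr ξ (zz z)) (fun ξ _ => cont_integrable _ ((chr_cont ξ).comp zz_cont))]
    simp_rw [fc_chr]
    simp
  unfold mulOp
  simp_rw [h1]
  rw [tsum_eq_sum (s := s)]
  · refine Finset.sum_congr rfl fun ξ hξ => ?_
    rw [ha ξ hξ, if_pos hξ]; simp
  · intro ξ hξ; simp [hξ]

lemma csym_FS (hφ : IsLPCutoff φ) (J : ℕ) : FS (csym φ (J+1)) := by
  rw [csym_succ]; exact FS_scl (phs_Sup hφ) (by positivity)

lemma S_tendsto (hφ : IsLPCutoff φ) (v : Torus m × Torus k → ℂ) (hv : StronglyMeasurable v) (hvi : Integrable v) :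
    Filter.Tendsto (fun J => ∫⁻ z, ‖mulOp (csym φ (J+1)) v z - v z‖ₑ) Filter.atTop (nhds 0) := by
  obtain ⟨C, hC, hS⟩ := S_L1 hφ
  rw [ENNReal.tendsto_nhds_zero]
  intro ε hε
  obtain ⟨δ, hδ, hδε⟩ : ∃ δ : ℝ, 0 < δ ∧ ENNReal.ofReal δ ≤ ε := by
    by_cases h : ε = ∞
    · exact ⟨1, one_pos, by rw [h]; exact le_top⟩
    · exact ⟨ε.toReal, ENNReal.toReal_pos hε.ne' h, by rw [ENNReal.ofReal_toReal h]⟩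
  obtain ⟨s, c, hsc⟩ := trig_dense v hvi (δ/(C+1)) (by positivity)
  set t : Torus m × Torus k → ℂ := fun w => ∑ ξ ∈ s, c ξ * chr ξ (zz w) with ht
  have htc : Continuous t := continuous_finsetSum _ fun ξ _ => continuous_const.mul ((chr_cont ξ).comp zz_cont)
  have hti : Integrable t := cont_integrable t htc
  obtain ⟨N, hN⟩ := pow_unbounded_of_one_lt (∑ ξ ∈ s, |ln ξ|) (one_lt_two (α := ℝ))
  filter_upwards [Filter.eventually_ge_atTop N] with J hJ
  have hone : ∀ ξ ∈ s, csym φ (J+1) ξ = 1 := by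
    intro ξ hξ
    apply csym_one hφ
    calc ln ξ ≤ |ln ξ| := le_abs_self _
      _ ≤ ∑ ξ ∈ s, |ln ξ| := Finset.single_le_sum (f := fun ξ => |ln ξ|) (fun _ _ => abs_nonneg _) hξ
      _ ≤ 2^N := hN.le
      _ ≤ 2^J := pow_le_pow_right₀ (by norm_num) hJ
  have hpt : ∀ z, mulOp (csym φ (J+1)) v z - v z = mulOp (csym φ (J+1)) (fun w => v w - t w) z - (v z - t z) := by
    intro z
    rw [mulOp_sub _ (csym_FS hφ J) v t hvi hti, mulOp_trig _ s c hone]; ring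
  have hvt : StronglyMeasurable fun w => v w - t w := hv.sub htc.stronglyMeasurable
  calc ∫⁻ z, ‖mulOp (csym φ (J+1)) v z - v z‖ₑ ≤ ∫⁻ z, (‖mulOp (csym φ (J+1)) (fun w => v w - t w) z‖ₑ + ‖v z - t z‖ₑ) := by
        refine lintegral_mono fun z => ?_
        simp only [hpt]
        exact enorm_sub_le
    _ = (∫⁻ z, ‖mulOp (csym φ (J+1)) (fun w => v w - t w) z‖ₑ) + ∫⁻ z, ‖v z - t z‖ₑ := lintegral_add_right _ hvt.enorm
    _ ≤ ENNReal.ofReal C * (∫⁻ z, ‖v z - t z‖ₑ) + ∫⁻ z, ‖v z - t z‖ₑ := by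
        gcongr; exact hS J _ hvt (hvi.sub hti)
    _ ≤ ENNReal.ofReal C * ENNReal.ofReal (δ/(C+1)) + ENNReal.ofReal (δ/(C+1)) := by gcongr
    _ = ENNReal.ofReal δ := by
        rw [← ENNReal.ofReal_mul hC, ← ENNReal.ofReal_add (by positivity) (by positivity)]
        congr 1; field_simp
    _ ≤ ε := hδε

lemma S_ae (hφ : IsLPCutoff φ) (ν : ℕ) (v : Fin ν → Torus m × Torus k → ℂ) (hv : ∀ i, StronglyMeasurable (v i)) (hvi : ∀ i, Integrable (v i)) :
    ∃ ns : ℕ → ℕ, ∀ᵐ z, ∀ i, Filter.Tendsto (fun l => mulOp (csym φ (ns l + 1)) (v i) z) Filter.atTop (nhds (v i z)) := by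
  have hmeas : ∀ J, StronglyMeasurable fun z => (fun i => mulOp (csym φ (J+1)) (v i) z) := fun J =>
    (continuous_pi fun i => mulOp_cont _ (csym_FS hφ J) (v i)).stronglyMeasurable
  have hmeas' : StronglyMeasurable fun z => (fun i => v i z) := (measurable_pi_lambda _ fun i => (hv i).measurable).stronglyMeasurable
  have hten : TendstoInMeasure volume (fun J z => (fun i => mulOp (csym φ (J+1)) (v i) z)) Filter.atTop (fun z => (fun i => v i z)) := by
    refine tendstoInMeasure_of_tendsto_eLpNorm (p := 1) (by simp) (fun J => (hmeas J).aestronglyMeasurable) hmeas'.aestronglyMeasurable ?_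
    have hsum : Filter.Tendsto (fun J => ∑ i, ∫⁻ z, ‖mulOp (csym φ (J+1)) (v i) z - v i z‖ₑ) Filter.atTop (nhds 0) := by
      have := tendsto_finsetSum (Finset.univ : Finset (Fin ν)) fun i _ => S_tendsto hφ (v i) (hv i) (hvi i)
      simpa using this
    refine tendsto_of_tendsto_of_tendsto_of_le_of_le tendsto_const_nhds hsum (fun _ => zero_le) fun J => ?_
    simp only
    rw [eLpNorm_one_eq_lintegral_enorm, ← lintegral_finsetSum]
    · refine lintegral_mono fun z => ?_
      rw [← ofReal_norm]
      simp_rw [← ofReal_norm]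
      rw [← ENNReal.ofReal_sum_of_nonneg (fun _ _ => norm_nonneg _)]
      refine ENNReal.ofReal_le_ofReal ?_
      rw [pi_norm_le_iff_of_nonneg (Finset.sum_nonneg fun _ _ => norm_nonneg _)]
      intro i
      exact Finset.single_le_sum (f := fun i => ‖mulOp (csym φ (J+1)) (v i) z - v i z‖) (fun _ _ => norm_nonneg _) (Finset.mem_univ i)
    · intro i _
      exact ((mulOp_cont _ (csym_FS hφ J) (v i)).measurable.sub (hv i).measurable).enorm
  obtain ⟨ns, -, hns⟩ := hten.exists_seq_tendsto_ae
  refine ⟨ns, ?_⟩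
  filter_upwards [hns] with z hz i
  exact (tendsto_pi_nhds.1 hz) i
end Dens

section Core
variable {m k : ℕ} {φ : (Fin m → ℝ) × (Fin k → ℝ) → ℝ}

lemma HS_enorm {J ν : ℕ} (x : HS J ν) :
    ‖x‖ₑ^2 = ∑ i, ‖x (none, i)‖ₑ^2 + ∑ j : Fin J, ∑ i, ‖x (some j, i)‖ₑ^2 := by
  have h1 : ‖x‖ₑ^2 = ∑ t, ‖x t‖ₑ^2 := by
    rw [← ofReal_norm, ← ENNReal.ofReal_pow (norm_nonneg _), EuclideanSpace.norm_sq_eq,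
      ENNReal.ofReal_sum_of_nonneg (fun _ _ => by positivity)]
    refine Finset.sum_congr rfl fun t _ => ?_
    rw [ENNReal.ofReal_pow (norm_nonneg _), ofReal_norm]
  rw [h1, Fintype.sum_prod_type, Fintype.sum_option]

lemma TT_apply (hφ : IsLPCutoff φ) (J ν : ℕ) (F : Torus m × Torus k → HS J ν) (hF : Integrable F) (z : Torus m × Torus k) (t : Th J ν) :
    TT (gg φ) J ν F z t = ∑ j : Fin J, (cj ν j t : ℂ) * mulOp (psy φ j) (fun w => F w (pj ν j t)) z := by
  have hIntg : Integrable fun w => kap (gg φ) J ν (zz z - zz w) (F w) := by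
    obtain ⟨C, hC, hb⟩ := kap_bdd (gg_Sup hφ) J ν
    refine Integrable.mono' (hF.norm.const_mul C) ?_ (Filter.Eventually.of_forall fun w => hb _ _)
    have h0 : AEStronglyMeasurable (fun w => (zz z - zz w, F w)) volume :=
      (continuous_const.sub zz_cont).aestronglyMeasurable.prodMk hF.1
    have h3 := (kap_cont (gg_Sup hφ) J ν).comp_aestronglyMeasurable h0
    exact h3
  have h1 : TT (gg φ) J ν F z t = ∫ w, (kap (gg φ) J ν (zz z - zz w) (F w)) t := by
    have h3 := (EuclideanSpace.proj t : HS J ν →L[ℂ] ℂ).integral_comp_comm hIntg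
    exact h3.symm
  have hcomp : ∀ t, Integrable fun w => F w t := fun t => hF.eval_piLp t
  rw [h1]
  have h2 : ∀ w, (kap (gg φ) J ν (zz z - zz w) (F w)) t =
      ∑ j : Fin J, (cj ν j t : ℂ) * (kern (gg φ j) (2^(j:ℕ)) (zz z - zz w) * F w (pj ν j t)) := by
    intro w
    rw [kap_apply, WithLp.ofLp_sum, Finset.sum_apply]
    refine Finset.sum_congr rfl fun j _ => ?_
    rw [PiLp.smul_apply, Ej_apply, smul_eq_mul]; ring
  simp_rw [h2]
  rw [integral_finsetSum]
  · refine Finset.sum_congr rfl fun j _ => ?_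
    rw [integral_const_mul, mulOp_conv (gg_Sup hφ j) (by positivity) _ (hcomp _)]
    rfl
  · intro j _
    refine Integrable.const_mul ?_ _
    obtain ⟨C, hC, hb⟩ := kern_bdd (gg_Sup hφ j) (R := 2^(j:ℕ)) (by positivity)
    refine (hcomp _).bdd_mul (c := C) ?_ (Filter.Eventually.of_forall fun w => hb _)
    have h3 := (kern_cont (gg_Sup hφ j) (R := 2^(j:ℕ)) (by positivity)).comp (continuous_const.sub zz_cont (f := fun _ => zz z))
    exact h3.aestronglyMeasurable

lemma TT_some (hφ : IsLPCutoff φ) (J ν : ℕ) (F : Torus m × Torus k → HS J ν) (hF : Integrable F) (z : Torus m × Torus k) (j : Fin J) (i : Fin ν) :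
    TT (gg φ) J ν F z (some j, i) = mulOp (psy φ j) (fun w => F w (none, i)) z := by
  rw [TT_apply hφ J ν F hF, Finset.sum_eq_single j]
  · simp [cj, pj]
  · intro j' _ hj
    have : cj ν j' (some j, i) = 0 := by simp [cj, Ne.symm hj]
    rw [this]; simp
  · simp

lemma TT_none (hφ : IsLPCutoff φ) (J ν : ℕ) (F : Torus m × Torus k → HS J ν) (hF : Integrable F) (z : Torus m × Torus k) (i : Fin ν) :
    TT (gg φ) J ν F z (none, i) = ∑ j : Fin J, mulOp (psy φ j) (fun w => F w (some j, i)) z := by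
  rw [TT_apply hφ J ν F hF]
  refine Finset.sum_congr rfl fun j _ => ?_
  simp [cj, pj]

lemma mulOp_smul (a : (Fin m ⊕ Fin k → ℤ) → ℝ) (c : ℂ) (v : Torus m × Torus k → ℂ) (z : Torus m × Torus k) :
    mulOp a (fun w => c * v w) z = c * mulOp a v z := by
  unfold mulOp fc
  rw [← tsum_mul_left]
  refine tsum_congr fun ξ => ?_
  simp_rw [mul_assoc c]
  rw [integral_const_mul]; ring

lemma mulOp_congr (a : (Fin m ⊕ Fin k → ℤ) → ℝ) (v t : Torus m × Torus k → ℂ) (h : v =ᵐ[volume] t) (z : Torus m × Torus k) :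
    mulOp a v z = mulOp a t z := by
  unfold mulOp fc
  refine tsum_congr fun ξ => ?_
  rw [integral_congr_ae (g := fun w => t w * chr (-ξ) (zz w))]
  filter_upwards [h] with w hw
  rw [hw]

lemma Nmix_sq (r q : ℝ) (G : Torus m × Torus k → ℝ≥0∞) :
    Nmix r q (fun z => G z ^ 2) = Nmix (2*r) (2*q) G := by
  unfold Nmix
  have : r / q = 2*r/(2*q) := by rw [mul_div_mul_left _ _ (by norm_num)]
  rw [this]
  refine lintegral_congr fun x => ?_
  congr 1
  refine lintegral_congr fun y => ?_
  rw [ENNReal.rpow_mul]; norm_num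

lemma Nmix_congr (p q : ℝ) (G G' : Torus m × Torus k → ℝ≥0∞) (h : G =ᵐ[volume] G') : Nmix p q G = Nmix p q G' := by
  unfold Nmix
  rw [Measure.volume_eq_prod] at h
  have h' := Measure.ae_ae_of_ae_prod h
  refine lintegral_congr_ae ?_
  filter_upwards [h'] with x hx
  congr 1
  refine lintegral_congr_ae ?_
  filter_upwards [hx] with y hy
  rw [hy]

lemma Nmix_smul (p q : ℝ) (hp : 0 < p) (hq : 0 < q) (c : ℝ≥0∞) (hc : c ≠ ∞) (G : Torus m × Torus k → ℝ≥0∞) :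
    Nmix p q (fun z => c * G z) = c^p * Nmix p q G := by
  unfold Nmix
  rw [← lintegral_const_mul' _ _ (ENNReal.rpow_ne_top_of_nonneg hp.le hc)]
  refine lintegral_congr fun x => ?_
  simp_rw [ENNReal.mul_rpow_of_nonneg _ _ hq.le]
  rw [lintegral_const_mul' _ _ (ENNReal.rpow_ne_top_of_nonneg hq.le hc), ENNReal.mul_rpow_of_nonneg _ _ (by positivity), ← ENNReal.rpow_mul]
  congr 2; field_simp

lemma Nmix_int (p q : ℝ) (hp : 1 < p) (hq : 1 < q) (G : Torus m × Torus k → ℝ≥0∞) (hG : Measurable G) (h : Nmix p q G ≠ ∞) :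
    ∫⁻ z, G z ≠ ∞ := by
  have hp0 : 0 < p := by linarith
  have hq0 : 0 < q := by linarith
  have h1 : (∫⁻ z, G z)^p ≤ Nmix p q G := by
    rw [Measure.volume_eq_prod, lintegral_prod _ hG.aemeasurable]
    have h2 := avg_jensen (μ := (volume : Measure (Torus m))) (c := 1) measure_univ one_ne_zero ENNReal.one_ne_top
      (fun x => ∫⁻ y, G (x,y)) hG.lintegral_prod_right'.aemeasurable p hp
    simp only [inv_one, one_mul] at h2
    refine h2.trans ?_
    unfold Nmix
    refine lintegral_mono fun x => ?_
    have h3 := avg_jensen (μ := (volume : Measure (Torus k))) (c := 1) measure_univ one_ne_zero ENNReal.one_ne_top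
      (fun y => G (x,y)) (hG.comp measurable_prodMk_left).aemeasurable q hq
    simp only [inv_one, one_mul] at h3
    calc (∫⁻ y, G (x,y))^p = ((∫⁻ y, G (x,y))^q)^(p/q) := by rw [← ENNReal.rpow_mul]; congr 1; field_simp
      _ ≤ _ := by gcongr
  intro hT
  rw [hT, ENNReal.top_rpow_of_pos hp0] at h1
  exact h (top_le_iff.1 h1)

lemma mixedNorm_eq (r q : ℝ) (hr : 0 < r) (hq : 0 < q) (f : Torus m × Torus k → ℂ) :
    mixedNorm (ENNReal.ofReal r) (ENNReal.ofReal q) f = (Nmix r q (fun z => ‖f z‖ₑ))^(1/r) := by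
  unfold mixedNorm eNorm Nmix
  rw [if_neg ENNReal.ofReal_ne_top, ENNReal.toReal_ofReal hr.le]
  congr 1
  refine lintegral_congr fun x => ?_
  simp only
  rw [if_neg ENNReal.ofReal_ne_top, ENNReal.toReal_ofReal hq.le, ← ENNReal.rpow_mul]
  congr 1; field_simp

lemma Nmix_ae_top (p q : ℝ) (hp : 0 < p) (hq : 0 < q) (G : Torus m × Torus k → ℝ≥0∞) (hG : Measurable G) (h : Nmix p q G ≠ ∞) :
    ∀ᵐ z, G z < ∞ := by
  have hm : Measurable fun z => G z ^ q := hG.pow_const q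
  have h1 : ∀ᵐ x : Torus m, (∫⁻ y, G (x,y)^q)^(p/q) < ∞ :=
    ae_lt_top (hm.lintegral_prod_right'.pow_const _) h
  have h2 : ∀ᵐ x : Torus m, ∀ᵐ y : Torus k, G (x,y) < ∞ := by
    filter_upwards [h1] with x hx
    have h3 : ∫⁻ y, G (x,y)^q ≠ ∞ := by
      intro hT
      rw [hT, ENNReal.top_rpow_of_pos (by positivity)] at hx
      exact lt_irrefl _ hx
    filter_upwards [ae_lt_top (hm.comp measurable_prodMk_left) h3] with y hy
    by_contra hc
    rw [not_lt, top_le_iff] at hc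
    simp [hc, hq] at hy
  rw [Measure.volume_eq_prod]
  exact (Measure.ae_prod_mem_iff_ae_ae_mem (s := {z | G z < ∞}) (measurableSet_lt hG measurable_const)).2 h2
end Core

section Fin
variable {m k : ℕ} {φ : (Fin m → ℝ) × (Fin k → ℝ) → ℝ}

/-- `j`-th Littlewood-Paley density -/
def Pd (φ : (Fin m → ℝ) × (Fin k → ℝ) → ℝ) {ν : ℕ} (lam : Fin ν → ℝ) (v : Fin ν → Torus m × Torus k → ℂ) (j : ℕ) (z : Torus m × Torus k) : ℝ≥0∞ :=
  ∑ i, ENNReal.ofReal (lam i) * ‖mulOp (psy φ j) (v i) z‖ₑ^2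

/-- full Littlewood-Paley density -/
def De (φ : (Fin m → ℝ) × (Fin k → ℝ) → ℝ) {ν : ℕ} (lam : Fin ν → ℝ) (v : Fin ν → Torus m × Torus k → ℂ) (z : Torus m × Torus k) : ℝ≥0∞ :=
  ∑' j, Pd φ lam v j z

/-- density -/
def Dn {ν : ℕ} (lam : Fin ν → ℝ) (v : Fin ν → Torus m × Torus k → ℂ) (z : Torus m × Torus k) : ℝ≥0∞ :=
  ∑ i, ENNReal.ofReal (lam i) * ‖v i z‖ₑ^2

lemma Pd_meas (hφ : IsLPCutoff φ) {ν : ℕ} (lam : Fin ν → ℝ) (v : Fin ν → Torus m × Torus k → ℂ) (j : ℕ) : Measurable (Pd φ lam v j) := by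
  unfold Pd
  refine Finset.measurable_fun_sum _ fun i _ => ?_
  exact ((mulOp_cont _ (psy_FS hφ j) (v i)).measurable.enorm.pow_const 2).const_mul _

lemma De_meas (hφ : IsLPCutoff φ) {ν : ℕ} (lam : Fin ν → ℝ) (v : Fin ν → Torus m × Torus k → ℂ) : Measurable (De φ lam v) :=
  Measurable.tsum fun j => Pd_meas hφ lam v j

lemma enorm_sqrt_mul (a : ℝ) (ha : 0 < a) (c : ℂ) : ‖((Real.sqrt a : ℝ) : ℂ) * c‖ₑ^2 = ENNReal.ofReal a * ‖c‖ₑ^2 := by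
  rw [enorm_mul, mul_pow]
  congr 1
  rw [← ofReal_norm, Complex.norm_real, Real.norm_of_nonneg (Real.sqrt_nonneg _), ← ENNReal.ofReal_pow (Real.sqrt_nonneg _), Real.sq_sqrt ha.le]

lemma main_op (hφ : IsLPCutoff φ) (r q : ℝ) (hr : 1/2 < r) (hq : 1/2 < q) : ∃ C : ℝ, 0 ≤ C ∧ ∀ J ν : ℕ, ∀ F : Torus m × Torus k → HS J ν,
    StronglyMeasurable F → Integrable F → Nmix r q (fun z => ‖TT (gg φ) J ν F z‖ₑ^2) ≤ ENNReal.ofReal C * Nmix r q (fun z => ‖F z‖ₑ^2) := by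
  obtain ⟨B, hB, -⟩ := gg_Cl hφ
  obtain ⟨C, hC, h⟩ := cont_main m k B 2 (by norm_num) (gg φ) hB (gg_Sup hφ) 2 (psy_L hφ) (2*r) (2*q) (by linarith) (by linarith)
  refine ⟨C, hC, fun J ν F hF hFi => ?_⟩
  rw [Nmix_sq, Nmix_sq]
  exact h J ν F hF hFi

lemma core_upper (hφ : IsLPCutoff φ) (r q : ℝ) (hr : 1/2 < r) (hq : 1/2 < q) : ∃ C : ℝ, 0 ≤ C ∧
    ∀ (ν : ℕ) (lam : Fin ν → ℝ) (_ : ∀ i, 0 < lam i) (v : Fin ν → Torus m × Torus k → ℂ), (∀ i, StronglyMeasurable (v i)) → (∀ i, Integrable (v i)) →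
      Nmix r q (De φ lam v) ≤ ENNReal.ofReal C * Nmix r q (Dn lam v) := by
  obtain ⟨C, hC, h⟩ := main_op hφ r q hr hq
  refine ⟨C, hC, fun ν lam hlam v hv hvi => ?_⟩
  have hr0 : 0 < r := by linarith
  have hq0 : 0 < q := by linarith
  refine (Nmix_fatou r q hr0 hq0 (fun J z => ∑ j ∈ Finset.range J, Pd φ lam v j z) (De φ lam v) ?_ ?_).trans ?_
  · intro J
    exact Finset.measurable_fun_sum _ fun j _ => Pd_meas hφ lam v j
  · exact Filter.Eventually.of_forall fun z => ENNReal.tendsto_nat_tsum _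
  refine Filter.liminf_le_of_frequently_le' (Filter.Frequently.of_forall fun J => ?_)
  set F : Torus m × Torus k → HS J ν := fun w => WithLp.toLp 2 (fun t => if t.1 = none then ((Real.sqrt (lam t.2) : ℝ) : ℂ) * v t.2 w else 0) with hF
  have hFm : StronglyMeasurable F := by
    refine Measurable.stronglyMeasurable ?_
    refine (WithLp.measurable_toLp 2 _).comp (measurable_pi_lambda _ fun t => ?_)
    split_ifs
    · exact (hv _).measurable.const_mul _
    · exact measurable_const
  have hFi : Integrable F := by
    refine Integrable.of_eval_piLp fun t => ?_
    simp only [hF]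
    split_ifs
    · exact (hvi _).const_mul _
    · exact integrable_zero _ _ _
  have h1 : (fun z => ‖F z‖ₑ^2) = Dn lam v := by
    funext z
    rw [HS_enorm]
    simp [hF, Dn, -enorm_mul, enorm_sqrt_mul _ (hlam _)]
  rw [← h1]
  refine (Nmix_mono r q hr0 hq0 _ _ fun z => ?_).trans (h J ν F hFm hFi)
  rw [HS_enorm]
  refine le_trans (le_of_eq ?_) le_add_self
  rw [Finset.sum_range]
  refine Finset.sum_congr rfl fun j _ => ?_
  refine Finset.sum_congr rfl fun i _ => ?_
  rw [TT_some hφ J ν F hFi]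
  have : (fun w => F w (none, i)) = fun w => ((Real.sqrt (lam i) : ℝ) : ℂ) * v i w := by
    funext w; simp [hF]
  rw [this, mulOp_smul, enorm_sqrt_mul _ (hlam i)]

lemma shift_sum (b : ℕ → ℝ≥0∞) (J : ℕ) : ∑ j ∈ Finset.range J, ∑ i ∈ Finset.Ico (j-1) (j+2), b i ≤ 4 * ∑' j, b j := by
  have h1 : ∀ j, ∑ i ∈ Finset.Ico (j-1) (j+2), b i ≤ b (j-1) + b j + b (j+1) := by
    intro j
    have hs : Finset.Ico (j-1) (j+2) ⊆ insert (j-1) ({j, j+1} : Finset ℕ) := by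
      intro x hx
      simp only [Finset.mem_Ico, Finset.mem_insert, Finset.mem_singleton] at *
      omega
    refine (Finset.sum_le_sum_of_subset hs).trans ?_
    rcases j with _ | j
    · simp only [Nat.zero_sub, zero_add, Finset.mem_insert, true_or, Finset.insert_eq_of_mem]
      rw [Finset.sum_pair (by simp), add_assoc]; exact le_add_self
    · rw [Finset.sum_insert (by simp; omega), Finset.sum_pair (by simp), ← add_assoc]
  have h2 : ∑ j ∈ Finset.range J, b j ≤ ∑' j, b j := ENNReal.sum_le_tsum _
  have h3 : ∑ j ∈ Finset.range J, b (j+1) ≤ ∑' j, b j :=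
    (ENNReal.sum_le_tsum _).trans (ENNReal.tsum_comp_le_tsum_of_injective (add_left_injective 1) b)
  have h4 : ∑ j ∈ Finset.range J, b (j-1) ≤ 2 * ∑' j, b j := by
    rcases J with _ | J
    · simp
    · rw [Finset.sum_range_succ', two_mul]
      exact add_le_add (ENNReal.sum_le_tsum _) (ENNReal.le_tsum _)
  calc _ ≤ ∑ j ∈ Finset.range J, (b (j-1) + b j + b (j+1)) := Finset.sum_le_sum fun j _ => h1 j
    _ = ∑ j ∈ Finset.range J, b (j-1) + ∑ j ∈ Finset.range J, b j + ∑ j ∈ Finset.range J, b (j+1) := by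
      rw [Finset.sum_add_distrib, Finset.sum_add_distrib]
    _ ≤ 2 * (∑' j, b j) + (∑' j, b j) + ∑' j, b j := by gcongr
    _ = _ := by ring

lemma enorm_sum_sq (s : Finset ℕ) (hs : s.card ≤ 3) (a : ℕ → ℂ) : ‖∑ i ∈ s, a i‖ₑ^2 ≤ 3 * ∑ i ∈ s, ‖a i‖ₑ^2 := by
  have h1 : ‖∑ i ∈ s, a i‖^2 ≤ 3 * ∑ i ∈ s, ‖a i‖^2 := by
    calc ‖∑ i ∈ s, a i‖^2 ≤ (∑ i ∈ s, ‖a i‖)^2 := by gcongr; exact norm_sum_le _ _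
      _ ≤ s.card * ∑ i ∈ s, ‖a i‖^2 := sq_sum_le_card_mul_sum_sq
      _ ≤ 3 * ∑ i ∈ s, ‖a i‖^2 := by gcongr; exact_mod_cast hs
  have h2 := ENNReal.ofReal_le_ofReal h1
  rw [ENNReal.ofReal_mul (by norm_num), ENNReal.ofReal_sum_of_nonneg (fun _ _ => by positivity), ENNReal.ofReal_pow (norm_nonneg _), ofReal_norm] at h2
  simpa [ENNReal.ofReal_pow, ofReal_norm] using h2

lemma core_lower (hφ : IsLPCutoff φ) (r q : ℝ) (hr : 1/2 < r) (hq : 1/2 < q) : ∃ C : ℝ, 0 ≤ C ∧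
    ∀ (ν : ℕ) (lam : Fin ν → ℝ) (_ : ∀ i, 0 < lam i) (v : Fin ν → Torus m × Torus k → ℂ), (∀ i, StronglyMeasurable (v i)) → (∀ i, Integrable (v i)) →
      Nmix r q (Dn lam v) ≤ ENNReal.ofReal C * Nmix r q (De φ lam v) := by
  obtain ⟨C, hC, h⟩ := main_op hφ r q hr hq
  refine ⟨C * 12^r, by positivity, fun ν lam hlam v hv hvi => ?_⟩
  have hr0 : 0 < r := by linarith
  have hq0 : 0 < q := by linarith
  obtain ⟨ns, hns⟩ := S_ae hφ ν v hv hvi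
  refine (Nmix_fatou r q hr0 hq0 (fun l z => ∑ i, ENNReal.ofReal (lam i) * ‖mulOp (csym φ (ns l + 1)) (v i) z‖ₑ^2) (Dn lam v) ?_ ?_).trans ?_
  · intro l
    refine Finset.measurable_fun_sum _ fun i _ => ?_
    exact ((mulOp_cont _ (csym_FS hφ _) (v i)).measurable.enorm.pow_const 2).const_mul _
  · filter_upwards [hns] with z hz
    refine tendsto_finsetSum _ fun i _ => ?_
    refine ENNReal.Tendsto.const_mul ?_ (Or.inr ENNReal.ofReal_ne_top)
    exact ENNReal.Tendsto.pow (hz i).enorm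
  refine Filter.liminf_le_of_frequently_le' (Filter.Frequently.of_forall fun l => ?_)
  set J := ns l + 1 with hJ
  have hFS : ∀ j, FS (fun ξ => ∑ i ∈ Finset.Ico (j-1) (j+2), psy φ i ξ) := by
    intro j
    choose s hs using psy_FS hφ
    refine ⟨(Finset.Ico (j-1) (j+2)).biUnion s, fun ξ hξ => Finset.sum_eq_zero fun i hi => hs i ξ ?_⟩
    intro hc
    exact hξ (Finset.mem_biUnion.2 ⟨i, hi, hc⟩)
  set G : ℕ → Fin ν → Torus m × Torus k → ℂ := fun j i => mulOp (fun ξ => ∑ i ∈ Finset.Ico (j-1) (j+2), psy φ i ξ) (v i) with hG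
  have hGc : ∀ j i, Continuous (G j i) := fun j i => mulOp_cont _ (hFS j) _
  set F : Torus m × Torus k → HS J ν := fun w => WithLp.toLp 2
    (fun t => t.1.elim 0 (fun j => ((Real.sqrt (lam t.2) : ℝ) : ℂ) * G j t.2 w)) with hF
  have hFc : Continuous F := by
    refine (PiLp.continuous_toLp 2 _).comp (continuous_pi fun t => ?_)
    obtain ⟨t, i⟩ := t
    rcases t with _ | j
    · exact continuous_const
    · exact continuous_const.mul (hGc j i)
  have hFi : Integrable F := cont_integrable F hFc
  have h1 : ∀ z, ‖F z‖ₑ^2 ≤ 12 * De φ lam v z := by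
    intro z
    rw [HS_enorm]
    have e1 : ∀ i, F z (none, i) = 0 := fun i => rfl
    have e2 : ∀ j i, F z (some j, i) = ((Real.sqrt (lam i) : ℝ) : ℂ) * G j i z := fun j i => rfl
    simp_rw [e1, e2, enorm_sqrt_mul _ (hlam _)]
    simp only [enorm_zero, ne_eq, OfNat.ofNat_ne_zero, not_false_eq_true, zero_pow, Finset.sum_const_zero, zero_add]
    rw [← Finset.sum_range (fun j => ∑ i, ENNReal.ofReal (lam i) * ‖G j i z‖ₑ^2)]
    calc _ ≤ ∑ j ∈ Finset.range J, 3 * ∑ i' ∈ Finset.Ico (j-1) (j+2), Pd φ lam v i' z := by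
          refine Finset.sum_le_sum fun j _ => ?_
          unfold Pd
          rw [Finset.sum_comm, Finset.mul_sum]
          refine Finset.sum_le_sum fun i _ => ?_
          rw [← Finset.mul_sum, mul_left_comm]
          gcongr
          simp only [hG]
          rw [mulOp_sum _ _ (psy_FS hφ)]
          refine enorm_sum_sq _ ?_ _
          rw [Nat.card_Ico]; omega
      _ = 3 * ∑ j ∈ Finset.range J, ∑ i' ∈ Finset.Ico (j-1) (j+2), Pd φ lam v i' z := by rw [Finset.mul_sum]
      _ ≤ 3 * (4 * ∑' j, Pd φ lam v j z) := by gcongr; exact shift_sum _ _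
      _ = _ := by unfold De; rw [← mul_assoc]; norm_num
  have h2 : ∀ z, ∑ i, ENNReal.ofReal (lam i) * ‖mulOp (csym φ J) (v i) z‖ₑ^2 ≤ ‖TT (gg φ) J ν F z‖ₑ^2 := by
    intro z
    rw [HS_enorm]
    refine le_trans (le_of_eq ?_) le_self_add
    refine Finset.sum_congr rfl fun i _ => ?_
    rw [TT_none hφ J ν F hFi]
    have e3 : ∀ j : Fin J, mulOp (psy φ j) (fun w => F w (some j, i)) z = ((Real.sqrt (lam i) : ℝ) : ℂ) * mulOp (psy φ j) (v i) z := by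
      intro j
      have : (fun w => F w (some j, i)) = fun w => ((Real.sqrt (lam i) : ℝ) : ℂ) * G j i w := rfl
      rw [this, mulOp_smul]
      simp only [hG]
      rw [mulOp_mulOp _ _ (hFS j)]
      simp_rw [psy_tilde hφ]
    simp_rw [e3]
    rw [← Finset.mul_sum, enorm_sqrt_mul _ (hlam i), ← Finset.sum_range (fun j => mulOp (psy φ j) (v i) z), ← mulOp_sum _ _ (psy_FS hφ)]
    simp_rw [psy_sum]
  calc _ ≤ Nmix r q (fun z => ‖TT (gg φ) J ν F z‖ₑ^2) := Nmix_mono r q hr0 hq0 _ _ h2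
    _ ≤ ENNReal.ofReal C * Nmix r q (fun z => ‖F z‖ₑ^2) := h J ν F hFc.stronglyMeasurable hFi
    _ ≤ ENNReal.ofReal C * Nmix r q (fun z => 12 * De φ lam v z) := by gcongr; exact Nmix_mono r q hr0 hq0 _ _ h1
    _ = _ := by
      rw [Nmix_smul r q hr0 hq0 12 (by norm_num), ENNReal.ofReal_mul hC, ← ENNReal.ofReal_rpow_of_pos (by norm_num), mul_assoc]
      norm_num
end Fin

section Fin2
variable {m k : ℕ} {φ : (Fin m → ℝ) × (Fin k → ℝ) → ℝ}

lemma ofReal_Pd {ν : ℕ} (lam : Fin ν → ℝ) (hlam : ∀ i, 0 < lam i) (c : Fin ν → ℂ) :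
    ENNReal.ofReal (∑ i, lam i * ‖c i‖^2) = ∑ i, ENNReal.ofReal (lam i) * ‖c i‖ₑ^2 := by
  rw [ENNReal.ofReal_sum_of_nonneg (fun i _ => mul_nonneg (hlam i).le (by positivity))]
  refine Finset.sum_congr rfl fun i _ => ?_
  rw [ENNReal.ofReal_mul (hlam i).le, ENNReal.ofReal_pow (norm_nonneg _), ofReal_norm]

lemma enorm_ofReal_nn (a : ℝ) (ha : 0 ≤ a) : ‖(a : ℂ)‖ₑ = ENNReal.ofReal a := by
  rw [← ofReal_norm, Complex.norm_real, Real.norm_of_nonneg ha]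

lemma De_lt_top (hφ : IsLPCutoff φ) (r q : ℝ) (hr : 1/2 < r) (hq : 1/2 < q) {ν : ℕ} (lam : Fin ν → ℝ) (v : Fin ν → Torus m × Torus k → ℂ)
    (hv : ∀ i, StronglyMeasurable (v i)) (hvi : ∀ i, Integrable (v i)) (hfin : ∀ i, Nmix (2*r) (2*q) (fun z => ‖v i z‖ₑ) ≠ ∞) :
    ∀ᵐ z, De φ lam v z < ∞ := by
  have hr0 : 0 < r := by linarith
  have hq0 : 0 < q := by linarith
  obtain ⟨C, hC, h⟩ := core_upper (φ := φ) hφ r q hr hq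
  have h1 : ∀ i, ∀ᵐ z, De φ (fun _ : Fin 1 => 1) (fun _ => v i) z < ∞ := by
    intro i
    refine Nmix_ae_top r q hr0 hq0 _ (De_meas hφ _ _) ?_
    refine ne_top_of_le_ne_top ?_ (h 1 (fun _ => 1) (fun _ => one_pos) (fun _ => v i) (fun _ => hv i) (fun _ => hvi i))
    have : Dn (fun _ : Fin 1 => (1:ℝ)) (fun _ => v i) = fun z => ‖v i z‖ₑ^2 := by
      funext z; simp [Dn]
    rw [this, Nmix_sq]
    exact ENNReal.mul_ne_top ENNReal.ofReal_ne_top (hfin i)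
  filter_upwards [ae_all_iff.2 h1] with z hz
  have h2 : De φ lam v z = ∑ i, ENNReal.ofReal (lam i) * De φ (fun _ : Fin 1 => 1) (fun _ => v i) z := by
    unfold De Pd
    simp_rw [← ENNReal.tsum_mul_left]
    rw [← Summable.tsum_finsetSum (fun _ _ => ENNReal.summable)]
    simp
  rw [h2]
  exact ENNReal.sum_lt_top.2 fun i _ => ENNReal.mul_lt_top ENNReal.ofReal_lt_top (hz i)

lemma rpow_bound (r C : ℝ) (hr : 0 < r) (hC : 0 ≤ C) (a b : ℝ≥0∞) (h : a ≤ ENNReal.ofReal C * b) :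
    a^(1/r) ≤ ENNReal.ofReal (C^(1/r)) * b^(1/r) := by
  rw [← ENNReal.ofReal_rpow_of_nonneg hC (by positivity), ← ENNReal.mul_rpow_of_nonneg _ _ (by positivity)]
  gcongr

end Fin2

/-- Vector-valued Littlewood–Paley theorem for operator densities: for
`1/2 < r, r̃ < ∞`, positive weights `(λ_k)` and functions
`(u_k) ⊂ L^{2r}_x L^{2r̃}_y(𝕋^m × 𝕋^k)`, there is `C > 1` independent of the number
of terms and of `(λ_k)`, `(u_k)`, such that
`C⁻¹ ‖∑_k λ_k |u_k|²‖ ≤ ‖∑_{N ∈ 2^ℕ} ∑_k λ_k |P_N u_k|²‖ ≤ C ‖∑_k λ_k |u_k|²‖`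
in `L^r_x L^r̃_y`. -/
theorem vector_valued_littlewood_paley (m k : ℕ) (r rt : ℝ)
    (hr1 : 1 / 2 < r) (hrt1 : 1 / 2 < rt)
    (φ : (Fin m → ℝ) × (Fin k → ℝ) → ℝ) (hφ : IsLPCutoff φ) :
    ∃ C : ℝ, 1 < C ∧
      ∀ (n : ℕ) (lam : Fin n → ℝ), (∀ i, 0 < lam i) →
        ∀ u : Fin n → (Torus m × Torus k → ℂ),
          (∀ i, AEStronglyMeasurable (u i) volume) →
          (∀ i, mixedNorm (ENNReal.ofReal (2 * r)) (ENNReal.ofReal (2 * rt)) (u i) ≠ ∞) →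
          (ENNReal.ofReal C)⁻¹ *
              mixedNorm (ENNReal.ofReal r) (ENNReal.ofReal rt)
                (fun z => ((∑ i, lam i * ‖u i z‖ ^ 2 : ℝ) : ℂ)) ≤
            mixedNorm (ENNReal.ofReal r) (ENNReal.ofReal rt)
              (fun z => ((∑' j : ℕ, ∑ i, lam i * ‖lpProj φ j (u i) z‖ ^ 2 : ℝ) : ℂ)) ∧
          mixedNorm (ENNReal.ofReal r) (ENNReal.ofReal rt)
              (fun z => ((∑' j : ℕ, ∑ i, lam i * ‖lpProj φ j (u i) z‖ ^ 2 : ℝ) : ℂ)) ≤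
            ENNReal.ofReal C *
              mixedNorm (ENNReal.ofReal r) (ENNReal.ofReal rt)
                (fun z => ((∑ i, lam i * ‖u i z‖ ^ 2 : ℝ) : ℂ)) := by
  have hr0 : 0 < r := by linarith
  have hq0 : 0 < rt := by linarith
  obtain ⟨C₁, hC₁, hup⟩ := core_upper (φ := φ) hφ r rt hr1 hrt1
  obtain ⟨C₂, hC₂, hlo⟩ := core_lower (φ := φ) hφ r rt hr1 hrt1
  have hp1 : 0 ≤ C₁^(1/r) := by positivity
  have hp2 : 0 ≤ C₂^(1/r) := by positivity
  refine ⟨C₁^(1/r) + C₂^(1/r) + 2, by linarith, fun n lam hlam u hu hfin => ?_⟩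
  set v : Fin n → Torus m × Torus k → ℂ := fun i => (hu i).mk (u i) with hvdef
  have hv : ∀ i, StronglyMeasurable (v i) := fun i => (hu i).stronglyMeasurable_mk
  have huv : ∀ i, u i =ᵐ[volume] v i := fun i => (hu i).ae_eq_mk
  have hfin' : ∀ i, Nmix (2*r) (2*rt) (fun z => ‖v i z‖ₑ) ≠ ∞ := by
    intro i hT
    apply hfin i
    rw [mixedNorm_eq _ _ (by linarith) (by linarith)]
    rw [Nmix_congr _ _ _ (fun z => ‖v i z‖ₑ) ((huv i).mono fun z hz => by simp only [hz]), hT]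
    exact ENNReal.top_rpow_of_pos (by positivity)
  have hvi : ∀ i, Integrable (v i) := fun i =>
    ⟨(hv i).aestronglyMeasurable, (Nmix_int _ _ (by linarith) (by linarith) _ (hv i).enorm (hfin' i)).lt_top⟩
  have hD : mixedNorm (ENNReal.ofReal r) (ENNReal.ofReal rt) (fun z => ((∑ i, lam i * ‖u i z‖ ^ 2 : ℝ) : ℂ)) =
      (Nmix r rt (Dn lam v))^(1/r) := by
    rw [mixedNorm_eq _ _ hr0 hq0]
    congr 1
    refine Nmix_congr _ _ _ _ ?_
    filter_upwards [ae_all_iff.2 huv] with z hz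
    rw [enorm_ofReal_nn _ (Finset.sum_nonneg fun i _ => mul_nonneg (hlam i).le (by positivity)), ofReal_Pd lam hlam]
    simp only [hz, Dn]
  have hE : mixedNorm (ENNReal.ofReal r) (ENNReal.ofReal rt)
      (fun z => ((∑' j : ℕ, ∑ i, lam i * ‖lpProj φ j (u i) z‖ ^ 2 : ℝ) : ℂ)) =
      (Nmix r rt (De φ lam v))^(1/r) := by
    rw [mixedNorm_eq _ _ hr0 hq0]
    congr 1
    refine Nmix_congr _ _ _ _ ?_
    filter_upwards [De_lt_top hφ r rt hr1 hrt1 lam v hv hvi hfin'] with z hz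
    have e1 : ∀ j i, lpProj φ j (u i) z = mulOp (psy φ j) (v i) z := fun j i => by
      rw [lpProj_eq, mulOp_congr _ _ _ (huv i)]
    simp_rw [e1]
    have e2 : ∀ j, 0 ≤ ∑ i, lam i * ‖mulOp (psy φ j) (v i) z‖^2 := fun j =>
      Finset.sum_nonneg fun i _ => mul_nonneg (hlam i).le (by positivity)
    have e3 : ∀ j, ENNReal.ofReal (∑ i, lam i * ‖mulOp (psy φ j) (v i) z‖^2) = Pd φ lam v j z := fun j =>
      ofReal_Pd lam hlam _
    have e4 : Summable fun j => ∑ i, lam i * ‖mulOp (psy φ j) (v i) z‖^2 := by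
      have h5 : ∑' j, ENNReal.ofReal (∑ i, lam i * ‖mulOp (psy φ j) (v i) z‖^2) ≠ ∞ := by
        simp_rw [e3]; exact hz.ne
      have h6 := ENNReal.summable_toReal h5
      refine h6.congr fun j => ?_
      rw [ENNReal.toReal_ofReal (e2 j)]
    rw [enorm_ofReal_nn _ (tsum_nonneg e2), ENNReal.ofReal_tsum_of_nonneg e2 e4]
    simp_rw [e3]
    rfl
  rw [hD, hE]
  have hu' := rpow_bound r C₁ hr0 hC₁ _ _ (hup n lam hlam v hv hvi)
  have hl' := rpow_bound r C₂ hr0 hC₂ _ _ (hlo n lam hlam v hv hvi)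
  constructor
  · rw [ENNReal.inv_mul_le_iff (ENNReal.ofReal_pos.2 (by linarith)).ne' ENNReal.ofReal_ne_top]
    refine hl'.trans ?_
    gcongr
    linarith
  · refine hu'.trans ?_
    gcongr
    linarith

end
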